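/- Let α be a real algebraic number of degree at least three, and let (a_ℓ)_{ℓ≥1} be the sequence of partial quotients of its continued fraction expansion. Then the sequence (a_ℓ)_{ℓ≥1} cannot be generated by a binary morphism; that is, there do not exist a two-letter alphabet A, a prolongable morphism σ on A with fixed point a, and a coding φ such that (a_ℓ)_{ℓ≥1} = φ(a). -/

import Mathlib

open Filter Topology

/-- The `n`-th iterate of the morphism `σ` (given by its action on letters and
extended to the free monoid by concatenation) applied to the word `W`. -/
def iterM {A : Type*} (σ : A → List A) (n : ℕ) (W : List A) : List A :=
  (fun L => L.flatMap σ)^[n] W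

/-- The morphism `σ` is prolongable on the letter `l`: `σ l = l W` for a word `W`
such that `σ^n(W)` is non-empty for every `n ≥ 0`. -/
def Prolongable {A : Type*} (σ : A → List A) (l : A) : Prop :=
  ∃ W : List A, σ l = l :: W ∧ ∀ n : ℕ, iterM σ n W ≠ []

/-- The infinite word `x` is the fixed point of the prolongable morphism `σ`
starting from the letter `l`: every word `σ^n(l)` is a prefix of `x`. -/
def IsFixedPointSeq {A : Type*} (σ : A → List A) (l : A) (x : ℕ → A) : Prop :=
  ∀ n i, i < (iterM σ n [l]).length → (iterM σ n [l])[i]? = some (x i)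

/-- Numerators of the convergents of `[a_0; a_1, a_2, …]` where `a i` denotes the
partial quotient `a_{i+1}`: `p_0 = a_0`, `p_1 = a_1 a_0 + 1`, `p_{ℓ+1} = a_{ℓ+1} p_ℓ + p_{ℓ-1}`. -/
def cvP (a0 : ℤ) (a : ℕ → ℕ) : ℕ → ℤ
  | 0 => a0
  | 1 => (a 0 : ℤ) * a0 + 1
  | n + 2 => (a (n + 1) : ℤ) * cvP a0 a (n + 1) + cvP a0 a n

/-- Denominators of the convergents of `[a_0; a_1, a_2, …]`:
`q_0 = 1`, `q_1 = a_1`, `q_{ℓ+1} = a_{ℓ+1} q_ℓ + q_{ℓ-1}`. -/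
def cvQ (a : ℕ → ℕ) : ℕ → ℤ
  | 0 => 1
  | 1 => (a 0 : ℤ)
  | n + 2 => (a (n + 1) : ℤ) * cvQ a (n + 1) + cvQ a n


section

open MvPolynomial

/-- weighted `ℓ¹` norm of the coefficients -/
noncomputable def wn {τ : Type*} (w : τ → ℝ) (F : MvPolynomial τ ℝ) : ℝ :=
  ∑ μ ∈ F.support, |F.coeff μ| * μ.prod (fun h k => w h ^ k)

section wn
variable {τ ρ : Type*} {w : τ → ℝ}

lemma wprod_nonneg (hw : ∀ h, 0 ≤ w h) (μ : τ →₀ ℕ) : 0 ≤ μ.prod (fun h k => w h ^ k) :=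
  Finset.prod_nonneg fun _ _ => pow_nonneg (hw _) _

lemma wn_eq {F : MvPolynomial τ ℝ} {S : Finset (τ →₀ ℕ)} (h : F.support ⊆ S) :
    wn w F = ∑ μ ∈ S, |F.coeff μ| * μ.prod (fun h k => w h ^ k) := by
  unfold wn
  refine Finset.sum_subset h ?_
  intro x _ hx
  rw [MvPolynomial.notMem_support_iff] at hx
  simp [hx]

lemma wn_nonneg (hw : ∀ h, 0 ≤ w h) (F : MvPolynomial τ ℝ) : 0 ≤ wn w F :=
  Finset.sum_nonneg fun _ _ => mul_nonneg (abs_nonneg _) (wprod_nonneg hw _)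

lemma wn_zero : wn w (0 : MvPolynomial τ ℝ) = 0 := by simp [wn]

lemma wn_add_le (hw : ∀ h, 0 ≤ w h) (F G : MvPolynomial τ ℝ) : wn w (F + G) ≤ wn w F + wn w G := by
  classical
  rw [wn_eq (F := F + G) (S := F.support ∪ G.support) MvPolynomial.support_add,
    wn_eq (F := F) (S := F.support ∪ G.support) Finset.subset_union_left,
    wn_eq (F := G) (S := F.support ∪ G.support) Finset.subset_union_right, ← Finset.sum_add_distrib]
  refine Finset.sum_le_sum fun μ _ => ?_
  rw [← add_mul, coeff_add]
  exact mul_le_mul_of_nonneg_right (abs_add_le _ _) (wprod_nonneg hw _)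

lemma wn_sum_le (hw : ∀ h, 0 ≤ w h) {ι : Type*} (s : Finset ι) (f : ι → MvPolynomial τ ℝ) :
    wn w (∑ i ∈ s, f i) ≤ ∑ i ∈ s, wn w (f i) := by
  classical
  induction s using Finset.induction_on with
  | empty => simp [wn_zero]
  | insert a s ha ih =>
    rw [Finset.sum_insert ha, Finset.sum_insert ha]
    exact (wn_add_le hw _ _).trans (by linarith)

lemma wn_monomial (μ : τ →₀ ℕ) (c : ℝ) :
    wn w (monomial μ c) = |c| * μ.prod (fun h k => w h ^ k) := by
  classical
  rw [wn_eq (S := {μ}) MvPolynomial.support_monomial_subset]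
  simp

lemma wn_mul_le (hw : ∀ h, 0 ≤ w h) (F G : MvPolynomial τ ℝ) : wn w (F * G) ≤ wn w F * wn w G := by
  classical
  have h1 : F * G = ∑ μ ∈ F.support, ∑ ν ∈ G.support, monomial (μ + ν) (F.coeff μ * G.coeff ν) := by
    conv_lhs => rw [F.as_sum, G.as_sum]
    rw [Finset.sum_mul_sum]
    simp [monomial_mul]
  rw [h1]
  refine (wn_sum_le hw _ _).trans ?_
  unfold wn
  rw [Finset.sum_mul_sum]
  refine Finset.sum_le_sum fun μ _ => (wn_sum_le hw _ _).trans ?_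
  refine Finset.sum_le_sum fun ν _ => ?_
  rw [wn_monomial, Finsupp.prod_add_index' (by simp) (by intros; rw [pow_add]), abs_mul]
  apply le_of_eq; ring

lemma wn_C (c : ℝ) : wn w (C c) = |c| := by
  rw [← monomial_zero', wn_monomial]; simp

lemma wn_one : wn w (1 : MvPolynomial τ ℝ) = 1 := by
  rw [← C_1, wn_C]; simp

lemma wn_X (h : τ) : wn w (X h) = w h := by
  rw [X, wn_monomial]; simp

lemma wn_pow_le (hw : ∀ h, 0 ≤ w h) (F : MvPolynomial τ ℝ) (n : ℕ) : wn w (F ^ n) ≤ wn w F ^ n := by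
  induction n with
  | zero => simp [wn_one]
  | succ n ih =>
    rw [pow_succ, pow_succ]
    exact (wn_mul_le hw _ _).trans (mul_le_mul_of_nonneg_right ih (wn_nonneg hw _))

lemma wn_prod_le (hw : ∀ h, 0 ≤ w h) {ι : Type*} (s : Finset ι) (f : ι → MvPolynomial τ ℝ) :
    wn w (∏ i ∈ s, f i) ≤ ∏ i ∈ s, wn w (f i) := by
  classical
  induction s using Finset.induction_on with
  | empty => simp [wn_one]
  | insert a s ha ih =>
    rw [Finset.prod_insert ha, Finset.prod_insert ha]
    exact (wn_mul_le hw _ _).trans (mul_le_mul_of_nonneg_left ih (wn_nonneg hw _))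

lemma wn_aeval_le (hw : ∀ h, 0 ≤ w h) (f : ρ → MvPolynomial τ ℝ) (F : MvPolynomial ρ ℝ) :
    wn w (aeval f F) ≤ wn (fun h => wn w (f h)) F := by
  conv_lhs => rw [F.as_sum, map_sum]
  refine (wn_sum_le hw _ _).trans ?_
  unfold wn
  refine Finset.sum_le_sum fun μ _ => ?_
  rw [aeval_monomial]
  refine (wn_mul_le hw _ _).trans ?_
  rw [MvPolynomial.algebraMap_eq, wn_C]
  refine mul_le_mul_of_nonneg_left ?_ (abs_nonneg _)
  refine (wn_prod_le hw _ _).trans ?_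
  exact Finset.prod_le_prod (fun _ _ => wn_nonneg hw _) (fun _ _ => wn_pow_le hw _ _)

lemma coeff_le_wn (hw : ∀ h, 0 ≤ w h) (F : MvPolynomial τ ℝ) (μ : τ →₀ ℕ) :
    |F.coeff μ| * μ.prod (fun h k => w h ^ k) ≤ wn w F := by
  classical
  rw [wn_eq (S := insert μ F.support) (Finset.subset_insert _ _)]
  exact Finset.single_le_sum (f := fun μ => |F.coeff μ| * μ.prod (fun h k => w h ^ k))
    (fun _ _ => mul_nonneg (abs_nonneg _) (wprod_nonneg hw _)) (Finset.mem_insert_self _ _)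

lemma wn_mono (hw : ∀ h, 0 ≤ w h) {w' : τ → ℝ} (h : ∀ h, w h ≤ w' h) (F : MvPolynomial τ ℝ) :
    wn w F ≤ wn w' F := by
  unfold wn
  refine Finset.sum_le_sum fun μ _ => mul_le_mul_of_nonneg_left ?_ (abs_nonneg _)
  exact Finset.prod_le_prod (fun _ _ => pow_nonneg (hw _) _)
    (fun i _ => pow_le_pow_left₀ (hw i) (h i) _)

/-- length -/
noncomputable def ln1 (F : MvPolynomial τ ℝ) : ℝ := wn (fun _ => 1) F

lemma ln1_eq (F : MvPolynomial τ ℝ) : ln1 F = ∑ μ ∈ F.support, |F.coeff μ| := by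
  simp [ln1, wn, Finsupp.prod]

lemma coeff_le_ln1 (F : MvPolynomial τ ℝ) (μ : τ →₀ ℕ) : |F.coeff μ| ≤ ln1 F := by
  have := coeff_le_wn (w := fun _ : τ => (1:ℝ)) (fun _ => zero_le_one) F μ
  simpa [Finsupp.prod, ln1] using this

lemma ln1_nonneg (F : MvPolynomial τ ℝ) : 0 ≤ ln1 F := wn_nonneg (fun _ => zero_le_one) F

lemma ln1_det_le {ι : Type*} [Fintype ι] [DecidableEq ι] (A : Matrix ι ι (MvPolynomial τ ℝ)) (B : ℝ)
    (hB : ∀ i j, ln1 (A i j) ≤ B) :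
    ln1 A.det ≤ (Fintype.card ι).factorial * B ^ (Fintype.card ι) := by
  rw [Matrix.det_apply]
  refine (wn_sum_le (fun _ => zero_le_one) _ _).trans ?_
  have : ∀ s ∈ (Finset.univ : Finset (Equiv.Perm ι)),
      wn (fun _ => 1) (Equiv.Perm.sign s • ∏ i, A (s i) i) ≤ B ^ (Fintype.card ι) := by
    intro s _
    have h1 : wn (fun _ => 1) (Equiv.Perm.sign s • ∏ i, A (s i) i)
        = wn (fun _ => 1) (∏ i, A (s i) i) := by
      rcases Int.units_eq_one_or (Equiv.Perm.sign s) with h | h <;> rw [h]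
      · simp
      · simp [wn]
    rw [h1]
    refine (wn_prod_le (fun _ => zero_le_one) _ _).trans ?_
    refine (Finset.prod_le_prod (fun _ _ => wn_nonneg (fun _ => zero_le_one) _) (fun i _ => hB _ _)).trans ?_
    simp
  refine (Finset.sum_le_sum this).trans ?_
  simp [Fintype.card_perm]

end wn

end

section

open MvPolynomial
/-! ### Hasse derivatives -/
/-- integrality of coefficients -/
def IsInt {τ : Type*} (F : MvPolynomial τ ℝ) : Prop := F ∈ (MvPolynomial.map (Int.castRingHom ℝ) : MvPolynomial τ ℤ →+* _).range

lemma isInt_iff {τ : Type*} (F : MvPolynomial τ ℝ) : IsInt F ↔ ∀ μ, ∃ n : ℤ, coeff μ F = n := by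
  unfold IsInt
  rw [← SetLike.mem_coe, RingHom.coe_range, MvPolynomial.mem_range_map_iff_coeffs_subset]
  constructor
  · intro h μ
    by_cases h0 : coeff μ F = 0
    · exact ⟨0, by simp [h0]⟩
    · have := h (coeff_mem_coeffs μ h0)
      obtain ⟨n, hn⟩ := this
      exact ⟨n, hn.symm⟩
  · intro h x hx
    rw [Finset.mem_coe, mem_coeffs_iff] at hx
    obtain ⟨n, _, rfl⟩ := hx
    obtain ⟨k, hk⟩ := h n
    exact ⟨k, hk.symm⟩

section hd
variable {τ : Type*} [Fintype τ]

/-- multi-binomial -/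
def mb (μ κ : τ →₀ ℕ) : ℕ := ∏ h, (μ h).choose (κ h)

noncomputable def hd (κ : τ →₀ ℕ) : MvPolynomial τ ℝ →ₗ[ℝ] MvPolynomial τ ℝ :=
  (basisMonomials τ ℝ).constr ℝ (fun μ => monomial (μ - κ) (mb μ κ : ℝ))

lemma hd_monomial (κ μ : τ →₀ ℕ) (c : ℝ) :
    hd κ (monomial μ c) = monomial (μ - κ) (c * (mb μ κ : ℝ)) := by
  have : (monomial μ c : MvPolynomial τ ℝ) = c • (basisMonomials τ ℝ μ) := by
    simp [smul_monomial]
  rw [this, map_smul, hd, Module.Basis.constr_basis, smul_monomial, smul_eq_mul]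

lemma mb_eq_zero {μ κ : τ →₀ ℕ} (h : ¬ κ ≤ μ) : mb μ κ = 0 := by
  rw [Finsupp.le_def] at h
  push Not at h
  obtain ⟨i, hi⟩ := h
  exact Finset.prod_eq_zero (Finset.mem_univ i) (Nat.choose_eq_zero_of_lt hi)

lemma coeff_hd (κ μ : τ →₀ ℕ) (F : MvPolynomial τ ℝ) :
    coeff μ (hd κ F) = coeff (μ + κ) F * (mb (μ + κ) κ : ℝ) := by
  classical
  induction F using MvPolynomial.induction_on' with
  | monomial ν c =>
    rw [hd_monomial, coeff_monomial, coeff_monomial]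
    by_cases hκ : κ ≤ ν
    · have : ν - κ = μ ↔ ν = μ + κ := by
        constructor
        · rintro rfl; rw [tsub_add_cancel_of_le hκ]
        · rintro rfl; simp
      simp only [this]
      split_ifs with h
      · rw [h]
      · simp
    · have : ¬ ν = μ + κ := by rintro rfl; exact hκ (by simp)
      rw [if_neg this, mb_eq_zero hκ]; simp
  | add p q hp hq => rw [map_add, coeff_add, coeff_add, hp, hq, add_mul]

lemma mem_support_hd {κ μ : τ →₀ ℕ} {F : MvPolynomial τ ℝ} (h : μ ∈ (hd κ F).support) :
    μ + κ ∈ F.support := by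
  rw [mem_support_iff, coeff_hd] at h
  rw [mem_support_iff]
  exact left_ne_zero_of_mul h

lemma mb_le (μ κ : τ →₀ ℕ) : mb μ κ ≤ 2 ^ (∑ h, μ h) := by
  rw [← Finset.prod_pow_eq_pow_sum]
  exact Finset.prod_le_prod' fun h _ => Nat.choose_le_two_pow _ _

lemma ln1_hd_le (κ : τ →₀ ℕ) (F : MvPolynomial τ ℝ) (N : ℕ) (hN : ∀ μ ∈ F.support, ∑ h, μ h ≤ N) :
    ln1 (hd κ F) ≤ 2 ^ N * ln1 F := by
  conv_lhs => rw [F.as_sum, map_sum]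
  refine (wn_sum_le (fun _ => zero_le_one) _ _).trans ?_
  rw [ln1_eq, Finset.mul_sum]
  refine Finset.sum_le_sum fun μ hμ => ?_
  rw [hd_monomial, wn_monomial, abs_mul]
  simp only [Finsupp.prod, one_pow, Finset.prod_const_one, mul_one, Nat.abs_cast]
  rw [mul_comm]
  refine mul_le_mul_of_nonneg_right ?_ (abs_nonneg _)
  have := (mb_le μ κ).trans (Nat.pow_le_pow_right (by norm_num) (hN μ hμ))
  exact_mod_cast this

lemma IsInt.hd {F : MvPolynomial τ ℝ} (hF : IsInt F) (κ : τ →₀ ℕ) : IsInt (hd κ F) := by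
  rw [isInt_iff] at hF ⊢
  intro μ
  obtain ⟨n, hn⟩ := hF (μ + κ)
  exact ⟨n * mb (μ + κ) κ, by rw [coeff_hd, hn]; push_cast; rfl⟩

/-- translation -/
noncomputable def trl (ξ : τ → ℝ) : MvPolynomial τ ℝ →ₐ[ℝ] MvPolynomial τ ℝ :=
  aeval (fun h => X h + C (ξ h))

lemma hd_mul_X [DecidableEq τ] (κ : τ →₀ ℕ) (i : τ) (F : MvPolynomial τ ℝ) :
    hd κ (F * X i) = hd κ F * X i + (if κ i = 0 then 0 else hd (κ - Finsupp.single i 1) F) := by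
  induction F using MvPolynomial.induction_on' with
  | add p q hp hq =>
    rw [add_mul, map_add, hp, hq, map_add]
    split_ifs
    · ring
    · rw [map_add]; ring
  | monomial ν c =>
    rw [X, monomial_mul, hd_monomial, hd_monomial, monomial_mul, mul_one]
    have key : ∀ κ : τ →₀ ℕ, mb ν κ = (ν i).choose (κ i) * ∏ h ∈ Finset.univ.erase i, (ν h).choose (κ h) := by
      intro κ
      rw [mb, Finset.mul_prod_erase _ (fun h => (ν h).choose (κ h)) (Finset.mem_univ i)]
    have key2 : mb (ν + Finsupp.single i 1) κ = (ν i + 1).choose (κ i) *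
        ∏ h ∈ Finset.univ.erase i, (ν h).choose (κ h) := by
      rw [mb, ← Finset.mul_prod_erase _ _ (Finset.mem_univ i)]
      congr 1
      · simp
      · refine Finset.prod_congr rfl fun h hh => ?_
        have : i ≠ h := (Finset.ne_of_mem_erase hh).symm
        simp [Finsupp.single_eq_of_ne' this]
    split_ifs with h0
    · rw [key2, key, h0]
      have : ν + Finsupp.single i 1 - κ = ν - κ + Finsupp.single i 1 := by
        ext h
        by_cases hh : i = h
        · subst hh; simp [h0]
        · simp [Finsupp.single_eq_of_ne' hh]
      rw [this]; simp
    · rw [hd_monomial]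
      have e1 : ν - (κ - Finsupp.single i 1) = ν + Finsupp.single i 1 - κ := by
        ext h
        by_cases hh : i = h
        · subst hh; simp; omega
        · simp [Finsupp.single_eq_of_ne' hh]
      have e3 : mb ν (κ - Finsupp.single i 1) = (ν i).choose (κ i - 1) *
          ∏ h ∈ Finset.univ.erase i, (ν h).choose (κ h) := by
        rw [key]
        congr 1
        · simp
        · refine Finset.prod_congr rfl fun h hh => ?_
          have : i ≠ h := (Finset.ne_of_mem_erase hh).symm
          simp [Finsupp.single_eq_of_ne' this]
      obtain ⟨k, hk⟩ := Nat.exists_eq_succ_of_ne_zero h0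
      by_cases hκ : κ ≤ ν
      · have e2 : ν - κ + Finsupp.single i 1 = ν + Finsupp.single i 1 - κ := by
          rw [tsub_add_eq_add_tsub hκ]
        rw [e1, e2, ← map_add, key2, key, e3, hk]
        congr 1
        rw [Nat.choose_succ_succ' (ν i) k]
        push_cast
        simp only [Nat.succ_eq_add_one]
        ring
      · rw [mb_eq_zero hκ, e1]
        have : mb (ν + Finsupp.single i 1) κ = mb ν (κ - Finsupp.single i 1) := by
          have h3 := mb_eq_zero hκ
          rw [key] at h3
          rw [key2, e3, hk, Nat.choose_succ_succ', add_mul]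
          rw [hk] at h3
          simp only [Nat.succ_eq_add_one, Nat.add_sub_cancel] at h3 ⊢
          rw [h3]; ring
        rw [this]; simp

lemma hd_trl (κ : τ →₀ ℕ) (ξ : τ → ℝ) (F : MvPolynomial τ ℝ) :
    hd κ (trl ξ F) = trl ξ (hd κ F) := by
  classical
  induction F using MvPolynomial.induction_on generalizing κ with
  | C c =>
    have : trl ξ (C c) = C c := by simp [trl]
    rw [this, ← monomial_zero', hd_monomial]
    simp [trl]
  | add p q hp hq => simp [hp, hq]
  | mul_X p i hp =>
    have : trl ξ (X i) = X i + C (ξ i) := by simp [trl]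
    rw [map_mul (trl ξ), this, mul_add, map_add, hd_mul_X, hd_mul_X, map_add,
      map_mul (trl ξ) (hd κ p), this, hp, mul_comm (trl ξ p) (C _), C_mul', map_smul, hp]
    split_ifs
    · simp only [map_zero, add_zero, smul_eq_C_mul, hp]; ring
    · simp only [smul_eq_C_mul, hp]; ring

end hd

end

section

open MvPolynomial

/-- univariate Euler-operator Wronskian -/
lemma euler_wronskian {k : ℕ} (f : Fin k → Polynomial ℝ) (hf : LinearIndependent ℝ f)
    (A : Matrix (Fin k) (Fin k) (Polynomial ℝ))
    (hA : ∀ i j n, (A i j).coeff n = (n : ℝ) ^ (i : ℕ) * (f j).coeff n) : A.det ≠ 0 := by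
  classical
  intro h0
  obtain ⟨v, hv, hv0⟩ := Matrix.exists_vecMul_eq_zero_iff.mpr h0
  -- top degree of v
  obtain ⟨i0, hi0⟩ : ∃ i, v i ≠ 0 := by
    by_contra hcon; push Not at hcon; exact hv (funext hcon)
  obtain ⟨i1, _, hi1⟩ := Finset.exists_max_image Finset.univ (fun i => (v i).degree) ⟨i0, Finset.mem_univ _⟩
  set D := (v i1).natDegree with hD
  have hvi1 : v i1 ≠ 0 := by
    intro hz
    have := hi1 i0 (Finset.mem_univ _)
    rw [hz, Polynomial.degree_zero, le_bot_iff, Polynomial.degree_eq_bot] at this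
    exact hi0 this
  have hle : ∀ i, (v i).natDegree ≤ D := fun i =>
    Polynomial.natDegree_le_natDegree (hi1 i (Finset.mem_univ _))
  set p : Polynomial ℝ := ∑ i : Fin k, Polynomial.C ((v i).coeff D) * Polynomial.X ^ (i : ℕ) with hp
  have hpc : ∀ i : Fin k, p.coeff i = (v i).coeff D := by
    intro i
    rw [hp, Polynomial.finsetSum_coeff]
    simp only [Polynomial.coeff_C_mul, Polynomial.coeff_X_pow]
    rw [Finset.sum_eq_single i]
    · simp
    · intro b _ hb
      have : ¬ (i : ℕ) = b := fun h => hb (Fin.ext h.symm)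
      simp [this]
    · simp
  have hp0 : p ≠ 0 := by
    intro h
    have := hpc i1
    rw [h] at this
    simp only [Polynomial.coeff_zero] at this
    exact hvi1 (Polynomial.leadingCoeff_eq_zero.mp this.symm)
  have hpdeg : p.natDegree < k := by
    have hk : 0 < k := i1.pos
    have : p.natDegree ≤ k - 1 := by
      apply Polynomial.natDegree_sum_le_of_forall_le
      intro i _
      exact (Polynomial.natDegree_C_mul_X_pow_le _ _).trans (by have := i.2; omega)
    omega
  -- each member of the span has degree a root of p
  have key : ∀ c : Fin k → ℝ, (∑ j, c j • f j) ≠ 0 → p.eval ((∑ j, c j • f j).natDegree : ℝ) = 0 := by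
    intro c hc
    set g := ∑ j, c j • f j with hg
    set N := g.natDegree
    have h1 : ∑ i, v i * (∑ j, Polynomial.C (c j) * A i j) = 0 := by
      have : ∀ j, ∑ i, v i * A i j = 0 := fun j => by
        have := congrFun hv0 j
        simpa [Matrix.vecMul, dotProduct] using this
      calc _ = ∑ j, Polynomial.C (c j) * ∑ i, v i * A i j := by
            simp only [Finset.mul_sum]
            rw [Finset.sum_comm]
            refine Finset.sum_congr rfl fun _ _ => Finset.sum_congr rfl fun _ _ => by ring
        _ = 0 := by simp [this]
    have h2 : ∀ i n, (∑ j, Polynomial.C (c j) * A i j).coeff n = (n : ℝ) ^ (i : ℕ) * g.coeff n := by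
      intro i n
      rw [hg, Polynomial.finsetSum_coeff, Polynomial.finsetSum_coeff, Finset.mul_sum]
      refine Finset.sum_congr rfl fun j _ => ?_
      rw [Polynomial.coeff_C_mul, hA, Polynomial.coeff_smul, smul_eq_mul]; ring
    have h3 : ∀ i, (∑ j, Polynomial.C (c j) * A i j).natDegree ≤ N := by
      intro i
      rw [Polynomial.natDegree_le_iff_coeff_eq_zero]
      intro n hn
      rw [h2, Polynomial.coeff_eq_zero_of_natDegree_lt hn, mul_zero]
    have h4 := congrArg (fun q => Polynomial.coeff q (D + N)) h1
    simp only [Polynomial.finsetSum_coeff, Polynomial.coeff_zero] at h4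
    have h5 : ∀ i, (v i * (∑ j, Polynomial.C (c j) * A i j)).coeff (D + N)
        = (v i).coeff D * ((N : ℝ) ^ (i : ℕ) * g.coeff N) := by
      intro i
      rw [Polynomial.coeff_mul_add_eq_of_natDegree_le (hle i) (h3 i), h2]
    simp only [← mul_assoc] at h5
    rw [Finset.sum_congr rfl (fun i _ => h5 i), ← Finset.sum_mul] at h4
    have h6 : g.coeff N ≠ 0 := by
      intro h; exact hc (Polynomial.leadingCoeff_eq_zero.mp h)
    have h7 := (mul_eq_zero.mp h4).resolve_right h6
    rw [hp, Polynomial.eval_finsetSum]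
    simpa using h7
  -- linear map to coefficients at the roots
  set S : Finset ℕ := p.roots.toFinset.image (fun x => ⌊x⌋₊) with hS
  have hScard : S.card < k := by
    have h1 : S.card ≤ p.roots.toFinset.card := Finset.card_image_le
    exact lt_of_le_of_lt (h1.trans ((Multiset.toFinset_card_le _).trans (Polynomial.card_roots' p))) hpdeg
  let T : (Fin k → ℝ) →ₗ[ℝ] (S → ℝ) :=
    { toFun := fun c s => (∑ j, c j • f j).coeff s
      map_add' := by intro a b; ext s; simp [add_mul, Finset.sum_add_distrib]
      map_smul' := by intro a b; ext s; simp [Finset.mul_sum, mul_assoc] }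
  have hinj : Function.Injective T := by
    rw [← LinearMap.ker_eq_bot, LinearMap.ker_eq_bot']
    intro c hc
    by_contra hcne
    have hne : (∑ j, c j • f j) ≠ 0 := by
      intro h
      exact hcne (funext (Fintype.linearIndependent_iff.mp hf c h))
    have h1 := key c hne
    have h2 : (∑ j, c j • f j).natDegree ∈ S := by
      rw [hS, Finset.mem_image]
      refine ⟨_, ?_, Nat.floor_natCast _⟩
      rw [Multiset.mem_toFinset, Polynomial.mem_roots hp0]
      exact h1
    have h3 := congrFun hc ⟨_, h2⟩
    exact hne (Polynomial.leadingCoeff_eq_zero.mp h3)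
  have := LinearMap.finrank_le_finrank_of_injective hinj
  simp at this
  omega

lemma kron_inj (B : ℕ) : ∀ (n : ℕ) (μ ν : Fin n → ℕ), (∀ h, μ h < B) → (∀ h, ν h < B) →
    ∑ h : Fin n, B ^ (h : ℕ) * μ h = ∑ h : Fin n, B ^ (h : ℕ) * ν h → μ = ν := by
  intro n
  induction n with
  | zero => intro μ ν _ _ _; exact Subsingleton.elim _ _
  | succ n ih =>
    intro μ ν hμ hν h
    rw [Fin.sum_univ_succ, Fin.sum_univ_succ] at h
    simp only [Fin.val_zero, pow_zero, one_mul, Fin.val_succ, pow_succ'] at h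
    simp only [mul_assoc, ← Finset.mul_sum] at h
    have hB : 0 < B := lt_of_le_of_lt (Nat.zero_le _) (hμ 0)
    have h0 : μ 0 = ν 0 := by
      have := congrArg (· % B) h
      simpa [Nat.mod_eq_of_lt (hμ 0), Nat.mod_eq_of_lt (hν 0)] using this
    rw [h0] at h
    have h1 := Nat.eq_of_mul_eq_mul_left hB (Nat.add_left_cancel h)
    have := ih (fun i => μ i.succ) (fun i => ν i.succ) (fun i => hμ _) (fun i => hν _) h1
    funext i
    refine Fin.cases h0 (fun i => congrFun this i) i

/-- powers of a linear form are combinations of multi-binomials -/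
lemma pow_mem_span_mb {n : ℕ} (c : Fin n → ℕ) (i : ℕ) :
    (fun μ : Fin n →₀ ℕ => ((∑ h, c h * μ h : ℕ) : ℝ) ^ i) ∈
      Submodule.span ℝ ((fun (κ μ : Fin n →₀ ℕ) => (mb μ κ : ℝ)) '' {κ | ∑ h, κ h ≤ i}) := by
  classical
  induction i with
  | zero =>
    apply Submodule.subset_span
    refine ⟨0, by simp, ?_⟩
    funext μ
    simp [mb]
  | succ i ih =>
    have hmul : ∀ f ∈ Submodule.span ℝ ((fun (κ μ : Fin n →₀ ℕ) => (mb μ κ : ℝ)) '' {κ | ∑ h, κ h ≤ i}),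
        (fun μ : Fin n →₀ ℕ => ((∑ h, c h * μ h : ℕ) : ℝ)) * f ∈
        Submodule.span ℝ ((fun (κ μ : Fin n →₀ ℕ) => (mb μ κ : ℝ)) '' {κ | ∑ h, κ h ≤ i + 1}) := by
      intro f hf
      induction hf using Submodule.span_induction with
      | zero => simp
      | add a b _ _ ha hb => rw [mul_add]; exact Submodule.add_mem _ ha hb
      | smul a b _ hb => rw [mul_smul_comm]; exact Submodule.smul_mem _ _ hb
      | mem f hf =>
        obtain ⟨κ, hκ, rfl⟩ := hf
        have hid : (fun μ : Fin n →₀ ℕ => ((∑ h, c h * μ h : ℕ) : ℝ)) * (fun μ => (mb μ κ : ℝ)) =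
            ∑ h, ((c h * κ h : ℝ) • (fun μ : Fin n →₀ ℕ => (mb μ κ : ℝ)) +
              (c h * (κ h + 1) : ℝ) • (fun μ : Fin n →₀ ℕ => (mb μ (κ + Finsupp.single h 1) : ℝ))) := by
          funext μ
          simp only [Pi.mul_apply, Finset.sum_apply, Pi.add_apply, Pi.smul_apply, smul_eq_mul]
          push_cast
          rw [Finset.sum_mul]
          refine Finset.sum_congr rfl fun h _ => ?_
          have e1 : mb μ κ = (μ h).choose (κ h) * ∏ h' ∈ Finset.univ.erase h, (μ h').choose (κ h') := by
            rw [mb, Finset.mul_prod_erase _ (fun h => (μ h).choose (κ h)) (Finset.mem_univ h)]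
          have e2 : mb μ (κ + Finsupp.single h 1) = (μ h).choose (κ h + 1) *
              ∏ h' ∈ Finset.univ.erase h, (μ h').choose (κ h') := by
            rw [mb, ← Finset.mul_prod_erase _ _ (Finset.mem_univ h)]
            congr 1
            · simp
            · refine Finset.prod_congr rfl fun h' hh => ?_
              have : h ≠ h' := (Finset.ne_of_mem_erase hh).symm
              simp [Finsupp.single_eq_of_ne' this]
          have e3 : (μ h : ℝ) * (μ h).choose (κ h) = κ h * (μ h).choose (κ h)
              + (κ h + 1) * (μ h).choose (κ h + 1) := by
            have := Nat.choose_succ_right_eq (μ h) (κ h)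
            rcases le_or_gt (κ h) (μ h) with hle | hlt
            · have h2 : (((μ h).choose (κ h + 1) * (κ h + 1) : ℕ) : ℝ) = (((μ h).choose (κ h) * (μ h - κ h) : ℕ) : ℝ) := by
                rw [this]
              push_cast [Nat.cast_sub hle] at h2
              linarith
            · rw [Nat.choose_eq_zero_of_lt hlt, Nat.choose_eq_zero_of_lt (by omega)]; simp
          rw [e1, e2]
          push_cast
          linear_combination (c h * (∏ x ∈ Finset.univ.erase h, ((μ x).choose (κ x) : ℝ))) * e3
        rw [hid]
        have hκ' : ∑ h, κ h ≤ i := hκ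
        refine Submodule.sum_mem _ fun h _ => Submodule.add_mem _ ?_ ?_
        · refine Submodule.smul_mem _ _ (Submodule.subset_span ⟨κ, ?_, rfl⟩)
          show ∑ h, κ h ≤ i + 1
          omega
        · refine Submodule.smul_mem _ _ (Submodule.subset_span ⟨κ + Finsupp.single h 1, ?_, rfl⟩)
          show ∑ h', (κ + Finsupp.single h 1 : Fin n →₀ ℕ) h' ≤ i + 1
          simp only [Finsupp.add_apply, Finset.sum_add_distrib]
          have : ∑ h', (Finsupp.single h 1 : Fin n →₀ ℕ) h' = 1 := by
            rw [Finset.sum_eq_single h] <;> simp +contextual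
          omega
    have := hmul _ ih
    convert this using 1
    funext μ
    simp [pow_succ, mul_comm]

theorem gen_wronskian {n k : ℕ} (φ : Fin k → MvPolynomial (Fin n) ℝ) (hφ : LinearIndependent ℝ φ) :
    ∃ κ : Fin k → (Fin n →₀ ℕ), (∀ i, ∑ h, κ i h < k) ∧
      (Matrix.of fun i j => hd (κ i) (φ j)).det ≠ 0 := by
  classical
  by_contra hcon
  push Not at hcon
  obtain ⟨B, hB⟩ : ∃ B, ∀ j, ∀ μ ∈ (φ j).support, ∀ h, μ h < B := by
    refine ⟨(∑ j, ∑ μ ∈ (φ j).support, ∑ h, μ h) + 1, fun j μ hμ h => Nat.lt_succ_of_le ?_⟩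
    calc μ h ≤ ∑ h, μ h := Finset.single_le_sum (f := fun h => μ h) (fun _ _ => Nat.zero_le _) (Finset.mem_univ h)
      _ ≤ ∑ μ ∈ (φ j).support, ∑ h, μ h :=
        Finset.single_le_sum (f := fun μ : Fin n →₀ ℕ => ∑ h, μ h) (fun _ _ => Nat.zero_le _) hμ
      _ ≤ _ := Finset.single_le_sum (f := fun j => ∑ μ ∈ (φ j).support, ∑ h, μ h)
        (fun _ _ => Nat.zero_le _) (Finset.mem_univ j)
  set c : Fin n → ℕ := fun h => B ^ (h : ℕ) with hc
  set N : (Fin n →₀ ℕ) → ℕ := fun μ => ∑ h, c h * μ h with hN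
  set s : MvPolynomial (Fin n) ℝ →ₐ[ℝ] Polynomial ℝ := aeval (fun h => Polynomial.X ^ c h) with hs
  have hsm : ∀ μ a, s (monomial μ a) = Polynomial.monomial (N μ) a := by
    intro μ a
    rw [hs, aeval_monomial, Finsupp.prod_fintype _ _ (by simp)]
    simp only [← pow_mul]
    rw [Finset.prod_pow_eq_pow_sum, ← Polynomial.C_mul_X_pow_eq_monomial]
    rfl
  have hinj : ∀ g : MvPolynomial (Fin n) ℝ, (∀ μ ∈ g.support, ∀ h, μ h < B) → s g = 0 → g = 0 := by
    intro g hg h0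
    ext μ
    rw [coeff_zero]
    by_contra hne
    have hμ : μ ∈ g.support := mem_support_iff.mpr hne
    have h1 : (s g).coeff (N μ) = coeff μ g := by
      conv_lhs => rw [g.as_sum, map_sum, Polynomial.finsetSum_coeff]
      rw [Finset.sum_eq_single μ]
      · rw [hsm, Polynomial.coeff_monomial, if_pos rfl]
      · intro ν hν hne'
        rw [hsm, Polynomial.coeff_monomial, if_neg]
        intro h
        apply hne'
        have := kron_inj B n ν μ (hg ν hν) (hg μ hμ) h
        exact DFunLike.coe_injective this
      · intro h; exact absurd hμ h
    rw [h0] at h1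
    exact hne (by simpa using h1.symm)
  have hf : LinearIndependent ℝ (fun j => s (φ j)) := by
    rw [Fintype.linearIndependent_iff] at hφ ⊢
    intro a ha
    apply hφ a
    apply hinj
    · intro μ hμ h
      have h1 := MvPolynomial.support_sum hμ
      rw [Finset.mem_biUnion] at h1
      obtain ⟨j, _, hj⟩ := h1
      exact hB j μ (MvPolynomial.support_smul hj) h
    · rw [map_sum]; simpa using ha
  have hl : ∀ i : Fin k, ∃ l : (Fin n →₀ ℕ) →₀ ℝ, (∀ κ ∈ l.support, ∑ h, κ h ≤ (i : ℕ)) ∧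
      ∀ μ, ∑ κ ∈ l.support, l κ * (mb μ κ : ℝ) = (N μ : ℝ) ^ (i : ℕ) := by
    intro i
    have := pow_mem_span_mb c (i : ℕ)
    rw [Finsupp.mem_span_image_iff_linearCombination] at this
    obtain ⟨l, hl, hl2⟩ := this
    refine ⟨l, fun κ hκ => (Finsupp.mem_supported ℝ l).mp hl hκ, fun μ => ?_⟩
    have := congrFun hl2 μ
    rw [Finsupp.linearCombination_apply, Finsupp.sum, Finset.sum_apply] at this
    exact this
  choose l hl1 hl2 using hl
  set E : Matrix (Fin k) (Fin k) (MvPolynomial (Fin n) ℝ) :=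
    fun i => ∑ κ ∈ (l i).support, (fun j => monomial κ (l i κ) * hd κ (φ j)) with hE
  have hE0 : E.det = 0 := by
    have h1 : E.det = Matrix.detRowAlternating E := rfl
    have h2 := (Matrix.detRowAlternating (R := MvPolynomial (Fin n) ℝ) (n := Fin k)).toMultilinearMap.map_sum_finset
      (fun i κ => (fun j => monomial κ (l i κ) * hd κ (φ j))) (fun i => (l i).support)
    have h3 : E.det = ∑ r ∈ Fintype.piFinset (fun i => (l i).support),
      Matrix.det (fun i j => monomial (r i) (l i (r i)) * hd (r i) (φ j)) := h2
    rw [h3]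
    refine Finset.sum_eq_zero fun r hr => ?_
    rw [Fintype.mem_piFinset] at hr
    have h4 := Matrix.det_mul_column (fun i => (monomial (r i) (l i (r i)) : MvPolynomial (Fin n) ℝ))
      (Matrix.of fun i j => hd (r i) (φ j))
    rw [hcon r (fun i => lt_of_le_of_lt (hl1 i _ (hr i)) i.2), mul_zero] at h4
    exact h4
  have hEact : ∀ (i : Fin k) (F : MvPolynomial (Fin n) ℝ) (m : ℕ),
      (s (∑ κ ∈ (l i).support, monomial κ (l i κ) * hd κ F)).coeff m = (m : ℝ) ^ (i : ℕ) * (s F).coeff m := by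
    intro i F m
    induction F using MvPolynomial.induction_on' with
    | add p q hp hq =>
      simp only [map_add, mul_add, Finset.sum_add_distrib, Polynomial.coeff_add, hp, hq]
    | monomial μ a =>
      have : ∑ κ ∈ (l i).support, monomial κ (l i κ) * hd κ (monomial μ a)
          = monomial μ (a * (N μ : ℝ) ^ (i : ℕ)) := by
        rw [← hl2, Finset.mul_sum, map_sum]
        refine Finset.sum_congr rfl fun κ _ => ?_
        rw [hd_monomial, monomial_mul]
        by_cases hκ : κ ≤ μ
        · rw [add_tsub_cancel_of_le hκ]; congr 1; ring
        · rw [mb_eq_zero hκ]; simp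
      rw [this, hsm, hsm, Polynomial.coeff_monomial, Polynomial.coeff_monomial]
      split_ifs with h
      · rw [h]; ring
      · simp
  have hfin := euler_wronskian (fun j => s (φ j)) hf ((s : MvPolynomial (Fin n) ℝ →+* Polynomial ℝ).mapMatrix E) (by
    intro i j m
    rw [← hEact]
    have : E i j = ∑ κ ∈ (l i).support, monomial κ (l i κ) * hd κ (φ j) := by
      show (∑ κ ∈ (l i).support, (fun j => monomial κ (l i κ) * hd κ (φ j))) j = _
      rw [Finset.sum_apply]
    rw [← this]
    rfl)
  apply hfin
  rw [← RingHom.map_det, hE0, map_zero]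

end

section

open MvPolynomial

/-! ### Separation of the variable `0` -/
section jn
variable {n : ℕ}

noncomputable def jn (U : MvPolynomial (Fin n) ℝ) (V : MvPolynomial (Fin 1) ℝ) :
    MvPolynomial (Fin (n + 1)) ℝ := rename Fin.succ U * rename (fun _ => 0) V

lemma jn_monomial (μ : Fin n →₀ ℕ) (ν : Fin 1 →₀ ℕ) (a b : ℝ) :
    jn (monomial μ a) (monomial ν b) = monomial (Finsupp.cons (ν 0) μ) (a * b) := by
  rw [jn, rename_monomial, rename_monomial, monomial_mul]
  have : ∀ {x y : Fin (n + 1) →₀ ℕ} (c : ℝ), x = y → (monomial x c : MvPolynomial _ ℝ) = monomial y c := by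
    rintro x y c rfl; rfl
  apply this
  ext h
  rw [Finsupp.add_apply]
  refine Fin.cases ?_ (fun i => ?_) h
  · rw [Finsupp.mapDomain_of_notMem_range _ _ (by simp), Finsupp.cons_zero,
      zero_add, Finsupp.mapDomain, Finsupp.sum_fintype _ _ (by simp)]
    simp
  · rw [Finsupp.mapDomain_apply (Fin.succ_injective n), Finsupp.cons_succ,
      Finsupp.mapDomain_of_notMem_range _ _ (by simp), add_zero]

lemma jn_add_left (U U' : MvPolynomial (Fin n) ℝ) (V) : jn (U + U') V = jn U V + jn U' V := by
  simp [jn, add_mul]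
lemma jn_add_right (U : MvPolynomial (Fin n) ℝ) (V V') : jn U (V + V') = jn U V + jn U V' := by
  simp [jn, mul_add]

lemma jn_coeff (U : MvPolynomial (Fin n) ℝ) (V : MvPolynomial (Fin 1) ℝ) (μ : Fin n →₀ ℕ) (e : ℕ) :
    coeff (Finsupp.cons e μ) (jn U V) = coeff μ U * coeff (Finsupp.single 0 e) V := by
  classical
  induction U using MvPolynomial.induction_on' with
  | add p q hp hq => rw [jn_add_left, coeff_add, coeff_add, hp, hq, add_mul]
  | monomial μ' a =>
    induction V using MvPolynomial.induction_on' with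
    | add p q hp hq => rw [jn_add_right, coeff_add, coeff_add, hp, hq, mul_add]
    | monomial ν b =>
      rw [jn_monomial, coeff_monomial, coeff_monomial, coeff_monomial]
      have : Finsupp.cons (ν 0) μ' = Finsupp.cons e μ ↔ μ' = μ ∧ ν = Finsupp.single 0 e := by
        constructor
        · intro h
          constructor
          · have := congrArg Finsupp.tail h; simpa using this
          · have := DFunLike.congr_fun h 0
            simp only [Finsupp.cons_zero] at this
            refine Finsupp.ext fun i => ?_
            fin_cases i; simp [this]
        · rintro ⟨rfl, rfl⟩; simp
      simp only [this, ite_and, mul_ite, ite_mul, zero_mul, mul_zero]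
      split_ifs <;> rfl

lemma jn_hd (U : MvPolynomial (Fin n) ℝ) (V : MvPolynomial (Fin 1) ℝ) (κ : Fin n →₀ ℕ) (l : Fin 1 →₀ ℕ) :
    hd (Finsupp.cons (l 0) κ) (jn U V) = jn (hd κ U) (hd l V) := by
  induction U using MvPolynomial.induction_on' with
  | add p q hp hq => rw [jn_add_left, map_add, map_add, hp, hq, jn_add_left]
  | monomial μ' a =>
    induction V using MvPolynomial.induction_on' with
    | add p q hp hq => rw [jn_add_right, map_add, map_add, hp, hq, jn_add_right]
    | monomial ν b =>
      rw [jn_monomial, hd_monomial, hd_monomial, hd_monomial, jn_monomial]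
      have h1 : (Finsupp.cons (ν 0) μ' - Finsupp.cons (l 0) κ : Fin (n + 1) →₀ ℕ) =
          Finsupp.cons ((ν - l) 0) (μ' - κ) := by
        refine Finsupp.ext fun h => ?_
        refine Fin.cases ?_ (fun i => ?_) h <;> simp
      rw [h1]
      congr 1
      · have : mb (Finsupp.cons (ν 0) μ') (Finsupp.cons (l 0) κ) = mb ν l * mb μ' κ := by
          simp [mb, Fin.prod_univ_succ]
        rw [this]; push_cast; ring

lemma jn_trl (U : MvPolynomial (Fin n) ℝ) (V : MvPolynomial (Fin 1) ℝ) (ξ : Fin (n + 1) → ℝ) :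
    trl ξ (jn U V) = jn (trl (fun h => ξ h.succ) U) (trl (fun _ => ξ 0) V) := by
  rw [jn, jn, map_mul]
  congr 1
  · have : (trl ξ).comp (rename Fin.succ) = (rename Fin.succ).comp (trl (fun h : Fin n => ξ h.succ)) := by
      apply MvPolynomial.algHom_ext; intro i; simp [trl]
    exact DFunLike.congr_fun this U
  · have : (trl ξ).comp (rename (fun _ : Fin 1 => 0)) = (rename (fun _ : Fin 1 => 0)).comp (trl (fun _ => ξ 0)) := by
      apply MvPolynomial.algHom_ext; intro i; simp [trl]
    exact DFunLike.congr_fun this V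

lemma jn_det {k : ℕ} (A : Matrix (Fin k) (Fin k) (MvPolynomial (Fin n) ℝ))
    (B : Matrix (Fin k) (Fin k) (MvPolynomial (Fin 1) ℝ)) :
    (Matrix.of fun i i' => ∑ j, jn (A i j) (B i' j)).det = jn A.det B.det := by
  have : (Matrix.of fun i i' => ∑ j, jn (A i j) (B i' j)) =
      ((rename Fin.succ : MvPolynomial (Fin n) ℝ →ₐ[ℝ] MvPolynomial (Fin (n+1)) ℝ) : _ →+* MvPolynomial (Fin (n+1)) ℝ).mapMatrix A *
        (((rename (fun _ => 0) : MvPolynomial (Fin 1) ℝ →ₐ[ℝ] MvPolynomial (Fin (n+1)) ℝ) : _ →+* MvPolynomial (Fin (n+1)) ℝ).mapMatrix B).transpose := by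
    ext1 i i'
    rw [Matrix.mul_apply]
    rfl
  rw [this, Matrix.det_mul, Matrix.det_transpose, ← RingHom.map_det, ← RingHom.map_det]
  rfl

lemma separation (F : MvPolynomial (Fin (n + 1)) ℝ) (r : ℕ) (hr : degreeOf 0 F ≤ r) :
    ∃ k : ℕ, k ≤ r + 1 ∧ ∃ (φ : Fin k → MvPolynomial (Fin n) ℝ) (ψ : Fin k → MvPolynomial (Fin 1) ℝ),
      LinearIndependent ℝ φ ∧ LinearIndependent ℝ ψ ∧ F = ∑ j, jn (φ j) (ψ j) ∧
      ∀ j, ∃ l, ∀ μ, coeff μ (φ j) = coeff (Finsupp.cons l μ) F := by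
  classical
  set g : ℕ → MvPolynomial (Fin n) ℝ := fun l => (finSuccEquiv ℝ n F).coeff l with hg
  have hgc : ∀ l μ, coeff μ (g l) = coeff (Finsupp.cons l μ) F := fun l μ =>
    finSuccEquiv_coeff_coeff μ F l
  set t : Finset (MvPolynomial (Fin n) ℝ) := (Finset.range (r + 1)).image g with ht
  obtain ⟨b, hbt, hspan, hli⟩ := exists_linearIndependent ℝ (t : Set (MvPolynomial (Fin n) ℝ))
  have hbfin : b.Finite := t.finite_toSet.subset hbt
  have := hbfin.fintype
  set k := Fintype.card b with hk
  have e : Fin k ≃ b := (Fintype.equivFin b).symm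
  have hkle : k ≤ r + 1 := by
    have h1 : b.toFinset ⊆ t := by intro x hx; exact hbt (by simpa using hx)
    have h2 := Finset.card_le_card h1
    rw [Set.toFinset_card] at h2
    exact h2.trans (Finset.card_image_le.trans (by simp))
  set φ : Fin k → MvPolynomial (Fin n) ℝ := fun j => (e j : MvPolynomial (Fin n) ℝ) with hφ
  have hφli : LinearIndependent ℝ φ := hli.comp e e.injective
  have hrange : Set.range φ = b := by
    rw [hφ]
    ext x; constructor
    · rintro ⟨j, rfl⟩; exact (e j).2
    · intro hx; exact ⟨e.symm ⟨x, hx⟩, by simp⟩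
  have hmem : ∀ l ∈ Finset.range (r + 1), ∃ c : Fin k → ℝ, ∑ j, c j • φ j = g l := by
    intro l hl
    rw [← Submodule.mem_span_range_iff_exists_fun, hrange, hspan]
    apply Submodule.subset_span
    rw [ht]; exact Finset.mem_coe.mpr (Finset.mem_image_of_mem _ hl)
  have hφg : ∀ j, ∃ l ∈ Finset.range (r + 1), g l = φ j := by
    intro j
    have := hbt (e j).2
    rw [ht] at this
    simpa using this
  choose! c hc using hmem
  choose L hL1 hL2 using hφg
  have hcd : ∀ j i, c (L j) i = if i = j then 1 else 0 := by
    intro j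
    have h1 : ∑ i, (c (L j) i - if i = j then 1 else 0) • φ i = 0 := by
      simp only [sub_smul, Finset.sum_sub_distrib]
      rw [hc _ (hL1 j), hL2]
      simp
    intro i
    have := Fintype.linearIndependent_iff.mp hφli _ h1 i
    linarith
  set ψ : Fin k → MvPolynomial (Fin 1) ℝ := fun j =>
    ∑ l ∈ Finset.range (r + 1), monomial (Finsupp.single 0 l) (c l j) with hψ
  have hψc : ∀ j, ∀ l ∈ Finset.range (r + 1), coeff (Finsupp.single 0 l) (ψ j) = c l j := by
    intro j l hl
    rw [hψ]
    simp only [coeff_sum, coeff_monomial]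
    rw [Finset.sum_eq_single l]
    · simp
    · intro l' _ hne
      rw [if_neg]
      intro h
      exact hne (Finsupp.single_injective 0 h)
    · intro h; exact absurd hl h
  have hψli : LinearIndependent ℝ ψ := by
    rw [Fintype.linearIndependent_iff]
    intro a ha j
    have := congrArg (coeff (Finsupp.single 0 (L j))) ha
    rw [coeff_sum] at this
    simp only [coeff_smul, hψc _ _ (hL1 j), hcd] at this
    simpa using this
  refine ⟨k, hkle, φ, ψ, hφli, hψli, ?_, fun j => ⟨L j, fun μ => by rw [← hL2, hgc]⟩⟩
  ext m
  obtain ⟨l, μ, rfl⟩ : ∃ l μ, m = Finsupp.cons l μ := ⟨m 0, m.tail, (Finsupp.cons_tail m).symm⟩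
  rw [coeff_sum]
  simp only [jn_coeff]
  by_cases hl : l ∈ Finset.range (r + 1)
  · rw [← hgc, ← hc l hl, coeff_sum]
    refine Finset.sum_congr rfl fun j _ => ?_
    rw [hψc _ _ hl, coeff_smul, smul_eq_mul, mul_comm]
  · have h1 : coeff (Finsupp.cons l μ) F = 0 := by
      by_contra hne
      have := (degreeOf_le_iff.mp hr) _ (mem_support_iff.mpr hne)
      simp at this hl
      omega
    rw [h1]
    symm
    apply Finset.sum_eq_zero
    intro j _
    have : coeff (Finsupp.single 0 l) (ψ j) = 0 := by
      rw [hψ]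
      simp only [coeff_sum, coeff_monomial]
      refine Finset.sum_eq_zero fun l' hl' => ?_
      rw [if_neg]
      intro h
      rw [Finsupp.single_injective 0 h] at hl'
      exact hl hl'
    rw [this, mul_zero]

end jn

lemma wt_det {τ : Type*} (wt : (τ →₀ ℕ) →+ ℝ) {k : ℕ}
    (A : Matrix (Fin k) (Fin k) (MvPolynomial τ ℝ)) (s : Fin k → ℝ)
    (h : ∀ i j, ∀ μ ∈ (A i j).support, s j ≤ wt μ) : ∀ μ ∈ A.det.support, ∑ j, s j ≤ wt μ := by
  classical
  have hprod : ∀ (f : Fin k → MvPolynomial τ ℝ), (∀ j, ∀ μ ∈ (f j).support, s j ≤ wt μ) →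
      ∀ T : Finset (Fin k), ∀ μ ∈ (∏ j ∈ T, f j).support, ∑ j ∈ T, s j ≤ wt μ := by
    intro f hf T
    induction T using Finset.induction_on with
    | empty =>
      intro μ hμ
      rw [Finset.prod_empty, ← C_1, mem_support_iff, coeff_C] at hμ
      have : μ = 0 := by by_contra h; exact hμ (if_neg (Ne.symm h))
      simp [this]
    | insert a T ha ih =>
      intro μ hμ
      rw [Finset.prod_insert ha] at hμ
      have := MvPolynomial.support_mul _ _ hμ
      obtain ⟨x, hx, y, hy, rfl⟩ := Finset.mem_add.mp this
      rw [Finset.sum_insert ha, map_add]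
      exact add_le_add (hf a x hx) (ih y hy)
  intro μ hμ
  rw [Matrix.det_apply] at hμ
  have h1 := MvPolynomial.support_sum hμ
  rw [Finset.mem_biUnion] at h1
  obtain ⟨p, _, hp⟩ := h1
  have h2 : μ ∈ (∏ i, A (p i) i).support := by
    rcases Int.units_eq_one_or (Equiv.Perm.sign p) with h | h <;> rw [h] at hp
    · simpa using hp
    · simpa using hp
  exact hprod (fun j => A (p j) j) (fun j => h _ _) Finset.univ μ h2

lemma IsInt.det {τ : Type*} {k : ℕ} (A : Matrix (Fin k) (Fin k) (MvPolynomial τ ℝ))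
    (h : ∀ i j, IsInt (A i j)) : IsInt A.det := by
  rw [Matrix.det_apply]
  refine Subring.sum_mem _ fun p _ => ?_
  have : ∏ i, A (p i) i ∈ (MvPolynomial.map (Int.castRingHom ℝ) : MvPolynomial τ ℤ →+* _).range :=
    Subring.prod_mem _ fun i _ => h _ _
  rcases Int.units_eq_one_or (Equiv.Perm.sign p) with h | h <;> rw [h]
  · simpa using this
  · simpa using this

lemma one_le_ln1 {τ : Type*} {F : MvPolynomial τ ℝ} (h : IsInt F) (h0 : F ≠ 0) : 1 ≤ ln1 F := by
  obtain ⟨μ, hμ⟩ := MvPolynomial.ne_zero_iff.mp h0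
  obtain ⟨G, rfl⟩ := h
  refine le_trans ?_ (coeff_le_ln1 _ μ)
  rw [coeff_map] at hμ ⊢
  simp only [eq_intCast, ne_eq, Int.cast_eq_zero] at hμ ⊢
  have := Int.one_le_abs hμ
  exact_mod_cast this

end

section

open MvPolynomial

lemma order_bound (Q : MvPolynomial (Fin 1) ℝ) (hQ : IsInt Q) (hQ0 : Q ≠ 0) (a b : ℤ) (hb : 2 ≤ b)
    (hab : IsCoprime a b) (M : ℝ) (hM : ∀ e, |coeff (Finsupp.single 0 e) Q| ≤ M) :
    ∃ e : ℕ, coeff (Finsupp.single 0 e) (trl (fun _ => (a / b : ℝ)) Q) ≠ 0 ∧ (b : ℝ) ^ e ≤ M := by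
  classical
  have hb0 : (b : ℝ) ≠ 0 := by
    have : b ≠ 0 := by omega
    exact_mod_cast this
  have hbq : (b : ℚ) ≠ 0 := by
    have : b ≠ 0 := by omega
    exact_mod_cast this
  set θ : MvPolynomial (Fin 1) ℝ →ₐ[ℝ] Polynomial ℝ := aeval (fun _ => Polynomial.X) with hθ
  have hθc : ∀ (G : MvPolynomial (Fin 1) ℝ) e, (θ G).coeff e = coeff (Finsupp.single 0 e) G := by
    intro G e
    induction G using MvPolynomial.induction_on' with
    | add p q hp hq => rw [map_add, Polynomial.coeff_add, coeff_add, hp, hq]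
    | monomial ν c =>
      rw [hθ, aeval_monomial, Finsupp.prod_fintype _ _ (by simp)]
      simp only [Finset.univ_unique, Fin.default_eq_zero, Finset.prod_singleton, coeff_monomial]
      rw [Polynomial.algebraMap_eq, Polynomial.coeff_C_mul_X_pow]
      have : e = ν 0 ↔ ν = Finsupp.single 0 e := by
        constructor
        · rintro rfl; refine Finsupp.ext fun i => ?_
          fin_cases i; simp
        · intro h; rw [h]; simp
      simp [this]
  have hmap : ∀ Q₀ : MvPolynomial (Fin 1) ℤ, θ (MvPolynomial.map (Int.castRingHom ℝ) Q₀) =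
      (aeval (fun _ => (Polynomial.X : Polynomial ℤ)) Q₀).map (Int.castRingHom ℝ) := by
    intro Q₀
    rw [hθ]
    induction Q₀ using MvPolynomial.induction_on with
    | C c => simp
    | add p q hp hq => simp only [map_add, Polynomial.map_add, hp, hq]
    | mul_X p i hp => simp only [map_mul, Polynomial.map_mul, hp, map_X, aeval_X, Polynomial.map_X]
  have htr : ∀ (G : MvPolynomial (Fin 1) ℝ) (c : ℝ), θ (trl (fun _ => c) G) =
      (θ G).comp (Polynomial.X + Polynomial.C c) := by
    intro G c
    rw [hθ, trl]
    induction G using MvPolynomial.induction_on with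
    | C c => simp
    | add p q hp hq => simp only [map_add, Polynomial.add_comp, hp, hq]
    | mul_X p i hp =>
      rw [map_mul, map_mul, hp, map_mul, Polynomial.mul_comp]
      simp
  obtain ⟨Q₀, rfl⟩ := hQ
  set P : Polynomial ℤ := aeval (fun _ => Polynomial.X) Q₀ with hP
  have hmapQ := hmap Q₀
  rw [← hP] at hmapQ
  set c : ℝ := (a / b : ℝ) with hc
  have hPR0 : P.map (Int.castRingHom ℝ) ≠ 0 := by
    rw [← hmapQ]
    intro h
    apply hQ0
    ext m
    have hm : m = Finsupp.single 0 (m 0) := by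
      refine Finsupp.ext fun i => ?_
      fin_cases i; simp
    rw [hm, ← hθc, h]; simp
  have hP0 : P ≠ 0 := by rintro h; rw [h] at hPR0; simp at hPR0
  obtain ⟨R, hR, hRnd⟩ := Polynomial.exists_eq_pow_rootMultiplicity_mul_and_not_dvd _ hPR0 c
  set e := (P.map (Int.castRingHom ℝ)).rootMultiplicity c with he
  refine ⟨e, ?_, ?_⟩
  · rw [← hθc, htr, hmapQ, hR, Polynomial.mul_comp, Polynomial.pow_comp]
    simp only [Polynomial.sub_comp, Polynomial.X_comp, Polynomial.C_comp, add_sub_cancel_right]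
    have h1 := Polynomial.coeff_X_pow_mul (R.comp (Polynomial.X + Polynomial.C c)) e 0
    rw [zero_add] at h1
    rw [h1, Polynomial.coeff_zero_eq_eval_zero, Polynomial.eval_comp]
    simp only [Polynomial.eval_add, Polynomial.eval_X, Polynomial.eval_C, zero_add]
    intro h
    exact hRnd (Polynomial.dvd_iff_isRoot.mpr h)
  · -- divisibility over ℚ, then over ℤ
    have h1 : (Polynomial.X - Polynomial.C (a / b : ℚ)) ^ e ∣ P.map (Int.castRingHom ℚ) := by
      rw [← Polynomial.map_dvd_map' (algebraMap ℚ ℝ)]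
      refine ⟨R, ?_⟩
      rw [Polynomial.map_map]
      have : (algebraMap ℚ ℝ).comp (Int.castRingHom ℚ) = Int.castRingHom ℝ := RingHom.ext_int _ _
      rw [this, hR]
      simp [hc]
    set l : Polynomial ℤ := Polynomial.C b * Polynomial.X - Polynomial.C a with hl
    have h2 : (l ^ e).map (Int.castRingHom ℚ) ∣ P.map (Int.castRingHom ℚ) := by
      have : (l ^ e).map (Int.castRingHom ℚ) = Polynomial.C ((b : ℚ) ^ e) *
          (Polynomial.X - Polynomial.C (a / b : ℚ)) ^ e := by
        rw [hl, map_pow, ← mul_pow]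
        rw [Polynomial.map_pow]
        congr 1
        simp only [Polynomial.map_sub, Polynomial.map_mul, Polynomial.map_C, Polynomial.map_X,
          Int.coe_castRingHom, mul_sub, ← Polynomial.C_mul]
        rw [mul_div_cancel₀ _ hbq]
      rw [this]
      exact (Polynomial.isUnit_C.mpr (IsUnit.mk0 _ (pow_ne_zero _ hbq))).mul_left_dvd.mpr h1
    have hlprim : l.IsPrimitive := by
      rw [Polynomial.isPrimitive_iff_isUnit_of_C_dvd]
      intro r hr
      rw [Polynomial.C_dvd_iff_dvd_coeff] at hr
      have e0 := hr 0
      have e1 := hr 1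
      rw [hl, Polynomial.coeff_sub, Polynomial.coeff_C_mul, Polynomial.coeff_X, Polynomial.coeff_C] at e0 e1
      simp only [one_ne_zero, if_false, if_true, mul_zero, zero_sub, mul_one, sub_zero, dvd_neg] at e0 e1
      exact hab.isUnit_of_dvd' e0 e1
    have hlpow : (l ^ e).IsPrimitive := by
      clear h1 h2
      induction e with
      | zero => simp [Polynomial.isPrimitive_one]
      | succ n ih => rw [pow_succ]; exact ih.mul hlprim
    obtain ⟨T, hT⟩ := (Polynomial.IsPrimitive.Int.dvd_iff_map_cast_dvd_map_cast _ _ hlpow).mpr h2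
    have hllc : l.leadingCoeff = b := by
      rw [hl, sub_eq_add_neg, ← Polynomial.C_neg]
      exact Polynomial.leadingCoeff_linear (by omega)
    have hlc : P.leadingCoeff = b ^ e * T.leadingCoeff := by
      rw [hT, Polynomial.leadingCoeff_mul, Polynomial.leadingCoeff_pow, hllc]
    have hT0 : T.leadingCoeff ≠ 0 := by
      intro h
      rw [h, mul_zero, Polynomial.leadingCoeff_eq_zero] at hlc
      exact hP0 hlc
    have h3 := hM P.natDegree
    rw [← hθc, hmapQ, Polynomial.coeff_map, Polynomial.coeff_natDegree, hlc] at h3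
    refine le_trans ?_ h3
    rw [eq_intCast]
    push_cast
    rw [abs_mul, abs_pow]
    have h4 : (1 : ℝ) ≤ |(T.leadingCoeff : ℝ)| := by exact_mod_cast Int.one_le_abs hT0
    have h5 : (b : ℝ) ≤ |(b : ℝ)| := le_abs_self _
    have h6 : (0 : ℝ) ≤ b := by have : (0 : ℤ) ≤ b := by omega
                                exact_mod_cast this
    calc (b : ℝ) ^ e ≤ |(b : ℝ)| ^ e := pow_le_pow_left₀ h6 h5 _
      _ ≤ _ := le_mul_of_one_le_right (by positivity) h4

end

section

open MvPolynomial

noncomputable def wtH {n : ℕ} (r : Fin n → ℕ) : (Fin n →₀ ℕ) →+ ℝ where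
  toFun μ := ∑ h, (μ h : ℝ) / r h
  map_zero' := by simp
  map_add' := by intro a b; simp [add_div, Finset.sum_add_distrib]

lemma wtH_apply {n : ℕ} (r : Fin n → ℕ) (μ : Fin n →₀ ℕ) : wtH r μ = ∑ h, (μ h : ℝ) / r h := rfl

noncomputable def degH {n : ℕ} (h : Fin n) : (Fin n →₀ ℕ) →+ ℝ where
  toFun μ := - (μ h : ℝ)
  map_zero' := by simp
  map_add' := by intro a b; simp [add_comm]

/-- Roth's lemma, as a statement depending on the number of variables -/
def RothLemma (n : ℕ) : Prop :=
  ∀ ε : ℝ, 0 < ε → ∃ ω : ℝ, 0 < ω ∧ ∃ Λ : ℝ, 0 < Λ ∧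
    ∀ (r : Fin n → ℕ) (a b : Fin n → ℤ) (F : MvPolynomial (Fin n) ℝ) (S : ℝ),
      (∀ h, 0 < r h) → (∀ h, 2 ≤ b h) → (∀ h, IsCoprime (a h) (b h)) → F ≠ 0 → IsInt F →
      (∀ h, degreeOf h F ≤ r h) → (∀ h h', h < h' → (r h : ℝ) ≤ ω * r h') →
      Real.log (ln1 F) + ∑ h, (r h : ℝ) ≤ S → (∀ h, Λ * S ≤ r h * Real.log (b h)) →
      ∃ i, coeff i (trl (fun h => (a h / b h : ℝ)) F) ≠ 0 ∧ wtH r i ≤ ε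

lemma max_sum_lower (k r : ℕ) (ε : ℝ) (hε : 0 < ε) (hε1 : ε ≤ 1) (hk : 0 < k) (hkr : k ≤ r + 1) (hr : 0 < r) :
    k * (ε ^ 2 / 32) ≤ ∑ l ∈ Finset.range k, max 0 (ε / 2 - (l : ℝ) / r) := by
  set j := min k (⌊ε * r / 4⌋₊ + 1) with hj
  have hr' : (0 : ℝ) < r := by exact_mod_cast hr
  have h1 : (j : ℝ) * (ε / 4) ≤ ∑ l ∈ Finset.range j, max 0 (ε / 2 - (l : ℝ) / r) := by
    rw [← nsmul_eq_mul, ← Finset.card_range j]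
    simp only [Finset.card_range]
    conv_lhs => rw [← Finset.card_range j]
    apply Finset.card_nsmul_le_sum
    intro l hl
    refine le_max_of_le_right ?_
    have : l ≤ ⌊ε * r / 4⌋₊ := by
      have := Finset.mem_range.mp hl
      have h2 : j ≤ ⌊ε * r / 4⌋₊ + 1 := min_le_right _ _
      omega
    have h3 : (l : ℝ) ≤ ε * r / 4 := (Nat.le_floor_iff (by positivity)).mp this
    have h4 : (l : ℝ) / r ≤ ε / 4 := by
      rw [div_le_iff₀ hr']; linarith
    linarith
  have h2 : ∑ l ∈ Finset.range j, max 0 (ε / 2 - (l : ℝ) / r) ≤ ∑ l ∈ Finset.range k, max 0 (ε / 2 - (l : ℝ) / r) :=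
    Finset.sum_le_sum_of_subset_of_nonneg (Finset.range_mono (min_le_left _ _)) (fun _ _ _ => le_max_left _ _)
  have h3 : (k : ℝ) * (ε / 8) ≤ j := by
    rcases min_choice k (⌊ε * r / 4⌋₊ + 1) with h | h
    · rw [hj, h]
      have : (0 : ℝ) ≤ k := Nat.cast_nonneg _
      nlinarith
    · rw [hj, h]
      push_cast
      have h5 := Nat.lt_floor_add_one (ε * r / 4)
      have h6 : (k : ℝ) ≤ 2 * r := by
        have : k ≤ 2 * r := by omega
        exact_mod_cast this
      nlinarith
  nlinarith

theorem roth_lemma : ∀ n, RothLemma n := by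
  intro n
  induction n with
  | zero =>
    intro ε hε
    refine ⟨1, one_pos, 1, one_pos, ?_⟩
    intro r a b F S _ _ _ hF0 _ _ _ _ _
    have h1 : trl (fun h => (a h / b h : ℝ)) F = F := by
      rw [MvPolynomial.eq_C_of_isEmpty F]; simp [trl]
    rw [h1]
    obtain ⟨i, hi⟩ := MvPolynomial.ne_zero_iff.mp hF0
    exact ⟨i, hi, by simp [wtH_apply]; exact hε.le⟩
  | succ n ih =>
    intro ε₀ hε₀
    set ε := min ε₀ 1 with hε
    have hεpos : 0 < ε := lt_min hε₀ one_pos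
    have hε1 : ε ≤ 1 := min_le_right _ _
    set δ := ε ^ 2 / 32 with hδ
    have hδpos : 0 < δ := by positivity
    obtain ⟨ω', hω', Λ', hΛ', IH⟩ := ih (δ / 4) (by positivity)
    refine ⟨min ω' (ε / 2), by positivity, max (3 * Λ') (8 / δ), by positivity, ?_⟩
    set ω := min ω' (ε / 2) with hω
    set Λ := max (3 * Λ') (8 / δ) with hΛ
    have hΛpos : 0 < Λ := lt_of_lt_of_le (by positivity) (le_max_left _ _)
    intro r a b F S hr hb hab hF0 hFi hdeg hrat hS hlog
    set ξ : Fin (n + 1) → ℝ := fun h => (a h / b h : ℝ) with hξ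
    by_contra hcon
    push Not at hcon
    have hwt : ∀ μ ∈ (trl ξ F).support, ε ≤ wtH r μ := by
      intro μ hμ
      exact (min_le_left _ _).trans (hcon μ (mem_support_iff.mp hμ)).le
    have hr0 : (0 : ℝ) < r 0 := by exact_mod_cast hr 0
    obtain ⟨k, hk, φ, ψ, hφ, hψ, hFs, hφc⟩ := separation F (r 0) (hdeg 0)
    have hkpos : 0 < k := by
      rcases Nat.eq_zero_or_pos k with rfl | h
      · exact absurd (by rw [hFs]; simp) hF0
      · exact h
    have hkR : (0 : ℝ) < k := by exact_mod_cast hkpos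
    obtain ⟨κ, hκ, hU⟩ := gen_wronskian φ hφ
    obtain ⟨l, hl, hV⟩ := gen_wronskian ψ hψ
    set A : Matrix (Fin k) (Fin k) (MvPolynomial (Fin n) ℝ) := Matrix.of fun i j => hd (κ i) (φ j) with hA
    set B : Matrix (Fin k) (Fin k) (MvPolynomial (Fin 1) ℝ) := Matrix.of fun i j => hd (l i) (ψ j) with hB
    set WM : Matrix (Fin k) (Fin k) (MvPolynomial (Fin (n + 1)) ℝ) :=
      Matrix.of fun i i' => hd (Finsupp.cons (l i' 0) (κ i)) F with hWM
    have hW : WM.det = jn A.det B.det := by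
      rw [← jn_det]
      congr 1
      ext1 i i'
      simp only [hWM, Matrix.of_apply, hA, hB]
      conv_lhs => rw [hFs, map_sum]
      refine Finset.sum_congr rfl fun j _ => ?_
      rw [jn_hd]
    -- sizes
    set N : ℕ := ∑ h, r h with hN
    have hsuppF : ∀ μ ∈ F.support, ∀ h, μ h ≤ r h := fun μ hμ h => (degreeOf_le_iff.mp (hdeg h)) μ hμ
    have hLF1 : 1 ≤ ln1 F := one_le_ln1 hFi hF0
    have hsuppφ : ∀ j, ∀ μ ∈ (φ j).support, ∀ h, μ h ≤ r h.succ := by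
      intro j μ hμ h
      obtain ⟨lj, hlj⟩ := hφc j
      rw [mem_support_iff, hlj] at hμ
      simpa using hsuppF _ (mem_support_iff.mpr hμ) h.succ
    have hlnφ : ∀ j, ln1 (φ j) ≤ ln1 F := by
      intro j
      obtain ⟨lj, hlj⟩ := hφc j
      rw [ln1_eq, ln1_eq]
      simp only [hlj]
      have hinj : Function.Injective (fun μ : Fin n →₀ ℕ => Finsupp.cons lj μ) :=
        Finsupp.cons_right_injective lj
      rw [← Finset.sum_image (s := (φ j).support) (f := fun ν => |coeff ν F|) (g := fun μ => Finsupp.cons lj μ)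
        (fun _ _ _ _ h => hinj h)]
      refine Finset.sum_le_sum_of_subset_of_nonneg ?_ (fun _ _ _ => abs_nonneg _)
      intro ν hν
      obtain ⟨μ, hμ, rfl⟩ := Finset.mem_image.mp hν
      rw [mem_support_iff, hlj] at hμ
      exact mem_support_iff.mpr hμ
    have hφint : ∀ j, IsInt (φ j) := by
      intro j
      obtain ⟨lj, hlj⟩ := hφc j
      rw [isInt_iff] at hFi ⊢
      intro μ
      rw [hlj]
      exact hFi _
    set M : ℝ := 2 ^ N * ln1 F with hM
    have hM1 : 1 ≤ M := by
      rw [hM]; exact one_le_mul_of_one_le_of_one_le (one_le_pow₀ (by norm_num)) hLF1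
    have hAb : ∀ i j, ln1 (A i j) ≤ M := by
      intro i j
      refine (ln1_hd_le _ _ N ?_).trans ?_
      · intro μ hμ
        rw [hN, Fin.sum_univ_succ]
        exact (Finset.sum_le_sum fun h _ => hsuppφ j μ hμ h).trans (Nat.le_add_left _ _)
      · exact mul_le_mul_of_nonneg_left (hlnφ j) (by positivity)
    have hWb : ∀ i j, ln1 (WM i j) ≤ M := by
      intro i j
      exact ln1_hd_le _ _ N fun μ hμ => Finset.sum_le_sum fun h _ => hsuppF μ hμ h
    set D : ℝ := (k.factorial : ℝ) * M ^ k with hD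
    have hUD : ln1 A.det ≤ D := by simpa using ln1_det_le A M hAb
    have hWD : ln1 WM.det ≤ D := by simpa using ln1_det_le WM M hWb
    have hNR : (N : ℝ) = ∑ h, (r h : ℝ) := by rw [hN]; push_cast; rfl
    have hlogF : 0 ≤ Real.log (ln1 F) := Real.log_nonneg hLF1
    have hr0S : (r 0 : ℝ) ≤ S := by
      have : (r 0 : ℝ) ≤ ∑ h, (r h : ℝ) := Finset.single_le_sum (f := fun h => (r h : ℝ))
        (fun _ _ => Nat.cast_nonneg _) (Finset.mem_univ 0)
      linarith
    have hlogM : Real.log M ≤ S := by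
      rw [hM, Real.log_mul (by positivity) (by linarith), Real.log_pow]
      have h1 : Real.log 2 ≤ 1 := by have := Real.log_two_lt_d9; linarith
      have : (N : ℝ) * Real.log 2 ≤ N := mul_le_of_le_one_right (Nat.cast_nonneg _) h1
      linarith
    have hlogD : Real.log D ≤ 2 * k * S := by
      rw [hD, Real.log_mul (by positivity) (by positivity), Real.log_pow]
      have h1 : Real.log (k.factorial : ℝ) ≤ k * S := by
        have h2 : (k.factorial : ℝ) ≤ (k : ℝ) ^ k := by exact_mod_cast Nat.factorial_le_pow k
        have h3 := Real.log_le_log (by positivity) h2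
        rw [Real.log_pow] at h3
        have h4 : Real.log k ≤ S := by
          have := Real.log_le_sub_one_of_pos hkR
          have h5 : (k : ℝ) ≤ r 0 + 1 := by exact_mod_cast hk
          linarith
        exact h3.trans (mul_le_mul_of_nonneg_left h4 hkR.le)
      have h2 : (k : ℝ) * Real.log M ≤ k * S := mul_le_mul_of_nonneg_left hlogM hkR.le
      linarith
    have hUint : IsInt A.det := IsInt.det _ fun i j => (hφint j).hd _
    have hWint : IsInt WM.det := IsInt.det _ fun i j => hFi.hd _
    have hSpos : 0 < S := lt_of_lt_of_le hr0 hr0S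
    -- induction hypothesis for U
    obtain ⟨i, hi, hiw⟩ := IH (fun h => k * r h.succ) (fun h => a h.succ) (fun h => b h.succ) A.det (3 * k * S)
      (fun h => Nat.mul_pos hkpos (hr _)) (fun h => hb _) (fun h => hab _) hU hUint
      (by
        intro h
        rw [degreeOf_le_iff]
        intro μ hμ
        have h1 := wt_det (degH h) A (fun _ => -(r h.succ : ℝ)) (by
          intro i j ν hν
          have h2 := hsuppφ j _ (mem_support_hd hν) h
          have h3 : ν h ≤ r h.succ := by simp at h2; omega
          show -(r h.succ : ℝ) ≤ -(ν h : ℝ)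
          have : (ν h : ℝ) ≤ r h.succ := by exact_mod_cast h3
          linarith) μ hμ
        simp only [Finset.sum_const, Finset.card_univ, Fintype.card_fin, nsmul_eq_mul] at h1
        have h4 : (k : ℝ) * -(r h.succ : ℝ) ≤ -(μ h : ℝ) := h1
        have h5 : (μ h : ℝ) ≤ k * r h.succ := by linarith
        exact_mod_cast h5)
      (by
        intro h h' hlt
        have h1 := hrat h.succ h'.succ (Fin.succ_lt_succ_iff.mpr hlt)
        have h2 : ω * (r h'.succ : ℝ) ≤ ω' * r h'.succ :=
          mul_le_mul_of_nonneg_right (min_le_left _ _) (Nat.cast_nonneg _)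
        push_cast
        have h3 : (r h.succ : ℝ) ≤ ω' * r h'.succ := h1.trans h2
        nlinarith)
      (by
        have h1 : Real.log (ln1 A.det) ≤ 2 * k * S :=
          (Real.log_le_log (lt_of_lt_of_le one_pos (one_le_ln1 hUint hU)) hUD).trans hlogD
        have h2 : ∑ h : Fin n, ((k * r h.succ : ℕ) : ℝ) ≤ k * S := by
          push_cast
          rw [← Finset.mul_sum]
          refine mul_le_mul_of_nonneg_left ?_ hkR.le
          rw [Fin.sum_univ_succ] at hS
          linarith
        linarith)
      (by
        intro h
        have h1 := hlog h.succ
        have h2 : 3 * Λ' * S ≤ Λ * S := mul_le_mul_of_nonneg_right (le_max_left _ _) hSpos.le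
        push_cast
        have h3 : 3 * Λ' * S ≤ r h.succ * Real.log (b h.succ) := h2.trans h1
        calc Λ' * (3 * k * S) = k * (3 * Λ' * S) := by ring
          _ ≤ k * (r h.succ * Real.log (b h.succ)) := mul_le_mul_of_nonneg_left h3 hkR.le
          _ = _ := by ring)
    -- order of V
    obtain ⟨i0, hi0⟩ := MvPolynomial.ne_zero_iff.mp hU
    set u := coeff i0 A.det with hu
    have hQc : ∀ e, coeff (Finsupp.single 0 e) (C u * B.det) = coeff (Finsupp.cons e i0) WM.det := by
      intro e
      rw [hW, jn_coeff, coeff_C_mul]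
    obtain ⟨e, he, heM⟩ := order_bound (C u * B.det) (by
        rw [isInt_iff] at hWint ⊢
        intro μ
        have : μ = Finsupp.single 0 (μ 0) := by
          refine Finsupp.ext fun i => ?_
          fin_cases i; simp
        rw [this, hQc]
        exact hWint _) (mul_ne_zero (by simpa using hi0) hV) (a 0) (b 0) (hb 0) (hab 0) D (by
        intro e
        rw [hQc]
        exact (coeff_le_ln1 _ _).trans hWD)
    have he' : coeff (Finsupp.single 0 e) (trl (fun _ => ξ 0) B.det) ≠ 0 := by
      rw [map_mul] at he
      have : trl (fun _ : Fin 1 => (a 0 / b 0 : ℝ)) (C u) = C u := by simp [trl]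
      rw [this, coeff_C_mul] at he
      exact right_ne_zero_of_mul he
    have hb0 : (2 : ℝ) ≤ b 0 := by exact_mod_cast hb 0
    have hlogb : 0 < Real.log (b 0) := Real.log_pos (by linarith)
    have heb : (e : ℝ) / r 0 ≤ k * (δ / 4) := by
      have h1 := Real.log_le_log (by positivity) heM
      rw [Real.log_pow] at h1
      have h2 : (e : ℝ) * Real.log (b 0) ≤ 2 * k * S := h1.trans hlogD
      have h3 : 8 / δ * S ≤ r 0 * Real.log (b 0) :=
        (mul_le_mul_of_nonneg_right (le_max_right _ _) hSpos.le).trans (hlog 0)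
      have h4 : S ≤ δ / 8 * (r 0 * Real.log (b 0)) := by
        calc S = δ / 8 * (8 / δ * S) := by field_simp
          _ ≤ _ := mul_le_mul_of_nonneg_left h3 (by positivity)
      have h5 : (e : ℝ) * Real.log (b 0) ≤ (k * (δ / 4) * r 0) * Real.log (b 0) := by
        calc (e : ℝ) * Real.log (b 0) ≤ 2 * k * S := h2
          _ ≤ 2 * k * (δ / 8 * (r 0 * Real.log (b 0))) := mul_le_mul_of_nonneg_left h4 (by positivity)
          _ = _ := by ring
      rw [div_le_iff₀ hr0]
      exact le_of_mul_le_mul_right h5 hlogb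
    -- the monomial of trl W
    have hmon : coeff (Finsupp.cons e i) (trl ξ WM.det) ≠ 0 := by
      rw [hW, jn_trl, jn_coeff]
      exact mul_ne_zero hi he'
    have hwle : wtH r (Finsupp.cons e i) ≤ k * (δ / 2) := by
      rw [wtH_apply, Fin.sum_univ_succ]
      simp only [Finsupp.cons_zero, Finsupp.cons_succ]
      have h1 : ∑ h : Fin n, (i h : ℝ) / r h.succ ≤ k * (δ / 4) := by
        rw [wtH_apply] at hiw
        have : ∑ h : Fin n, (i h : ℝ) / r h.succ = k * ∑ h : Fin n, (i h : ℝ) / ((k * r h.succ : ℕ) : ℝ) := by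
          rw [Finset.mul_sum]
          refine Finset.sum_congr rfl fun h _ => ?_
          have := hr h.succ
          push_cast
          field_simp
        rw [this]
        exact mul_le_mul_of_nonneg_left hiw hkR.le
      linarith
    -- lower bound
    have hlow : ∑ j : Fin k, max 0 (ε / 2 - ((l j 0 : ℕ) : ℝ) / r 0) ≤ wtH r (Finsupp.cons e i) := by
      have hdet : trl ξ WM.det = (((trl ξ : _ →ₐ[ℝ] _) : _ →+* MvPolynomial (Fin (n + 1)) ℝ).mapMatrix WM).det := by
        rw [← RingHom.map_det]; rfl
      rw [hdet] at hmon
      refine wt_det (wtH r) _ (fun j => max 0 (ε / 2 - ((l j 0 : ℕ) : ℝ) / r 0)) ?_ _ (mem_support_iff.mpr hmon)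
      intro i j μ hμ
      have hμ' : μ ∈ (hd (Finsupp.cons (l j 0) (κ i)) (trl ξ F)).support := by
        rw [hd_trl]; exact hμ
      have h1 := hwt _ (mem_support_hd hμ')
      rw [map_add] at h1
      refine max_le (by rw [wtH_apply]; positivity) ?_
      have h2 : wtH r (Finsupp.cons (l j 0) (κ i)) ≤ ((l j 0 : ℕ) : ℝ) / r 0 + ε / 2 := by
        rw [wtH_apply, Fin.sum_univ_succ]
        simp only [Finsupp.cons_zero, Finsupp.cons_succ]
        have h3 : ∀ h : Fin n, (κ i h : ℝ) / r h.succ ≤ (κ i h : ℝ) * (ω / r 0) := by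
          intro h
          rw [div_eq_mul_inv]
          refine mul_le_mul_of_nonneg_left ?_ (Nat.cast_nonneg _)
          have h4 := hrat 0 h.succ (Fin.succ_pos h)
          have h5 : (0 : ℝ) < r h.succ := by exact_mod_cast hr _
          rw [inv_eq_one_div, div_le_div_iff₀ h5 hr0]
          linarith
        have h6 : ∑ h : Fin n, (κ i h : ℝ) / r h.succ ≤ ω := by
          refine (Finset.sum_le_sum fun h _ => h3 h).trans ?_
          rw [← Finset.sum_mul]
          have h7 : (∑ h : Fin n, (κ i h : ℝ)) ≤ r 0 := by
            have h8 := hκ i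
            have h9 : ∑ h : Fin n, κ i h ≤ r 0 := by omega
            exact_mod_cast h9
          have hωpos : 0 < ω := by positivity
          calc (∑ h : Fin n, (κ i h : ℝ)) * (ω / r 0) ≤ r 0 * (ω / r 0) :=
                mul_le_mul_of_nonneg_right h7 (by positivity)
            _ = ω := by field_simp
        have h7 : ω ≤ ε / 2 := min_le_right _ _
        linarith
      linarith
    have hlinj : Function.Injective (fun j : Fin k => (⟨l j 0, by
        have := hl j; simpa using this⟩ : Fin k)) := by
      intro j j' hjj
      by_contra hne
      have h1 : l j = l j' := by
        refine Finsupp.ext fun i => ?_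
        fin_cases i
        have := congrArg Fin.val hjj
        simpa using this
      apply hV
      apply Matrix.det_zero_of_row_eq hne
      funext m
      simp only [hB, Matrix.of_apply, h1]
    have hsum : ∑ j : Fin k, max 0 (ε / 2 - ((l j 0 : ℕ) : ℝ) / r 0) =
        ∑ m ∈ Finset.range k, max 0 (ε / 2 - (m : ℝ) / r 0) := by
      rw [← Fin.sum_univ_eq_sum_range (fun m => max 0 (ε / 2 - (m : ℝ) / r 0))]
      exact Function.Bijective.sum_comp (Finite.injective_iff_bijective.mp hlinj)
        (fun m : Fin k => max 0 (ε / 2 - ((m : ℕ) : ℝ) / r 0))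
    have hfin := max_sum_lower k (r 0) ε hεpos hε1 hkpos hk (hr 0)
    rw [← hsum] at hfin
    have : (k : ℝ) * δ ≤ k * (δ / 2) := hfin.trans (hlow.trans hwle)
    nlinarith

end

section

open MvPolynomial

/-! ### counting exponents -/
/-- multidegree index set -/
def JJ {m : ℕ} (r : Fin m → ℕ) : Finset (Fin m → Fin 4 → ℕ) :=
  Fintype.piFinset (fun h => Finset.piAntidiag (Finset.univ : Finset (Fin 4)) (r h))

lemma mem_JJ {m : ℕ} {r : Fin m → ℕ} {j : Fin m → Fin 4 → ℕ} : j ∈ JJ r ↔ ∀ h, ∑ k, j h k = r h := by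
  simp [JJ, Fintype.mem_piFinset]

lemma sum_antidiag_coord (r : ℕ) (k : Fin 4) :
    (∑ j ∈ Finset.piAntidiag (Finset.univ : Finset (Fin 4)) r, (j k : ℝ)) =
      (Finset.piAntidiag (Finset.univ : Finset (Fin 4)) r).card * r / 4 := by
  have sym : ∀ k, (∑ j ∈ Finset.piAntidiag (Finset.univ : Finset (Fin 4)) r, (j k : ℝ)) =
      ∑ j ∈ Finset.piAntidiag (Finset.univ : Finset (Fin 4)) r, (j 0 : ℝ) := by
    intro k
    refine Finset.sum_bij' (fun j _ => j ∘ Equiv.swap 0 k) (fun j _ => j ∘ Equiv.swap 0 k) ?_ ?_ ?_ ?_ ?_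
    · intro j hj
      simp only [Finset.mem_piAntidiag, Finset.mem_univ, implies_true, and_true] at hj ⊢
      rw [← hj]
      exact Equiv.sum_comp (Equiv.swap 0 k) j
    · intro j hj
      simp only [Finset.mem_piAntidiag, Finset.mem_univ, implies_true, and_true] at hj ⊢
      rw [← hj]
      exact Equiv.sum_comp (Equiv.swap 0 k) j
    · intro j _; funext x; simp
    · intro j _; funext x; simp
    · intro j _; simp
  have h1 : ∑ k : Fin 4, (∑ j ∈ Finset.piAntidiag (Finset.univ : Finset (Fin 4)) r, (j k : ℝ)) =
      (Finset.piAntidiag (Finset.univ : Finset (Fin 4)) r).card * r := by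
    rw [Finset.sum_comm, Finset.cast_card, Finset.sum_mul]
    refine Finset.sum_congr rfl fun j hj => ?_
    simp only [Finset.mem_piAntidiag, Finset.mem_univ, implies_true, and_true] at hj
    rw [one_mul, ← hj]; push_cast; rfl
  rw [Finset.sum_congr rfl (fun k _ => sym k)] at h1
  rw [sym k, ← h1]; simp

lemma mgf_block (r : ℕ) (hr : 0 < r) (e : Fin 4 → ℝ) (E θ s : ℝ) (hE : 0 < E) (he : ∀ k, |e k| ≤ E)
    (hs : 0 ≤ s) (hsE : s * E ≤ 1) (hsum : ∑ k, e k ≤ -(4 * θ)) :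
    ∑ j ∈ Finset.piAntidiag (Finset.univ : Finset (Fin 4)) r, Real.exp (s * ∑ k, e k * j k / r) ≤
      (Finset.piAntidiag (Finset.univ : Finset (Fin 4)) r).card * Real.exp (-(s * θ) + (s * E) ^ 2) := by
  have hr' : (0:ℝ) < r := by exact_mod_cast hr
  have hb : ∀ j ∈ Finset.piAntidiag (Finset.univ : Finset (Fin 4)) r, |∑ k, e k * j k / r| ≤ E := by
    intro j hj
    simp only [Finset.mem_piAntidiag, Finset.mem_univ, implies_true, and_true] at hj
    refine (Finset.abs_sum_le_sum_abs _ _).trans ?_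
    have : ∀ k ∈ (Finset.univ : Finset (Fin 4)), |e k * j k / r| ≤ E * (j k / r) := by
      intro k _
      rw [mul_div_assoc, abs_mul, abs_of_nonneg (a := (j k : ℝ) / r) (by positivity)]
      exact mul_le_mul_of_nonneg_right (he k) (by positivity)
    refine (Finset.sum_le_sum this).trans ?_
    rw [← Finset.mul_sum, ← Finset.sum_div]
    have : (∑ k, (j k : ℝ)) = r := by rw [← hj]; push_cast; rfl
    rw [this, div_self hr'.ne', mul_one]
  have h1 : ∀ j ∈ Finset.piAntidiag (Finset.univ : Finset (Fin 4)) r,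
      Real.exp (s * ∑ k, e k * j k / r) ≤ 1 + s * ∑ k, e k * j k / r + (s * E) ^ 2 := by
    intro j hj
    have hx : |s * ∑ k, e k * j k / r| ≤ s * E := by
      rw [abs_mul, abs_of_nonneg hs]; exact mul_le_mul_of_nonneg_left (hb j hj) hs
    have h2 := Real.abs_exp_sub_one_sub_id_le (hx.trans hsE)
    have h3 : (s * ∑ k, e k * j k / r) ^ 2 ≤ (s * E) ^ 2 := by
      rw [← sq_abs]; exact pow_le_pow_left₀ (abs_nonneg _) hx 2
    have := (abs_le.1 h2).2
    linarith
  refine (Finset.sum_le_sum h1).trans ?_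
  rw [Finset.sum_add_distrib, Finset.sum_add_distrib, ← Finset.mul_sum, Finset.sum_comm]
  have h4 : ∑ k, ∑ j ∈ Finset.piAntidiag (Finset.univ : Finset (Fin 4)) r, e k * (j k : ℝ) / r =
      (Finset.piAntidiag (Finset.univ : Finset (Fin 4)) r).card * ((∑ k, e k) / 4) := by
    have : ∀ k, ∑ j ∈ Finset.piAntidiag (Finset.univ : Finset (Fin 4)) r, e k * (j k : ℝ) / r =
      (Finset.piAntidiag (Finset.univ : Finset (Fin 4)) r).card * (e k / 4) := by
      intro k
      rw [← Finset.sum_div, ← Finset.mul_sum, sum_antidiag_coord]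
      field_simp
    rw [Finset.sum_congr rfl (fun k _ => this k), ← Finset.mul_sum, Finset.sum_div]
  rw [h4, Finset.sum_const, Finset.sum_const, nsmul_eq_mul, nsmul_eq_mul]
  set N : ℝ := ((Finset.piAntidiag (Finset.univ : Finset (Fin 4)) r).card : ℝ)
  have hN : 0 ≤ N := by positivity
  have h5 := Real.add_one_le_exp (-(s * θ) + (s * E) ^ 2)
  have h6 : s * ((∑ k, e k) / 4) ≤ - (s * θ) := by
    have := mul_le_mul_of_nonneg_left hsum hs
    linarith
  calc N * 1 + s * (N * ((∑ k, e k) / 4)) + N * (s * E) ^ 2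
      = N * (1 + s * ((∑ k, e k) / 4) + (s * E) ^ 2) := by ring
    _ ≤ _ := mul_le_mul_of_nonneg_left (by linarith) hN

lemma count_bad {m : ℕ} (r : Fin m → ℕ) (hr : ∀ h, 0 < r h) (e : Fin m → Fin 4 → ℝ) (E θ : ℝ)
    (hE : 0 < E) (hθ : 0 < θ) (hθE : θ ≤ E)
    (he : ∀ h k, |e h k| ≤ E) (hsum : ∀ h, ∑ k, e h k ≤ -(4 * θ)) :
    (((JJ r).filter (fun j => -(m * θ / 2) ≤ ∑ h, ∑ k, e h k * j h k / r h)).card : ℝ) ≤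
      (JJ r).card * Real.exp (-(m * θ ^ 2 / (16 * E ^ 2))) := by
  set s : ℝ := θ / (4 * E ^ 2) with hs
  have hs0 : 0 < s := by positivity
  have hsE : s * E ≤ 1 := by
    have : s * E = θ / E / 4 := by rw [hs]; field_simp
    rw [this]
    have : θ / E ≤ 1 := (div_le_one hE).2 hθE
    linarith
  have h1 : (((JJ r).filter (fun j => -(m * θ / 2) ≤ ∑ h, ∑ k, e h k * j h k / r h)).card : ℝ) ≤
      ∑ j ∈ JJ r, Real.exp (s * (m * θ / 2)) * ∏ h, Real.exp (s * ∑ k, e h k * j h k / r h) := by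
    rw [Finset.cast_card, Finset.sum_filter]
    refine Finset.sum_le_sum fun j _ => ?_
    rw [← Real.exp_sum, ← Real.exp_add, ← Finset.mul_sum, ← mul_add]
    split_ifs with h
    · apply Real.one_le_exp
      apply mul_nonneg hs0.le; linarith
    · positivity
  refine h1.trans ?_
  rw [← Finset.mul_sum]
  have h2 : ∑ j ∈ JJ r, ∏ h, Real.exp (s * ∑ k, e h k * j h k / r h) =
      ∏ h, ∑ j ∈ Finset.piAntidiag (Finset.univ : Finset (Fin 4)) (r h), Real.exp (s * ∑ k, e h k * j k / r h) := by
    rw [Finset.prod_univ_sum]; rfl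
  rw [h2]
  have h3 : ∏ h, ∑ j ∈ Finset.piAntidiag (Finset.univ : Finset (Fin 4)) (r h), Real.exp (s * ∑ k, e h k * j k / r h) ≤
      ∏ h : Fin m, ((Finset.piAntidiag (Finset.univ : Finset (Fin 4)) (r h)).card * Real.exp (-(s * θ) + (s * E) ^ 2)) :=
    Finset.prod_le_prod (fun _ _ => by positivity)
      (fun h _ => mgf_block (r h) (hr h) (e h) E θ s hE (he h) hs0.le hsE (hsum h))
  refine (mul_le_mul_of_nonneg_left h3 (by positivity)).trans ?_
  rw [Finset.prod_mul_distrib, Finset.prod_const, Finset.card_univ, Fintype.card_fin, ← Real.exp_nat_mul]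
  have h4 : ((JJ r).card : ℝ) = ∏ h : Fin m, ((Finset.piAntidiag (Finset.univ : Finset (Fin 4)) (r h)).card : ℝ) := by
    rw [JJ, Fintype.card_piFinset]; push_cast; rfl
  rw [← h4, mul_left_comm, ← Real.exp_add]
  refine le_of_eq ?_
  congr 2
  rw [hs]; field_simp; ring

lemma card_JJ_le {m : ℕ} (r : Fin m → ℕ) : ((JJ r).card : ℝ) ≤ 16 ^ (∑ h, r h) := by
  have h1 : (JJ r).card ≤ 16 ^ (∑ h, r h) := by
    rw [← Finset.prod_pow_eq_pow_sum, JJ, Fintype.card_piFinset]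
    refine Finset.prod_le_prod' fun h _ => ?_
    have : Finset.piAntidiag (Finset.univ : Finset (Fin 4)) (r h) ⊆
        Fintype.piFinset (fun _ : Fin 4 => Finset.range (r h + 1)) := by
      intro j hj
      simp only [Finset.mem_piAntidiag, Finset.mem_univ, implies_true, and_true] at hj
      rw [Fintype.mem_piFinset]
      intro k
      rw [Finset.mem_range, Nat.lt_succ_iff, ← hj]
      exact Finset.single_le_sum (f := j) (fun _ _ => Nat.zero_le _) (Finset.mem_univ k)
    refine (Finset.card_le_card this).trans ?_
    rw [Fintype.card_piFinset]
    simp only [Finset.card_range, Finset.prod_const, Finset.card_univ, Fintype.card_fin]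
    calc (r h + 1) ^ 4 ≤ (2 ^ r h) ^ 4 := Nat.pow_le_pow_left Nat.lt_two_pow_self 4
      _ = 16 ^ r h := by rw [← pow_mul, mul_comm, pow_mul]; norm_num
  exact_mod_cast h1

end

section

open MvPolynomial

/-! ### finite free-ish orders -/
/-- integral combination of the `ω` -/
def Sp {n : ℕ} (ω : Fin n → ℝ) (x : ℝ) : Prop := ∃ c : Fin n → ℤ, x = ∑ l, (c l : ℝ) * ω l

lemma exists_order (y : ℝ) (hy : IsAlgebraic ℚ y) :
    ∃ (n : ℕ) (ω : Fin n → ℝ) (D : ℤ), D ≠ 0 ∧ (∀ i j, Sp ω (ω i * ω j)) ∧ Sp ω 0 ∧ Sp ω 1 ∧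
      Sp ω (D ^ 2) ∧ Sp ω (D ^ 2 * y) ∧ Sp ω (D ^ 2 * y ^ 2) ∧ Sp ω (-(D ^ 2 * y)) ∧ Sp ω (-(D ^ 2 * y ^ 2)) := by
  have hy' : IsAlgebraic ℤ y := (IsFractionRing.isAlgebraic_iff ℤ ℚ ℝ).2 hy
  obtain ⟨D, hD, hintg⟩ := hy'.exists_integral_multiple
  have hfg := hintg.fg_adjoin_singleton
  obtain ⟨n, ω, hω⟩ := Submodule.fg_iff_exists_fin_generating_family.1 hfg
  have key : ∀ x, x ∈ Algebra.adjoin ℤ {D • y} ↔ Sp ω x := by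
    intro x
    rw [← Subalgebra.mem_toSubmodule, ← hω, Submodule.mem_span_range_iff_exists_fun]
    constructor
    · rintro ⟨c, rfl⟩; exact ⟨c, by simp⟩
    · rintro ⟨c, rfl⟩; exact ⟨c, by simp⟩
  have hb : (D : ℝ) * y ∈ Algebra.adjoin ℤ {D • y} := by
    have := Algebra.self_mem_adjoin_singleton ℤ (D • y)
    simpa using this
  have hD1 : (D : ℝ) ∈ Algebra.adjoin ℤ {D • y} := intCast_mem _ D
  have hw : ∀ i, ω i ∈ Algebra.adjoin ℤ {D • y} := by
    intro i
    rw [← Subalgebra.mem_toSubmodule, ← hω]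
    exact Submodule.subset_span ⟨i, rfl⟩
  have e1 : (D : ℝ) ^ 2 * y = D * (D * y) := by ring
  have e2 : (D : ℝ) ^ 2 * y ^ 2 = (D * y) ^ 2 := by ring
  have h1 : (D : ℝ) ^ 2 * y ∈ Algebra.adjoin ℤ {D • y} := by rw [e1]; exact mul_mem hD1 hb
  have h2 : (D : ℝ) ^ 2 * y ^ 2 ∈ Algebra.adjoin ℤ {D • y} := by rw [e2]; exact pow_mem hb 2
  refine ⟨n, ω, D, hD, fun i j => (key _).1 (mul_mem (hw i) (hw j)), (key _).1 (zero_mem _), (key _).1 (one_mem _),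
    (key _).1 (pow_mem hD1 2), (key _).1 h1, (key _).1 h2, (key _).1 (neg_mem h1), (key _).1 (neg_mem h2)⟩

lemma IsInt.add {τ : Type*} {F G : MvPolynomial τ ℝ} (hF : IsInt F) (hG : IsInt G) : IsInt (F + G) :=
  add_mem hF hG
lemma IsInt.mul {τ : Type*} {F G : MvPolynomial τ ℝ} (hF : IsInt F) (hG : IsInt G) : IsInt (F * G) :=
  mul_mem hF hG
lemma IsInt.sum {τ ι : Type*} {s : Finset ι} {F : ι → MvPolynomial τ ℝ} (hF : ∀ i ∈ s, IsInt (F i)) :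
    IsInt (∑ i ∈ s, F i) := sum_mem hF
lemma IsInt.C {τ : Type*} (c : ℤ) : IsInt (MvPolynomial.C (c : ℝ) : MvPolynomial τ ℝ) :=
  ⟨MvPolynomial.C c, by simp⟩
lemma IsInt.X {τ : Type*} (c : τ) : IsInt (MvPolynomial.X c : MvPolynomial τ ℝ) :=
  ⟨MvPolynomial.X c, by simp⟩

/-- `F` is an `ω`-combination of integer polynomials of length at most `W` -/
def Rd {n : ℕ} {τ : Type*} (ω : Fin n → ℝ) (W : ℝ) (F : MvPolynomial τ ℝ) : Prop :=
  ∃ G : Fin n → MvPolynomial τ ℝ, (∀ l, IsInt (G l)) ∧ (∀ l, ln1 (G l) ≤ W) ∧ F = ∑ l, C (ω l) * G l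

section Rd
variable {n : ℕ} {τ : Type*} {ω : Fin n → ℝ}

lemma Rd.mono {W W' : ℝ} {F : MvPolynomial τ ℝ} (h : Rd ω W F) (hW : W ≤ W') : Rd ω W' F := by
  obtain ⟨G, h1, h2, h3⟩ := h
  exact ⟨G, h1, fun l => (h2 l).trans hW, h3⟩

lemma Rd.add {W W' : ℝ} {F F' : MvPolynomial τ ℝ} (h : Rd ω W F) (h' : Rd ω W' F') : Rd ω (W + W') (F + F') := by
  obtain ⟨G, h1, h2, h3⟩ := h
  obtain ⟨G', h1', h2', h3'⟩ := h'
  refine ⟨fun l => G l + G' l, fun l => (h1 l).add (h1' l), fun l => ?_, ?_⟩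
  · exact (wn_add_le (fun _ => zero_le_one) _ _).trans (add_le_add (h2 l) (h2' l))
  · rw [h3, h3', ← Finset.sum_add_distrib]; simp only [mul_add]

lemma Rd.sum {ι : Type*} (s : Finset ι) (W : ι → ℝ) (F : ι → MvPolynomial τ ℝ) (h : ∀ i ∈ s, Rd ω (W i) (F i)) :
    Rd ω (∑ i ∈ s, W i) (∑ i ∈ s, F i) := by
  classical
  induction s using Finset.induction_on with
  | empty =>
    refine ⟨fun _ => 0, fun l => zero_mem _, fun l => by simp [ln1, wn_zero], by simp⟩
  | insert a s ha ih =>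
    rw [Finset.sum_insert ha, Finset.sum_insert ha]
    exact (h a (Finset.mem_insert_self a s)).add (ih fun i hi => h i (Finset.mem_insert_of_mem hi))

lemma Rd.C_mul {b : ℝ} (hb : Sp ω b) : ∃ W, 0 ≤ W ∧ ∀ F : MvPolynomial τ ℝ, IsInt F → Rd ω (W * ln1 F) (C b * F) := by
  obtain ⟨c, hc⟩ := hb
  refine ⟨∑ l, |(c l : ℝ)|, Finset.sum_nonneg fun _ _ => abs_nonneg _, fun F hF =>
    ⟨fun l => C (c l : ℝ) * F, fun l => (IsInt.C _).mul hF, fun l => ?_, ?_⟩⟩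
  · refine (wn_mul_le (fun _ => zero_le_one) _ _).trans ?_
    rw [wn_C]
    exact mul_le_mul_of_nonneg_right (Finset.single_le_sum (f := fun l => |(c l : ℝ)|) (fun _ _ => abs_nonneg _) (Finset.mem_univ l)) (ln1_nonneg F)
  · rw [hc, map_sum, Finset.sum_mul]
    refine Finset.sum_congr rfl fun l _ => ?_
    rw [map_mul]; ring

lemma Rd.mul (hω : ∀ i j, Sp ω (ω i * ω j)) : ∃ K : ℝ, 1 ≤ K ∧ ∀ (τ : Type) (W W' : ℝ) (F F' : MvPolynomial τ ℝ), 0 ≤ W →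
    Rd ω W F → Rd ω W' F' → Rd ω (K * W * W') (F * F') := by
  choose c hc using hω
  set K : ℝ := 1 + ∑ i, ∑ j, ∑ l, |(c i j l : ℝ)| with hK
  refine ⟨K, ?_, ?_⟩
  · have : 0 ≤ ∑ i, ∑ j, ∑ l, |(c i j l : ℝ)| := by positivity
    linarith
  intro τ W W' F F' hW ⟨G, h1, h2, h3⟩ ⟨G', h1', h2', h3'⟩
  refine ⟨fun l => ∑ i, ∑ j, C (c i j l : ℝ) * (G i * G' j), fun l => ?_, fun l => ?_, ?_⟩
  · exact IsInt.sum fun i _ => IsInt.sum fun j _ => (IsInt.C _).mul ((h1 i).mul (h1' j))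
  · have hW' : 0 ≤ W' := (ln1_nonneg _).trans (h2' l)
    have step : ∀ i j, ln1 (C (c i j l : ℝ) * (G i * G' j)) ≤ |(c i j l : ℝ)| * (W * W') := by
      intro i j
      refine (wn_mul_le (fun _ => zero_le_one) _ _).trans ?_
      rw [wn_C]
      refine mul_le_mul_of_nonneg_left ?_ (abs_nonneg _)
      refine (wn_mul_le (fun _ => zero_le_one) _ _).trans ?_
      exact mul_le_mul (h2 i) (h2' j) (ln1_nonneg _) hW
    have : ln1 (∑ i, ∑ j, C (c i j l : ℝ) * (G i * G' j)) ≤ ∑ i, ∑ j, |(c i j l : ℝ)| * (W * W') := by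
      refine (wn_sum_le (fun _ => zero_le_one) _ _).trans (Finset.sum_le_sum fun i _ => ?_)
      exact (wn_sum_le (fun _ => zero_le_one) _ _).trans (Finset.sum_le_sum fun j _ => step i j)
    refine this.trans ?_
    simp_rw [← Finset.sum_mul]
    rw [mul_assoc]
    refine mul_le_mul_of_nonneg_right ?_ (by positivity)
    have : ∑ i, ∑ j, |(c i j l : ℝ)| ≤ ∑ i, ∑ j, ∑ l, |(c i j l : ℝ)| :=
      Finset.sum_le_sum fun i _ => Finset.sum_le_sum fun j _ =>
        Finset.single_le_sum (f := fun l => |(c i j l : ℝ)|) (fun _ _ => abs_nonneg _) (Finset.mem_univ l)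
    linarith
  · rw [h3, h3', Finset.sum_mul_sum]
    have : ∀ i j, C (ω i) * G i * (C (ω j) * G' j) = ∑ l, C (ω l) * (C (c i j l : ℝ) * (G i * G' j)) := by
      intro i j
      calc C (ω i) * G i * (C (ω j) * G' j) = C (ω i * ω j) * (G i * G' j) := by rw [map_mul]; ring
        _ = _ := by
          rw [hc, map_sum, Finset.sum_mul]
          refine Finset.sum_congr rfl fun l _ => ?_
          rw [map_mul]; ring
    simp_rw [this, Finset.mul_sum]
    rw [Finset.sum_comm' (s := Finset.univ) (t := fun _ => Finset.univ) (t' := Finset.univ) (s' := fun _ => Finset.univ) (by simp)]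
    rw [Finset.sum_congr rfl (fun i _ => Finset.sum_comm)]
    rw [Finset.sum_comm]
    refine Finset.sum_congr rfl fun l _ => Finset.sum_comm
end Rd

/-- block linear substitution -/
noncomputable def lf {m : ℕ} (B : Fin 4 → Fin 4 → ℝ) (p : Fin m × Fin 4) : MvPolynomial (Fin m × Fin 4) ℝ :=
  ∑ k, C (B p.2 k) * X (p.1, k)

lemma Rd_monomials {n : ℕ} {ω : Fin n → ℝ} (hω : ∀ i j, Sp ω (ω i * ω j)) (h1 : Sp ω 1) (B : Fin 4 → Fin 4 → ℝ)
    (hB : ∀ i j, Sp ω (B i j)) :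
    ∃ W0 A : ℝ, 1 ≤ W0 ∧ 1 ≤ A ∧ ∀ (m : ℕ) (i : Fin m × Fin 4 → ℕ), Rd ω (W0 * A ^ (∑ p, i p)) (∏ p, lf B p ^ i p) := by
  obtain ⟨K, hK, hmul⟩ := Rd.mul hω
  obtain ⟨c1, hc1⟩ := h1
  choose c hc using hB
  set W0 : ℝ := 1 + ∑ l, |(c1 l : ℝ)|
  set W : ℝ := 1 + ∑ i, ∑ j, ∑ l, |(c i j l : ℝ)|
  have hW0 : 1 ≤ W0 := by
    have : 0 ≤ ∑ l, |(c1 l : ℝ)| := by positivity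
    linarith
  have hW : 1 ≤ W := by
    have : 0 ≤ ∑ i, ∑ j, ∑ l, |(c i j l : ℝ)| := by positivity
    linarith
  have hKW : 1 ≤ K * W := by nlinarith
  refine ⟨W0, K * W, hW0, hKW, fun m i => ?_⟩
  have hlf : ∀ p : Fin m × Fin 4, Rd ω W (lf B p) := by
    intro p
    refine ⟨fun l => ∑ k, C (c p.2 k l : ℝ) * X (p.1, k), fun l => IsInt.sum fun k _ => (IsInt.C _).mul (IsInt.X _), fun l => ?_, ?_⟩
    · have : ln1 (∑ k, C (c p.2 k l : ℝ) * X (p.1, k)) ≤ ∑ k, |(c p.2 k l : ℝ)| := by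
        refine (wn_sum_le (fun _ => zero_le_one) _ _).trans (Finset.sum_le_sum fun k _ => ?_)
        refine (wn_mul_le (fun _ => zero_le_one) _ _).trans ?_
        rw [wn_C, wn_X, mul_one]
      refine this.trans ?_
      have h1 : ∑ k, |(c p.2 k l : ℝ)| ≤ ∑ k, ∑ l, |(c p.2 k l : ℝ)| := Finset.sum_le_sum fun k _ =>
        Finset.single_le_sum (f := fun l => |(c p.2 k l : ℝ)|) (fun _ _ => abs_nonneg _) (Finset.mem_univ l)
      have h2 : ∑ k, ∑ l, |(c p.2 k l : ℝ)| ≤ ∑ i, ∑ k, ∑ l, |(c i k l : ℝ)| :=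
        Finset.single_le_sum (f := fun i => ∑ k, ∑ l, |(c i k l : ℝ)|) (fun _ _ => by positivity) (Finset.mem_univ p.2)
      linarith
    · unfold lf
      simp_rw [Finset.mul_sum]
      rw [Finset.sum_comm]
      refine Finset.sum_congr rfl fun k _ => ?_
      rw [hc p.2 k, map_sum, Finset.sum_mul]
      refine Finset.sum_congr rfl fun l _ => ?_
      rw [map_mul]; ring
  have hone : Rd ω W0 (1 : MvPolynomial (Fin m × Fin 4) ℝ) := by
    refine ⟨fun l => C (c1 l : ℝ), fun l => IsInt.C _, fun l => ?_, ?_⟩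
    · unfold ln1
      rw [wn_C]
      have := Finset.single_le_sum (f := fun l => |(c1 l : ℝ)|) (fun _ _ => abs_nonneg _) (Finset.mem_univ l)
      simp only [W0]; linarith
    · rw [← C_1, hc1, map_sum]
      refine Finset.sum_congr rfl fun l _ => ?_
      rw [map_mul]; ring
  have hpow : ∀ (V : ℝ) (F : MvPolynomial (Fin m × Fin 4) ℝ) (p) (e : ℕ), 0 ≤ V → Rd ω V F →
      Rd ω (V * (K * W) ^ e) (F * lf B p ^ e) := by
    intro V F p e hV hF
    induction e with
    | zero => simpa using hF
    | succ e ih =>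
      have := hmul _ _ _ _ _ (by positivity) ih (hlf p)
      rw [pow_succ (lf B p), ← mul_assoc]
      refine this.mono (le_of_eq ?_)
      ring
  have hall : ∀ s : Finset (Fin m × Fin 4), Rd ω (W0 * (K * W) ^ (∑ p ∈ s, i p)) (∏ p ∈ s, lf B p ^ i p) := by
    intro s
    induction s using Finset.induction_on with
    | empty => simpa using hone
    | insert a s ha ih =>
      rw [Finset.sum_insert ha, Finset.prod_insert ha, mul_comm (lf B a ^ i a)]
      refine (hpow _ _ a (i a) (by positivity) ih).mono (le_of_eq ?_)
      rw [pow_add]; ring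
  exact hall _

end

section

open MvPolynomial

noncomputable def toF {m : ℕ} (j : Fin m → Fin 4 → ℕ) : (Fin m × Fin 4) →₀ ℕ :=
  Finsupp.equivFunOnFinite.symm (fun p => j p.1 p.2)

lemma toF_apply {m : ℕ} (j : Fin m → Fin 4 → ℕ) (p) : toF j p = j p.1 p.2 := rfl

lemma toF_inj {m : ℕ} {j j' : Fin m → Fin 4 → ℕ} (h : toF j = toF j') : j = j' := by
  funext a b
  have := DFunLike.congr_fun h (a, b)
  simpa [toF_apply] using this

lemma toF_surj {m : ℕ} (μ : (Fin m × Fin 4) →₀ ℕ) : ∃ j, toF j = μ :=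
  ⟨fun h k => μ (h, k), by ext p; rfl⟩

/-- the polynomial with coefficient vector `z` -/
noncomputable def polZ {m : ℕ} (r : Fin m → ℕ) (z : (Fin m → Fin 4 → ℕ) → ℤ) : MvPolynomial (Fin m × Fin 4) ℝ :=
  ∑ j ∈ JJ r, monomial (toF j) (z j : ℝ)

lemma aeval_monomial_lf {m : ℕ} {τ : Type*} (f : Fin m × Fin 4 → MvPolynomial τ ℝ) (j : Fin m → Fin 4 → ℕ) (c : ℝ) :
    aeval f (monomial (toF j) c) = C c * ∏ p, f p ^ (j p.1 p.2) := by
  rw [aeval_monomial, algebraMap_eq, Finsupp.prod_fintype _ _ (by simp)]; rfl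

lemma sum_toF {m : ℕ} {r : Fin m → ℕ} {j : Fin m → Fin 4 → ℕ} (hj : j ∈ JJ r) : ∑ p : Fin m × Fin 4, j p.1 p.2 = ∑ h, r h := by
  rw [Fintype.sum_prod_type]
  exact Finset.sum_congr rfl fun h _ => mem_JJ.1 hj h

lemma JJ_nonempty {m : ℕ} (r : Fin m → ℕ) : (JJ r).Nonempty :=
  ⟨fun h k => if k = 0 then r h else 0, by rw [mem_JJ]; intro h; simp⟩

lemma coeff_lf_mem {m : ℕ} (r : Fin m → ℕ) (z) (B : Fin 4 → Fin 4 → ℝ) (j : Fin m → Fin 4 → ℕ)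
    (h : coeff (toF j) (aeval (lf B) (polZ r z)) ≠ 0) : j ∈ JJ r := by
  rw [mem_JJ]
  intro h0
  let w : Fin m × Fin 4 → ℕ := fun p => if p.1 = h0 then 1 else 0
  have hl : ∀ p, IsWeightedHomogeneous w (lf (m := m) B p) (w p) := by
    intro p
    unfold lf
    refine IsWeightedHomogeneous.sum _ _ _ fun k _ => ?_
    have h1 := (isWeightedHomogeneous_C w (B p.2 k)).mul (isWeightedHomogeneous_X ℝ w (p.1, k))
    simpa [w] using h1
  have hP : IsWeightedHomogeneous w (aeval (lf B) (polZ r z)) (r h0) := by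
    unfold polZ
    rw [map_sum]
    refine IsWeightedHomogeneous.sum _ _ _ fun i hi => ?_
    rw [aeval_monomial_lf]
    have h2 : IsWeightedHomogeneous w (∏ p, lf B p ^ (i p.1 p.2)) (∑ p, i p.1 p.2 • w p) :=
      IsWeightedHomogeneous.prod _ _ _ fun p _ => (hl p).pow _
    have h3 := (isWeightedHomogeneous_C w (z i : ℝ)).mul h2
    have h4 : ∑ p : Fin m × Fin 4, i p.1 p.2 • w p = r h0 := by
      rw [Fintype.sum_prod_type, ← mem_JJ.1 hi h0, Finset.sum_eq_single h0]
      · simp [w]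
      · intro b _ hb; simp [w, hb]
      · simp
    rwa [zero_add, h4] at h3
  have h5 := hP h
  rw [← h5, Finsupp.weight_apply, Finsupp.sum_fintype _ _ (by simp), Fintype.sum_prod_type, Finset.sum_eq_single h0]
  · simp [w, toF_apply]
  · intro b _ hb; simp [w, hb]
  · simp

theorem aux_poly {n : ℕ} {ω : Fin n → ℝ} (hω : ∀ i j, Sp ω (ω i * ω j)) (h1 : Sp ω 1) (B : Fin 4 → Fin 4 → ℝ)
    (hB : ∀ i j, Sp ω (B i j)) : ∃ A : ℝ, 1 ≤ A ∧ ∀ (m : ℕ) (r : Fin m → ℕ) (e : Fin m → Fin 4 → ℝ) (E θ : ℝ),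
    0 < m → (∀ h, 0 < r h) → 0 < E → 0 < θ → θ ≤ E → (∀ h k, |e h k| ≤ E) → (∀ h, ∑ k, e h k ≤ -(4 * θ)) →
    n * Real.exp (-(m * θ ^ 2 / (16 * E ^ 2))) ≤ 1 / 2 →
    ∃ z : (Fin m → Fin 4 → ℕ) → ℤ, (∃ j ∈ JJ r, z j ≠ 0) ∧ (∀ j, |(z j : ℝ)| ≤ A ^ (∑ h, r h)) ∧
      ∀ j ∈ JJ r, -(m * θ / 2) ≤ ∑ h, ∑ k, e h k * j h k / r h → coeff (toF j) (aeval (lf B) (polZ r z)) = 0 := by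
  obtain ⟨W0, A, hW0, hA, hRd⟩ := Rd_monomials hω h1 B hB
  refine ⟨16 * W0 * A, by nlinarith, ?_⟩
  intro m r e E θ hm hr hE hθ hθE he hsum hexp
  choose G hG1 hG2 hG3 using fun j : Fin m → Fin 4 → ℕ => hRd m (fun p => j p.1 p.2)
  have hintg := fun j l => (isInt_iff _).1 (hG1 j l)
  choose c hc using hintg
  classical
  set bad := (JJ r).filter (fun j => -(m * θ / 2) ≤ ∑ h, ∑ k, e h k * j h k / r h) with hbad
  have hcount := count_bad r hr e E θ hE hθ hθE he hsum
  rw [← hbad] at hcount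
  let M : Matrix (bad × Fin n) (JJ r) ℤ := fun b i => c i.1 b.2 (toF b.1.1)
  set R := ∑ h, r h with hR
  have hR0 : 1 ≤ R := by
    have := Finset.single_le_sum (f := r) (fun _ _ => Nat.zero_le _) (Finset.mem_univ ⟨0, hm⟩)
    exact (hr _).trans_le this
  have hME : ∀ b i, |(M b i : ℝ)| ≤ W0 * A ^ R := by
    intro b i
    have : (M b i : ℝ) = coeff (toF b.1.1) (G i.1 b.2) := (hc _ _ _).symm
    rw [this]
    refine (coeff_le_ln1 _ _).trans ((hG2 i.1 b.2).trans (le_of_eq ?_))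
    rw [sum_toF i.2]
  have hJ0 : 0 < (JJ r).card := (JJ_nonempty r).card_pos
  have hcard : (Fintype.card (bad × Fin n) : ℝ) ≤ (Fintype.card (JJ r) : ℝ) / 2 := by
    simp only [Fintype.card_prod, Fintype.card_coe, Fintype.card_fin]
    push_cast
    calc (bad.card : ℝ) * n ≤ (JJ r).card * Real.exp (-(m * θ ^ 2 / (16 * E ^ 2))) * n :=
          mul_le_mul_of_nonneg_right hcount (by positivity)
      _ = (JJ r).card * (n * Real.exp (-(m * θ ^ 2 / (16 * E ^ 2)))) := by ring
      _ ≤ (JJ r).card * (1 / 2) := mul_le_mul_of_nonneg_left hexp (by positivity)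
      _ = _ := by ring
  have hJp : (0:ℝ) < Fintype.card (JJ r) := by rw [Fintype.card_coe]; exact_mod_cast hJ0
  have hbase : (1:ℝ) ≤ W0 * A ^ R := by
    have := one_le_pow₀ hA (n := R)
    nlinarith
  have hfin : (Fintype.card (JJ r) : ℝ) * (W0 * A ^ R) ≤ (16 * W0 * A) ^ R := by
    rw [Fintype.card_coe, mul_pow, mul_pow]
    have h2 := card_JJ_le r
    have h3 : W0 ≤ W0 ^ R := by
      calc W0 = W0 ^ 1 := (pow_one _).symm
        _ ≤ _ := pow_le_pow_right₀ hW0 hR0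
    calc ((JJ r).card : ℝ) * (W0 * A ^ R) ≤ 16 ^ R * (W0 ^ R * A ^ R) := by gcongr
      _ = _ := by ring
  have hsieg : ∃ t : JJ r → ℤ, t ≠ 0 ∧ M.mulVec t = 0 ∧ ∀ i, |(t i : ℝ)| ≤ (16 * W0 * A) ^ R := by
    by_cases h0 : 0 < Fintype.card (bad × Fin n)
    · have hlt : Fintype.card (bad × Fin n) < Fintype.card (JJ r) := by
        have : (Fintype.card (bad × Fin n) : ℝ) < Fintype.card (JJ r) := by linarith
        exact_mod_cast this
      letI : SeminormedAddCommGroup (Matrix (bad × Fin n) (JJ r) ℤ) := Matrix.seminormedAddCommGroup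
      obtain ⟨t, ht0, ht1, ht2⟩ := Int.Matrix.exists_ne_zero_int_vec_norm_le M hlt h0
      refine ⟨t, ht0, ht1, fun i => ?_⟩
      have hn : max 1 ‖M‖ ≤ W0 * A ^ R := by
        refine max_le hbase ?_
        rw [Matrix.norm_le_iff (by linarith)]
        intro b i
        rw [Int.norm_eq_abs]; exact hME b i
      have h3 : |(t i : ℝ)| ≤ ‖t‖ := by
        rw [← Int.norm_eq_abs]; exact norm_le_pi_norm t i
      refine h3.trans (ht2.trans ?_)
      have hb1 : 1 ≤ (Fintype.card (JJ r) : ℝ) * max 1 ‖M‖ := by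
        have : (1:ℝ) ≤ Fintype.card (JJ r) := by
          rw [Fintype.card_coe]; exact_mod_cast hJ0
        have h1 : (1:ℝ) ≤ max 1 ‖M‖ := le_max_left _ _
        nlinarith
      refine (Real.rpow_le_rpow_of_exponent_le hb1 (y := _) (z := 1) ?_).trans ?_
      · rw [div_le_one (by linarith)]; linarith
      · rw [Real.rpow_one]
        exact (mul_le_mul_of_nonneg_left hn hJp.le).trans hfin
    · have hE0 : IsEmpty (bad × Fin n) := by
        rw [← Fintype.card_eq_zero_iff]; omega
      refine ⟨fun _ => 1, ?_, Subsingleton.elim _ _, fun i => ?_⟩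
      · intro h
        obtain ⟨j, hj⟩ := JJ_nonempty r
        have := congrFun h ⟨j, hj⟩
        simp at this
      · simp only [Int.cast_one, abs_one]
        apply one_le_pow₀; nlinarith
  obtain ⟨t, ht0, ht1, ht2⟩ := hsieg
  let z : (Fin m → Fin 4 → ℕ) → ℤ := fun j => if hj : j ∈ JJ r then t ⟨j, hj⟩ else 0
  refine ⟨z, ?_, ?_, ?_⟩
  · obtain ⟨i, hi⟩ := Function.ne_iff.1 ht0
    refine ⟨i.1, i.2, ?_⟩
    simpa [z] using hi
  · intro j
    by_cases hj : j ∈ JJ r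
    · simp only [z, hj, dite_true]; exact ht2 _
    · simp only [z, hj, dite_false, Int.cast_zero, abs_zero]; positivity
  · intro j hj hjb
    have hjb' : j ∈ bad := by rw [hbad, Finset.mem_filter]; exact ⟨hj, hjb⟩
    unfold polZ
    rw [map_sum, coeff_sum]
    have : ∀ i ∈ JJ r, coeff (toF j) (aeval (lf B) (monomial (toF i) (z i : ℝ))) =
        ∑ l, ω l * ((z i * c i l (toF j) : ℤ) : ℝ) := by
      intro i hi
      rw [aeval_monomial_lf, coeff_C_mul, hG3 i, coeff_sum, Finset.mul_sum]
      refine Finset.sum_congr rfl fun l _ => ?_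
      rw [coeff_C_mul, hc]; push_cast; ring
    rw [Finset.sum_congr rfl this, Finset.sum_comm]
    refine Finset.sum_eq_zero fun l _ => ?_
    rw [← Finset.mul_sum]
    have h2 := congrFun ht1 (⟨j, hjb'⟩, l)
    rw [Matrix.mulVec, dotProduct] at h2
    have h3 : ∑ i ∈ JJ r, z i * c i l (toF j) = 0 := by
      rw [← Finset.sum_coe_sort]
      rw [Pi.zero_apply] at h2
      rw [← h2]
      refine Finset.sum_congr rfl fun i _ => ?_
      simp only [z, i.2, dite_true, M]
      ring
    rw [← Int.cast_sum, h3]; simp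

end

section

open MvPolynomial

lemma coeff_partial_eval {κ ι : Type*} [Fintype κ] [Fintype ι] (G : MvPolynomial (κ ⊕ ι) ℝ) (a : κ → ℝ) (i : ι →₀ ℕ)
    (h : ∀ ν : (κ ⊕ ι) →₀ ℕ, (∀ x, ν (Sum.inr x) = i x) → coeff ν G = 0) :
    coeff i (aeval (Sum.elim (fun x => (C (a x) : MvPolynomial ι ℝ)) (fun x => X x)) G) = 0 := by
  classical
  rw [G.as_sum, map_sum, coeff_sum]
  refine Finset.sum_eq_zero fun ν _ => ?_
  by_cases hν : ∀ x, ν (Sum.inr x) = i x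
  · rw [h ν hν]; simp
  · rw [aeval_monomial, algebraMap_eq, Finsupp.prod_fintype _ _ (by simp), Fintype.prod_sum_type]
    simp only [Sum.elim_inl, Sum.elim_inr, ← map_pow, ← map_prod, coeff_C_mul]
    have : (∏ x, (X x : MvPolynomial ι ℝ) ^ ν (Sum.inr x)) = monomial (Finsupp.equivFunOnFinite.symm fun x => ν (Sum.inr x)) 1 := by
      rw [monomial_eq, Finsupp.prod_fintype _ _ (by simp)]; simp
    rw [this, coeff_monomial, if_neg]
    · simp
    · intro h2; apply hν; intro x
      rw [← h2]; rfl

lemma ln1_lf_le (B : Fin 4 → Fin 4 → ℝ) {m : ℕ} (p : Fin m × Fin 4) : ln1 (lf B p) ≤ 1 + ∑ i, ∑ j, |B i j| := by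
  have h0 : ln1 (lf B p) ≤ ∑ k, |B p.2 k| := by
    refine (wn_sum_le (fun _ => zero_le_one) _ _).trans (Finset.sum_le_sum fun k _ => ?_)
    refine (wn_mul_le (fun _ => zero_le_one) _ _).trans ?_
    rw [wn_C, wn_X, mul_one]
  have h2 : ∑ k, |B p.2 k| ≤ ∑ i, ∑ k, |B i k| :=
        Finset.single_le_sum (f := fun i => ∑ k, |B i k|) (fun _ _ => by positivity) (Finset.mem_univ p.2)
  linarith

lemma ln1_subst_le {m : ℕ} (r : Fin m → ℕ) (z : (Fin m → Fin 4 → ℕ) → ℤ) (B : Fin 4 → Fin 4 → ℝ) (A : ℝ) (hA : 1 ≤ A)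
    (hz : ∀ j, |(z j : ℝ)| ≤ A ^ (∑ h, r h)) :
    ln1 (aeval (lf B) (polZ r z)) ≤ (16 * A * (1 + ∑ i, ∑ j, |B i j|)) ^ (∑ h, r h) := by
  set CB := 1 + ∑ i, ∑ j, |B i j| with hCB
  have hCB0 : 0 ≤ CB := by positivity
  unfold polZ
  rw [map_sum]
  refine (wn_sum_le (fun _ => zero_le_one) _ _).trans ?_
  have : ∀ j ∈ JJ r, wn (fun _ => 1) (aeval (lf B) (monomial (toF j) (z j : ℝ))) ≤ A ^ (∑ h, r h) * CB ^ (∑ h, r h) := by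
    intro j hj
    rw [aeval_monomial_lf]
    refine (wn_mul_le (fun _ => zero_le_one) _ _).trans ?_
    rw [wn_C]
    refine mul_le_mul (hz j) ?_ (wn_nonneg (fun _ => zero_le_one) _) (by positivity)
    refine (wn_prod_le (fun _ => zero_le_one) _ _).trans ?_
    rw [← sum_toF hj, ← Finset.prod_pow_eq_pow_sum]
    refine Finset.prod_le_prod (fun _ _ => wn_nonneg (fun _ => zero_le_one) _) fun p _ => ?_
    refine (wn_pow_le (fun _ => zero_le_one) _ _).trans ?_
    exact pow_le_pow_left₀ (wn_nonneg (fun _ => zero_le_one) _) (ln1_lf_le B p) _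
  refine (Finset.sum_le_sum this).trans ?_
  rw [Finset.sum_const, nsmul_eq_mul, mul_pow, mul_pow, mul_assoc]
  exact mul_le_mul_of_nonneg_right (card_JJ_le r) (by positivity)

lemma isInt_aeval_polZ {m : ℕ} {τ : Type*} (r : Fin m → ℕ) (z : (Fin m → Fin 4 → ℕ) → ℤ) (f : Fin m × Fin 4 → MvPolynomial τ ℝ)
    (hf : ∀ p, IsInt (f p)) : IsInt (aeval f (polZ r z)) := by
  unfold polZ
  rw [map_sum]
  refine IsInt.sum fun j _ => ?_
  rw [aeval_monomial_lf]
  exact (IsInt.C _).mul (prod_mem fun p _ => pow_mem (hf p) _)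

lemma aeval_aeval_of {κ ρ τ : Type*} (l : κ → MvPolynomial ρ ℝ) (g : ρ → MvPolynomial τ ℝ) (f : κ → MvPolynomial τ ℝ)
    (h : ∀ p, aeval g (l p) = f p) (P : MvPolynomial κ ℝ) : aeval g (aeval l P) = aeval f P := by
  have : (aeval g : MvPolynomial ρ ℝ →ₐ[ℝ] _).comp (aeval l) = aeval f := by
    apply MvPolynomial.algHom_ext
    intro p
    rw [AlgHom.comp_apply, aeval_X, aeval_X, h]
  rw [← this, AlgHom.comp_apply]

set_option maxHeartbeats 1000000 in
theorem vanish {m : ℕ} (r : Fin m → ℕ) (hr : ∀ h, 0 < r h) (e : Fin m → Fin 4 → ℝ) (E θ A RR : ℝ) (q : Fin m → ℝ)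
    (hm : 0 < m) (hE : 0 < E) (hθ : 0 < θ) (hθE : θ ≤ E) (he : ∀ h k, |e h k| ≤ E) (hA : 1 ≤ A) (hRR : 0 < RR)
    (hq : ∀ h, 0 ≤ q h)
    (z : (Fin m → Fin 4 → ℕ) → ℤ) (B : Fin 4 → Fin 4 → ℝ)
    (hz : ∀ j, |(z j : ℝ)| ≤ A ^ (∑ h, r h))
    (hbad : ∀ j ∈ JJ r, -(m * θ / 2) ≤ ∑ h, ∑ k, e h k * j h k / r h → coeff (toF j) (aeval (lf B) (polZ r z)) = 0)
    (Y : Fin m → Fin 3 → Fin 4 → ℤ) (l : Fin m → Fin 3 → Fin 4 → ℝ) (hY : ∀ h i k, (Y h i k : ℝ) = ∑ k', B k k' * l h i k')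
    (hl : ∀ h i k, |l h i k| ≤ Real.exp (q h * e h k))
    (ν : Fin 4 → ℝ) (hν : ∀ k, |ν k| ≤ 1) (hν1 : ∀ k, (if k = 1 then (1:ℝ) else 0) = ∑ k', B k k' * ν k')
    (hq1 : ∀ h, RR ≤ r h * q h) (hq2 : ∀ h, r h * q h ≤ (1 + θ / (4 * E)) * RR)
    (hbig : (∑ h, r h : ℕ) * Real.log (64 * A * (1 + ∑ i, ∑ j, |B i j|)) ≤ RR * m * θ / 8)
    (a : Fin m → Fin 3 → ℝ) (i : Fin m →₀ ℕ) (hi : wtH r i ≤ m * θ / (32 * E)) :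
    coeff i (aeval (fun p : Fin m × Fin 4 => (C (∑ i, a p.1 i * Y p.1 i p.2) + (if p.2 = 1 then X p.1 else 0) :
      MvPolynomial (Fin m) ℝ)) (polZ r z)) = 0 := by
  set CB := 1 + ∑ i, ∑ j, |B i j| with hCB
  have hCB1 : 1 ≤ CB := by
    have : 0 ≤ ∑ i, ∑ j, |B i j| := by positivity
    linarith
  set R := ∑ h, r h with hR
  -- generic polynomial
  let g : Fin m × Fin 4 → MvPolynomial ((Fin m × Fin 3) ⊕ Fin m) ℝ := fun p =>
    ∑ i, C (l p.1 i p.2) * X (Sum.inl (p.1, i)) + C (ν p.2) * X (Sum.inr p.1)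
  let f : Fin m × Fin 4 → MvPolynomial ((Fin m × Fin 3) ⊕ Fin m) ℝ := fun p =>
    ∑ i, C (Y p.1 i p.2 : ℝ) * X (Sum.inl (p.1, i)) + C ((if p.2 = 1 then (1 : ℤ) else 0 : ℤ) : ℝ) * X (Sum.inr p.1)
  set T := aeval (lf B) (polZ r z) with hT
  set G := aeval f (polZ r z) with hG
  have hGg : G = aeval g T := by
    rw [hG, hT]
    symm
    apply aeval_aeval_of
    intro p
    unfold lf
    rw [map_sum]
    simp only [map_mul, aeval_X, aeval_C, algebraMap_eq, f, g]
    have e1 : ((if p.2 = 1 then (1 : ℤ) else 0 : ℤ) : ℝ) = ∑ k', B p.2 k' * ν k' := by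
      rw [← hν1]; split_ifs <;> simp
    rw [e1]
    simp only [hY, map_sum, map_mul, mul_add, Finset.sum_add_distrib, Finset.sum_mul, Finset.mul_sum]
    rw [Finset.sum_comm (s := (Finset.univ : Finset (Fin 3)))]
    simp only [mul_assoc]
  have hGint : IsInt G := isInt_aeval_polZ r z f fun p =>
    (IsInt.sum fun i _ => (IsInt.C _).mul (IsInt.X _)).add ((IsInt.C _).mul (IsInt.X _))
  -- weights
  let w : ((Fin m × Fin 3) ⊕ Fin m) → ℝ := Sum.elim (fun _ => 1) (fun h => Real.exp (-(E * q h)))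
  have hw : ∀ x, 0 ≤ w x := by
    rintro (x | x)
    · simp [w]
    · exact (Real.exp_pos _).le
  have hg : ∀ p, wn w (g p) ≤ 4 * Real.exp (q p.1 * e p.1 p.2) := by
    intro p
    refine (wn_add_le hw _ _).trans ?_
    have h1 : wn w (∑ i, C (l p.1 i p.2) * X (Sum.inl (p.1, i))) ≤ ∑ i : Fin 3, Real.exp (q p.1 * e p.1 p.2) := by
      refine (wn_sum_le hw _ _).trans (Finset.sum_le_sum fun i _ => ?_)
      refine (wn_mul_le hw _ _).trans ?_
      rw [wn_C, wn_X]
      simp only [w, Sum.elim_inl, mul_one]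
      exact hl _ _ _
    have h2 : wn w (C (ν p.2) * X (Sum.inr p.1)) ≤ Real.exp (q p.1 * e p.1 p.2) := by
      refine (wn_mul_le hw _ _).trans ?_
      rw [wn_C, wn_X]
      simp only [w, Sum.elim_inr]
      calc |ν p.2| * Real.exp (-(E * q p.1)) ≤ 1 * Real.exp (-(E * q p.1)) :=
            mul_le_mul_of_nonneg_right (hν _) (Real.exp_pos _).le
        _ ≤ _ := by
          rw [one_mul, Real.exp_le_exp]
          have := (abs_le.1 (he p.1 p.2)).1
          nlinarith [hq p.1]
    simp only [Finset.sum_const, Finset.card_univ, Fintype.card_fin, nsmul_eq_mul, Nat.cast_ofNat] at h1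
    linarith
  have hGw : wn w G ≤ Real.exp (-(RR * m * θ / 8)) := by
    rw [hGg]
    refine (wn_aeval_le hw g T).trans ?_
    refine (wn_mono (fun p => wn_nonneg hw _) hg T).trans ?_
    have hterm : ∀ μ ∈ T.support, |coeff μ T| * μ.prod (fun p k => (4 * Real.exp (q p.1 * e p.1 p.2)) ^ k) ≤
        |coeff μ T| * (4 ^ R * Real.exp (-(RR * m * θ / 4))) := by
      intro μ hμ
      refine mul_le_mul_of_nonneg_left ?_ (abs_nonneg _)
      obtain ⟨j, rfl⟩ := toF_surj μ
      have hne := mem_support_iff.1 hμ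
      have hj := coeff_lf_mem r z B j hne
      have hgood : ∑ h, ∑ k, e h k * j h k / r h < -(m * θ / 2) := by
        by_contra hcon
        exact hne (hbad j hj (not_lt.1 hcon))
      rw [Finsupp.prod_fintype _ _ (by simp)]
      simp only [mul_pow, Finset.prod_mul_distrib, toF_apply]
      rw [Finset.prod_pow_eq_pow_sum, sum_toF hj]
      refine mul_le_mul_of_nonneg_left ?_ (by positivity)
      simp only [← Real.exp_nat_mul]
      rw [← Real.exp_sum, Real.exp_le_exp, Fintype.sum_prod_type]
      have hx : ∀ h, |∑ k, e h k * j h k / r h| ≤ E := by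
        intro h
        have hr' : (0:ℝ) < r h := by exact_mod_cast hr h
        refine (Finset.abs_sum_le_sum_abs _ _).trans ?_
        have : ∀ k ∈ (Finset.univ : Finset (Fin 4)), |e h k * j h k / r h| ≤ E * (j h k / r h) := by
          intro k _
          rw [mul_div_assoc, abs_mul, abs_of_nonneg (a := (j h k : ℝ) / r h) (by positivity)]
          exact mul_le_mul_of_nonneg_right (he h k) (by positivity)
        refine (Finset.sum_le_sum this).trans ?_
        rw [← Finset.mul_sum, ← Finset.sum_div]
        have : (∑ k, (j h k : ℝ)) = r h := by rw [← mem_JJ.1 hj h]; push_cast; rfl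
        rw [this, div_self hr'.ne', mul_one]
      have hh : ∀ h, ∑ k, (j h k : ℝ) * (q h * e h k) ≤ RR * (∑ k, e h k * j h k / r h) + RR * (θ / 4) := by
        intro h
        have hr' : (0:ℝ) < r h := by exact_mod_cast hr h
        have e1 : ∑ k, (j h k : ℝ) * (q h * e h k) = (r h * q h) * ∑ k, e h k * j h k / r h := by
          rw [Finset.mul_sum]
          refine Finset.sum_congr rfl fun k _ => ?_
          field_simp
        rw [e1]
        have h3 := (abs_le.1 (hx h)).2
        have h4 : (r h * q h - RR) * (∑ k, e h k * j h k / r h) ≤ (θ / (4 * E) * RR) * E := by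
          have h5 : 0 ≤ r h * q h - RR := by linarith [hq1 h]
          have h6 : r h * q h - RR ≤ θ / (4 * E) * RR := by linarith [hq2 h]
          calc _ ≤ (r h * q h - RR) * E := mul_le_mul_of_nonneg_left h3 h5
            _ ≤ _ := mul_le_mul_of_nonneg_right h6 hE.le
        have h7 : (θ / (4 * E) * RR) * E = RR * (θ / 4) := by field_simp
        linarith
      refine (Finset.sum_le_sum fun h _ => hh h).trans ?_
      rw [Finset.sum_add_distrib, ← Finset.mul_sum]
      simp only [Finset.sum_const, Finset.card_univ, Fintype.card_fin, nsmul_eq_mul]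
      nlinarith
    refine (Finset.sum_le_sum hterm).trans ?_
    rw [← Finset.sum_mul, ← ln1_eq]
    have h1 := ln1_subst_le r z B A hA hz
    rw [← hT, ← hCB, ← hR] at h1
    calc ln1 T * (4 ^ R * Real.exp (-(RR * m * θ / 4))) ≤ (16 * A * CB) ^ R * (4 ^ R * Real.exp (-(RR * m * θ / 4))) :=
          mul_le_mul_of_nonneg_right h1 (by positivity)
      _ = (64 * A * CB) ^ R * Real.exp (-(RR * m * θ / 4)) := by
          rw [← mul_assoc, ← mul_pow]; congr 2; ring
      _ = Real.exp (R * Real.log (64 * A * CB)) * Real.exp (-(RR * m * θ / 4)) := by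
          rw [Real.exp_nat_mul, Real.exp_log (by positivity)]
      _ ≤ Real.exp (RR * m * θ / 8) * Real.exp (-(RR * m * θ / 4)) := by
          refine mul_le_mul_of_nonneg_right (Real.exp_le_exp.2 hbig) (Real.exp_pos _).le
      _ = _ := by rw [← Real.exp_add]; congr 1; ring
  -- coefficients
  have hcoef : ∀ ν : ((Fin m × Fin 3) ⊕ Fin m) →₀ ℕ, (∀ x, ν (Sum.inr x) = i x) → coeff ν G = 0 := by
    intro ν hνi
    obtain ⟨c, hc⟩ := (isInt_iff G).1 hGint ν
    have h1 := (coeff_le_wn hw G ν).trans hGw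
    rw [Finsupp.prod_fintype _ _ (by simp), Fintype.prod_sum_type] at h1
    simp only [w, Sum.elim_inl, Sum.elim_inr, one_pow, Finset.prod_const_one, one_mul, hνi, ← Real.exp_nat_mul] at h1
    rw [← Real.exp_sum] at h1
    have h2 : -(RR * m * θ / 16) ≤ ∑ x, (i x : ℝ) * -(E * q x) := by
      have h3 : ∑ x, (i x : ℝ) * (E * q x) ≤ 2 * RR * E * wtH r i := by
        rw [wtH_apply, Finset.mul_sum]
        refine Finset.sum_le_sum fun x _ => ?_
        have hr' : (0:ℝ) < r x := by exact_mod_cast hr x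
        have h4 : r x * q x ≤ 2 * RR := by
          refine (hq2 x).trans ?_
          have : θ / (4 * E) ≤ 1 := by rw [div_le_one (by positivity)]; linarith
          nlinarith
        calc (i x : ℝ) * (E * q x) = (r x * q x) * (E * (i x / r x)) := by field_simp
          _ ≤ 2 * RR * (E * (i x / r x)) := mul_le_mul_of_nonneg_right h4 (by positivity)
          _ = _ := by ring
      have h5 : 2 * RR * E * wtH r i ≤ RR * m * θ / 16 := by
        calc 2 * RR * E * wtH r i ≤ 2 * RR * E * (m * θ / (32 * E)) := mul_le_mul_of_nonneg_left hi (by positivity)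
          _ = _ := by field_simp; ring
      simp only [mul_neg, Finset.sum_neg_distrib]
      linarith
    have h6 : |coeff ν G| < 1 := by
      have h7 : |coeff ν G| * Real.exp (-(RR * m * θ / 16)) ≤ Real.exp (-(RR * m * θ / 8)) :=
        (mul_le_mul_of_nonneg_left (Real.exp_le_exp.2 h2) (abs_nonneg _)).trans h1
      have hm' : (0:ℝ) < m := by exact_mod_cast hm
      have h8 : Real.exp (-(RR * m * θ / 8)) < 1 * Real.exp (-(RR * m * θ / 16)) := by
        rw [one_mul, Real.exp_lt_exp]
        have : 0 < RR * m * θ := by positivity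
        linarith
      exact lt_of_mul_lt_mul_right (h7.trans_lt h8) (Real.exp_pos _).le
    rw [hc] at h6 ⊢
    have : |c| < 1 := by exact_mod_cast h6
    rw [Int.abs_lt_one_iff.1 this]; simp
  have hfinal := coeff_partial_eval G (fun x : Fin m × Fin 3 => a x.1 x.2) i hcoef
  rw [hG, aeval_aeval_of f _ _ (fun p => rfl)] at hfinal
  rw [← hfinal]
  congr 2
  congr 1
  funext p
  simp only [f, map_add, map_sum, map_mul, aeval_X, aeval_C, algebraMap_eq, Sum.elim_inl, Sum.elim_inr]
  congr 1
  · refine Finset.sum_congr rfl fun i _ => ?_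
    rw [mul_comm]
  · split_ifs <;> simp

end

section

open MvPolynomial

lemma coeff_trl {τ : Type*} [Fintype τ] (η : τ → ℝ) (F : MvPolynomial τ ℝ) (i : τ →₀ ℕ) :
    coeff i (trl η F) = eval η (hd i F) := by
  have h1 := coeff_hd i 0 (trl η F)
  have h2 : mb (0 + i) i = 1 := by simp [mb]
  rw [h2, zero_add, Nat.cast_one, mul_one] at h1
  rw [← h1, hd_trl, ← constantCoeff_eq]
  generalize hd i F = P
  have : (constantCoeff : MvPolynomial τ ℝ →+* ℝ).comp (trl η : MvPolynomial τ ℝ →ₐ[ℝ] _).toRingHom = eval η := by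
    apply MvPolynomial.ringHom_ext
    · intro c; simp [trl]
    · intro c; simp [trl]
  rw [← this]; rfl

noncomputable def jx {m : ℕ} (j : Fin m → Fin 4 → ℕ) : Fin m →₀ ℕ := Finsupp.equivFunOnFinite.symm (fun h => j h 1)
noncomputable def jw {m : ℕ} (j : Fin m → Fin 4 → ℕ) : Fin m × Fin 2 →₀ ℕ :=
  Finsupp.equivFunOnFinite.symm (fun p => j p.1 (if p.2 = 0 then 2 else 3))

lemma jx_jw_inj {m : ℕ} {r : Fin m → ℕ} {j j' : Fin m → Fin 4 → ℕ} (hj : j ∈ JJ r) (hj' : j' ∈ JJ r)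
    (h1 : jx j = jx j') (h2 : jw j = jw j') : j = j' := by
  have a1 : ∀ h, j h 1 = j' h 1 := fun h => DFunLike.congr_fun h1 h
  have a2 : ∀ h, j h 2 = j' h 2 := fun h => DFunLike.congr_fun h2 (h, 0)
  have a3 : ∀ h, j h 3 = j' h 3 := fun h => DFunLike.congr_fun h2 (h, 1)
  rw [mem_JJ] at hj hj'
  funext h k
  have b1 := hj h
  have b2 := hj' h
  rw [Fin.sum_univ_four] at b1 b2
  have := a1 h; have := a2 h; have := a3 h
  fin_cases k <;> simp <;> omega

def dw {m : ℕ} (j : Fin m → Fin 4 → ℕ) : ℕ := ∑ h, (j h 2 + j h 3)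

lemma dw_eq {m : ℕ} {j j' : Fin m → Fin 4 → ℕ} (h2 : jw j = jw j') : dw j = dw j' := by
  have a2 : ∀ h, j h 2 = j' h 2 := fun h => DFunLike.congr_fun h2 (h, 0)
  have a3 : ∀ h, j h 3 = j' h 3 := fun h => DFunLike.congr_fun h2 (h, 1)
  unfold dw
  simp only [a2, a3]

/-- the point at which we evaluate -/
noncomputable def tpt {m : ℕ} (η : Fin m → ℝ) (τ : ℝ) (w : Fin m × Fin 2 → ℝ) (h : Fin m) : Fin 4 → ℝ :=
  ![1, η h, τ * w (h, 0), τ * w (h, 1)]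

lemma subst_monomial {m : ℕ} (η : Fin m → ℝ) (τ : ℝ) (w : Fin m × Fin 2 → ℝ) (j : Fin m → Fin 4 → ℕ) (c : ℝ) :
    aeval (fun p : Fin m × Fin 4 => (C (tpt η τ w p.1 p.2) + (if p.2 = 1 then X p.1 else 0) :
      MvPolynomial (Fin m) ℝ)) (monomial (toF j) c) =
    C (c * τ ^ dw j * eval w (monomial (jw j) 1)) * trl η (monomial (jx j) 1) := by
  rw [aeval_monomial_lf, Fintype.prod_prod_type]
  simp only [Fin.prod_univ_four]
  have e1 : trl η (monomial (jx j) 1) = ∏ h, (X h + C (η h)) ^ j h 1 := by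
    unfold trl
    rw [aeval_monomial, algebraMap_eq, map_one, one_mul, Finsupp.prod_fintype _ _ (by simp)]; rfl
  have e2 : eval w (monomial (jw j) 1) = ∏ h, (w (h, 0) ^ j h 2 * w (h, 1) ^ j h 3) := by
    rw [eval_monomial, one_mul, Finsupp.prod_fintype _ _ (by simp), Fintype.prod_prod_type]
    simp only [Fin.prod_univ_two]
    rfl
  rw [e1, e2, dw, ← Finset.prod_pow_eq_pow_sum, mul_assoc c, ← Finset.prod_mul_distrib, map_mul, map_prod,
    mul_assoc, ← Finset.prod_mul_distrib]
  congr 1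
  refine Finset.prod_congr rfl fun h _ => ?_
  simp [tpt]
  ring

theorem reduce {m : ℕ} (r : Fin m → ℕ) (z : (Fin m → Fin 4 → ℕ) → ℤ) (hz0 : ∃ j ∈ JJ r, z j ≠ 0) (A : ℝ)
    (hz : ∀ j, |(z j : ℝ)| ≤ A ^ (∑ h, r h)) (ξ : Fin m → ℝ) (lam : Fin m → Fin 2 → ℝ) (ε : ℝ)
    (hv : ∀ t : Fin m → Fin 4 → ℝ, (∀ h, t h 1 = ξ h * t h 0 + lam h 0 * t h 2 + lam h 1 * t h 3) →
      ∀ i, wtH r i ≤ ε → coeff i (aeval (fun p : Fin m × Fin 4 => (C (t p.1 p.2) + (if p.2 = 1 then X p.1 else 0) :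
      MvPolynomial (Fin m) ℝ)) (polZ r z)) = 0) :
    ∃ F : MvPolynomial (Fin m) ℝ, F ≠ 0 ∧ IsInt F ∧ (∀ h, degreeOf h F ≤ r h) ∧ ln1 F ≤ (16 * A) ^ (∑ h, r h) ∧
      ∀ i, wtH r i ≤ ε → coeff i (trl ξ F) = 0 := by
  classical
  set S := (JJ r).filter (fun j => z j ≠ 0) with hS
  have hSne : S.Nonempty := by
    obtain ⟨j, hj, hj0⟩ := hz0
    exact ⟨j, Finset.mem_filter.2 ⟨hj, hj0⟩⟩
  obtain ⟨j0, hj0, hmin⟩ := Finset.exists_min_image S dw hSne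
  have hSJ : ∀ j ∈ S, j ∈ JJ r := fun j hj => (Finset.mem_filter.1 hj).1
  set D := dw j0 with hD
  have hpol : polZ r z = ∑ j ∈ S, monomial (toF j) (z j : ℝ) := by
    unfold polZ
    rw [hS, Finset.sum_filter]
    refine Finset.sum_congr rfl fun j _ => ?_
    split_ifs with h
    · rfl
    · push Not at h; rw [h]; simp
  set S0 := S.filter (fun j => jw j = jw j0) with hS0
  have hj00 : j0 ∈ S0 := Finset.mem_filter.2 ⟨hj0, rfl⟩
  refine ⟨∑ j ∈ S0, monomial (jx j) (z j : ℝ), ?_, ?_, ?_, ?_, ?_⟩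
  · intro h
    have h1 := congrArg (coeff (jx j0)) h
    rw [coeff_sum, coeff_zero, Finset.sum_eq_single j0] at h1
    · rw [coeff_monomial, if_pos rfl] at h1
      have := (Finset.mem_filter.1 hj0).2
      exact this (by exact_mod_cast h1)
    · intro j hj hne
      rw [coeff_monomial, if_neg]
      intro h2
      have h3 := Finset.mem_filter.1 hj
      exact hne (jx_jw_inj (hSJ _ h3.1) (hSJ _ hj0) h2 h3.2)
    · intro h; exact absurd hj00 h
  · refine IsInt.sum fun j _ => ?_
    refine ⟨monomial (jx j) (z j), ?_⟩
    rw [map_monomial]; rfl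
  · intro h
    refine (degreeOf_sum_le h _ _).trans (Finset.sup_le fun j hj => ?_)
    have h3 := mem_JJ.1 (hSJ j (Finset.mem_filter.1 hj).1) h
    rw [degreeOf_monomial_eq _ _ (by
      have := (Finset.mem_filter.1 (Finset.mem_filter.1 hj).1).2
      exact_mod_cast this)]
    rw [← h3]
    exact Finset.single_le_sum (f := j h) (fun _ _ => Nat.zero_le _) (Finset.mem_univ 1)
  · refine (wn_sum_le (fun _ => zero_le_one) _ _).trans ?_
    have : ∀ j ∈ S0, wn (fun _ => 1) (monomial (jx j) (z j : ℝ)) ≤ A ^ (∑ h, r h) := by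
      intro j _
      rw [wn_monomial]
      simpa [Finsupp.prod] using hz j
    refine (Finset.sum_le_sum this).trans ?_
    rw [Finset.sum_const, nsmul_eq_mul, mul_pow]
    have hc : (S0.card : ℝ) ≤ 16 ^ (∑ h, r h) := by
      refine le_trans ?_ (card_JJ_le r)
      exact_mod_cast Finset.card_le_card ((Finset.filter_subset _ _).trans (Finset.filter_subset _ _))
    exact mul_le_mul_of_nonneg_right hc ((abs_nonneg _).trans (hz j0))
  · intro i hi
    -- limit argument
    have key : ∀ w : Fin m × Fin 2 → ℝ, ∑ j ∈ S.filter (fun j => dw j = D), (z j : ℝ) * eval w (monomial (jw j) 1) *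
        eval ξ (hd i (monomial (jx j) 1)) = 0 := by
      intro w
      let η : ℝ → Fin m → ℝ := fun τ h => ξ h + τ * (lam h 0 * w (h, 0) + lam h 1 * w (h, 1))
      let f : ℝ → ℝ := fun τ => ∑ j ∈ S, (z j : ℝ) * τ ^ (dw j - D) * eval w (monomial (jw j) 1) *
        eval (η τ) (hd i (monomial (jx j) 1))
      have hη : Continuous η := by
        apply continuous_pi; intro h; simp only [η]; fun_prop
      have hf : Continuous f := by
        apply continuous_finsetSum
        intro j _
        have : Continuous fun τ => eval (η τ) (hd i (monomial (jx j) 1)) :=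
          (MvPolynomial.continuous_eval _).comp hη
        fun_prop
      have hf0 : Set.EqOn f (fun _ => 0) {0}ᶜ := by
        intro τ hτ
        have hτ0 : τ ≠ 0 := hτ
        have h1 := hv (tpt (η τ) τ w) (by intro h; simp [tpt, η]; ring) i hi
        rw [hpol, map_sum, coeff_sum] at h1
        have h2 : τ ^ D * f τ = 0 := by
          rw [← h1, Finset.mul_sum]
          refine Finset.sum_congr rfl fun j hj => ?_
          rw [subst_monomial, coeff_C_mul, coeff_trl]
          have h3 : τ ^ dw j = τ ^ D * τ ^ (dw j - D) := by
            rw [← pow_add, Nat.add_sub_cancel' (hmin j hj)]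
          rw [h3]; ring
        exact (mul_eq_zero.1 h2).resolve_left (pow_ne_zero _ hτ0)
      have h4 := Continuous.ext_on (dense_compl_singleton (0:ℝ)) hf continuous_const hf0
      have h5 := congrFun h4 0
      simp only [f] at h5
      rw [← h5, Finset.sum_filter]
      refine Finset.sum_congr rfl fun j hj => ?_
      have hη0 : η 0 = ξ := by funext h; simp [η]
      rw [hη0]
      split_ifs with h
      · rw [h]; simp
      · have : dw j - D ≠ 0 := by have := hmin j hj; omega
        rw [zero_pow this]; ring
    have hH : (∑ j ∈ S.filter (fun j => dw j = D), monomial (jw j) ((z j : ℝ) * eval ξ (hd i (monomial (jx j) 1)))) = 0 := by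
      apply MvPolynomial.funext
      intro w
      rw [map_zero, ← key w, map_sum]
      refine Finset.sum_congr rfl fun j _ => ?_
      rw [eval_monomial, eval_monomial]; ring
    have h6 := congrArg (coeff (jw j0)) hH
    rw [coeff_sum, coeff_zero] at h6
    rw [coeff_trl, map_sum, map_sum, ← h6, hS0, Finset.sum_filter, Finset.sum_filter (fun j => dw j = D)]
    refine Finset.sum_congr rfl fun j _ => ?_
    by_cases h : jw j = jw j0
    · rw [if_pos h, if_pos (dw_eq h), coeff_monomial, if_pos h, hd_monomial, hd_monomial, eval_monomial, eval_monomial]; ring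
    · rw [if_neg h]
      split_ifs
      · rw [coeff_monomial, if_neg h]
      · rfl

end

section

open MvPolynomial

/-- the four linear forms -/
def Lf (y : ℝ) (v : Fin 4 → ℝ) : Fin 4 → ℝ :=
  ![y * v 0 + v 1 - y ^ 2 * v 2 - y * v 3, v 0 - y * v 2, y * v 2 + v 3, v 2]

lemma ker_span (v : Fin 3 → Fin 4 → ℝ) (hv : LinearIndependent ℝ v) (c t : Fin 4 → ℝ) (hc : c ≠ 0)
    (hvc : ∀ i, ∑ k, c k * v i k = 0) (ht : ∑ k, c k * t k = 0) : ∃ a : Fin 3 → ℝ, ∀ k, t k = ∑ i, a i * v i k := by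
  let M : (Fin 4 → ℝ) →ₗ[ℝ] ℝ := ∑ k, c k • LinearMap.proj k
  have hM : ∀ x, M x = ∑ k, c k * x k := by intro x; simp [M]
  have hle : Submodule.span ℝ (Set.range v) ≤ LinearMap.ker M := by
    rw [Submodule.span_le]
    rintro _ ⟨i, rfl⟩
    simp only [SetLike.mem_coe, LinearMap.mem_ker, hM, hvc]
  have hne : LinearMap.ker M ≠ ⊤ := by
    intro h
    apply hc
    funext k
    have h1 : M (Pi.single k 1) = 0 := by
      rw [← LinearMap.mem_ker, h]; trivial
    rw [hM] at h1
    simpa [Pi.single_apply] using h1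
  have hlt := Submodule.finrank_lt hne
  rw [Module.finrank_fin_fun] at hlt
  have h3 := finrank_span_eq_card hv
  rw [Fintype.card_fin] at h3
  have heq := Submodule.eq_of_le_of_finrank_le hle (by omega)
  have hmem : t ∈ Submodule.span ℝ (Set.range v) := by
    rw [heq, LinearMap.mem_ker, hM, ht]
  obtain ⟨a, ha⟩ := (Submodule.mem_span_range_iff_exists_fun ℝ).1 hmem
  refine ⟨a, fun k => ?_⟩
  rw [← ha]; simp

theorem pt4 (y : ℝ) (halg : IsAlgebraic ℚ y) (E θ : ℝ) (hθ : 0 < θ)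
    (hdata : ∀ N : ℝ, ∃ (p' p q' q : ℤ) (Y : Fin 3 → Fin 4 → ℤ) (e : Fin 4 → ℝ), 2 ≤ q ∧ N ≤ Real.log q ∧ IsCoprime q' q ∧
      (∀ k, |e k| ≤ E) ∧ ∑ k, e k ≤ -(4 * θ) ∧
      (∀ i k, |Lf y (fun k => (Y i k : ℝ)) k| ≤ Real.exp (Real.log q * e k)) ∧
      (∀ i, q' * Y i 0 - p' * Y i 2 - q * Y i 1 + p * Y i 3 = 0) ∧
      LinearIndependent ℝ (fun i k => (Y i k : ℝ))) : False := by
  obtain ⟨n, ω, D, hD, hω, hS0, hS1, hSD, hSDy, hSDy2, hSDyn, hSDy2n⟩ := exists_order y halg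
  let Bm : Fin 4 → Fin 4 → ℝ := ![![0, D ^ 2, 0, D ^ 2 * y], ![D ^ 2, -(D ^ 2 * y), D ^ 2 * y, -(D ^ 2 * y ^ 2)],
    ![0, 0, 0, D ^ 2], ![0, 0, D ^ 2, -(D ^ 2 * y)]]
  have hDR : (D : ℝ) ≠ 0 := by exact_mod_cast hD
  have hD1 : (1:ℝ) ≤ (D:ℝ) ^ 2 := by
    have : (1:ℤ) ≤ D ^ 2 := by have := sq_pos_of_ne_zero hD; omega
    exact_mod_cast this
  have hBS : ∀ i j, Sp ω (Bm i j) := by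
    intro i j
    fin_cases i <;> fin_cases j <;> simp [Bm] <;> assumption
  have hBinv : ∀ (v : Fin 4 → ℝ) k, v k = ∑ k', Bm k k' * (Lf y v k' / D ^ 2) := by
    intro v k
    fin_cases k <;> simp [Bm, Lf, Fin.sum_univ_four] <;> field_simp <;> ring
  obtain ⟨A, hA, haux⟩ := aux_poly hω hS1 Bm hBS
  choose p' p q' q Y e hq2 hqN hcop he hsum hLf hM hli using hdata
  -- θ ≤ E
  have hθE : θ ≤ E := by
    have h1 := hsum 0
    rw [Fin.sum_univ_four] at h1
    have a0 := (abs_le.1 (he 0 0)).1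
    have a1 := (abs_le.1 (he 0 1)).1
    have a2 := (abs_le.1 (he 0 2)).1
    have a3 := (abs_le.1 (he 0 3)).1
    linarith
  have hE : 0 < E := hθ.trans_le hθE
  -- choice of m
  obtain ⟨m, hm0, hm⟩ : ∃ m : ℕ, 0 < m ∧ n * Real.exp (-(m * θ ^ 2 / (16 * E ^ 2))) ≤ 1 / 2 := by
    have hc : 0 < θ ^ 2 / (16 * E ^ 2) := by positivity
    obtain ⟨k, hk⟩ := exists_nat_gt (2 * n / (θ ^ 2 / (16 * E ^ 2)))
    rw [div_lt_iff₀ hc] at hk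
    refine ⟨k + 1, by omega, ?_⟩
    have e1 : (((k + 1 : ℕ) : ℝ) * θ ^ 2 / (16 * E ^ 2)) = (k + 1) * (θ ^ 2 / (16 * E ^ 2)) := by push_cast; ring
    rw [e1]
    set x := ((k:ℝ) + 1) * (θ ^ 2 / (16 * E ^ 2)) with hx
    have h1 : 2 * (n:ℝ) ≤ x := by rw [hx, add_mul]; linarith
    have h2 := Real.add_one_le_exp x
    rw [Real.exp_neg]
    rw [← div_eq_mul_inv, div_le_iff₀ (Real.exp_pos _)]
    linarith
  have hmR : (0:ℝ) < m := by exact_mod_cast hm0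
  obtain ⟨om, hom, Λ, hΛ, hroth⟩ := roth_lemma m (m * θ / (32 * E)) (by positivity)
  set CB := 1 + ∑ i, ∑ j, |Bm i j| with hCB
  have hCB1 : 1 ≤ CB := by
    have : 0 ≤ ∑ i, ∑ j, |Bm i j| := by positivity
    linarith
  set c1 := Real.log (64 * A * CB) with hc1
  have hc1p : 0 < c1 := Real.log_pos (by nlinarith)
  set c2 := Real.log (16 * A) + 1 with hc2
  have hc2p : 0 < c2 := by
    have := Real.log_pos (show (1:ℝ) < 16 * A by linarith)
    linarith
  set Ns := 1 + 16 * c1 / θ + 2 * m * Λ * c2 with hNs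
  have hNs1 : 1 ≤ Ns := by
    have : 0 ≤ 16 * c1 / θ + 2 * m * Λ * c2 := by positivity
    linarith
  set K := max 1 (2 / om) with hK
  -- sequence of data
  let Nseq : ℕ → ℝ := fun k => Nat.rec Ns (fun _ x => max Ns (K * Real.log (q x))) k
  have hNs0 : Nseq 0 = Ns := rfl
  have hNsucc : ∀ k, Nseq (k + 1) = max Ns (K * Real.log (q (Nseq k))) := fun k => rfl
  let lq : ℕ → ℝ := fun k => Real.log (q (Nseq k))
  have hlqN : ∀ k, Ns ≤ lq k := by
    intro k
    refine le_trans ?_ (hqN (Nseq k))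
    cases k with
    | zero => exact le_refl _
    | succ k => rw [hNsucc]; exact le_max_left _ _
  have hlqs : ∀ k, K * lq k ≤ lq (k + 1) := by
    intro k
    refine le_trans ?_ (hqN (Nseq (k + 1)))
    rw [hNsucc]; exact le_max_right _ _
  have hK1 : 1 ≤ K := le_max_left _ _
  have hlqmono : Monotone lq := monotone_nat_of_le_succ fun k => by
    have := hlqs k
    have := hlqN k
    nlinarith
  have hlac : ∀ i j, i < j → K * lq i ≤ lq j := by
    intro i j hij
    exact (hlqs i).trans (hlqmono hij)
  let ix : Fin m → ℕ := fun h => m - 1 - h.1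
  let Q : Fin m → ℝ := fun h => lq (ix h)
  have hQN : ∀ h, Ns ≤ Q h := fun h => hlqN _
  have hQ0 : ∀ h, 0 < Q h := fun h => by linarith [hQN h]
  have hQlac : ∀ h h', h < h' → K * Q h' ≤ Q h := by
    intro h h' hh
    apply hlac
    simp only [ix]
    have : h.1 < h'.1 := hh
    have := h'.2
    omega
  set ρ := θ / (4 * E) with hρ
  have hρ0 : 0 < ρ := by positivity
  have hρ1 : ρ ≤ 1 := by rw [hρ, div_le_one (by positivity)]; linarith
  set RR := (∑ h, Q h) / ρ with hRR
  have hQRR : ∀ h, Q h ≤ ρ * RR := by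
    intro h
    have : ρ * RR = ∑ h, Q h := by rw [hRR]; field_simp
    rw [this]
    exact Finset.single_le_sum (f := Q) (fun h _ => (hQ0 h).le) (Finset.mem_univ h)
  have hRR0 : 0 < RR := by
    have h1 := (hQ0 ⟨0, hm0⟩).trans_le (hQRR ⟨0, hm0⟩)
    exact (mul_pos_iff_of_pos_left hρ0).1 h1
  let r : Fin m → ℕ := fun h => ⌈RR / Q h⌉₊
  have hr : ∀ h, 0 < r h := fun h => Nat.ceil_pos.2 (div_pos hRR0 (hQ0 h))
  have hr1 : ∀ h, RR ≤ r h * Q h := by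
    intro h
    rw [← div_le_iff₀ (hQ0 h)]; exact Nat.le_ceil _
  have hr2 : ∀ h, r h * Q h ≤ (1 + ρ) * RR := by
    intro h
    have h1 := (Nat.ceil_lt_add_one (div_pos hRR0 (hQ0 h)).le).le
    have h2 := mul_le_mul_of_nonneg_right h1 (hQ0 h).le
    rw [add_mul, div_mul_cancel₀ _ (hQ0 h).ne'] at h2
    have := hQRR h
    simp only [r]
    linarith
  have hr3 : ∀ h, r h * Q h ≤ 2 * RR := fun h => (hr2 h).trans (by nlinarith)
  have hR : ((∑ h, r h : ℕ) : ℝ) * Ns ≤ 2 * m * RR := by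
    push_cast
    rw [Finset.sum_mul]
    have : ∀ h ∈ (Finset.univ : Finset (Fin m)), (r h : ℝ) * Ns ≤ 2 * RR := fun h _ =>
      (mul_le_mul_of_nonneg_left (hQN h) (by positivity)).trans (hr3 h)
    refine (Finset.sum_le_sum this).trans (le_of_eq ?_)
    simp; ring
  have hRnn : (0:ℝ) ≤ ((∑ h, r h : ℕ) : ℝ) := by positivity
  obtain ⟨z, hz0, hz1, hz2⟩ := haux m r (fun h => e (Nseq (ix h))) E θ hm0 hr hE hθ hθE (fun h k => he _ k) (fun h => hsum _) hm
  have hvan := vanish r hr (fun h => e (Nseq (ix h))) E θ A RR Q hm0 hE hθ hθE (fun h k => he _ k) hA hRR0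
    (fun h => (hQ0 h).le) z Bm hz1 hz2 (fun h => Y (Nseq (ix h)))
    (fun h i k => Lf y (fun k => (Y (Nseq (ix h)) i k : ℝ)) k / D ^ 2)
    (fun h i k => hBinv (fun k => (Y (Nseq (ix h)) i k : ℝ)) k)
    (fun h i k => by
      refine le_trans ?_ (hLf (Nseq (ix h)) i k)
      rw [abs_div, abs_of_nonneg (sq_nonneg (D:ℝ))]
      exact div_le_self (abs_nonneg _) hD1)
    ![1 / D ^ 2, 0, 0, 0]
    (fun k => by
      fin_cases k <;> simp
      exact inv_le_one_of_one_le₀ hD1)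
    (fun k => by
      fin_cases k <;> simp [Bm, Fin.sum_univ_four, hDR])
    hr1 hr2 (by
      rw [← hCB, ← hc1]
      have h1 : 16 * c1 / θ ≤ Ns := by
        have : 0 ≤ 2 * m * Λ * c2 := by positivity
        linarith
      rw [div_le_iff₀ hθ] at h1
      have h2 := mul_le_mul_of_nonneg_left h1 hRnn
      have h3 := mul_le_mul_of_nonneg_right hR hθ.le
      nlinarith)
  have hqr : ∀ x, (q x : ℝ) ≠ 0 := fun x => by
    have := hq2 x
    have : q x ≠ 0 := by omega
    exact_mod_cast this
  obtain ⟨F, hF0, hFi, hFd, hFl, hFv⟩ := reduce r z hz0 A hz1 (fun h => (q' (Nseq (ix h)) / q (Nseq (ix h)) : ℝ))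
    (fun h => ![-(p' (Nseq (ix h)) / q (Nseq (ix h)) : ℝ), (p (Nseq (ix h)) / q (Nseq (ix h)) : ℝ)]) (m * θ / (32 * E))
    (by
      intro t ht i hi
      have hspan : ∀ h, ∃ a : Fin 3 → ℝ, ∀ k, t h k = ∑ i, a i * (Y (Nseq (ix h)) i k : ℝ) := by
        intro h
        refine ker_span _ (hli (Nseq (ix h))) ![(q' (Nseq (ix h)) : ℝ), -(q (Nseq (ix h)) : ℝ), -(p' (Nseq (ix h)) : ℝ), (p (Nseq (ix h)) : ℝ)] (t h) ?_ ?_ ?_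
        · intro h0
          have := congrFun h0 1
          simp at this
          have h2 := hq2 (Nseq (ix h))
          omega
        · intro i
          have := hM (Nseq (ix h)) i
          simp only [Fin.sum_univ_four]
          simp
          have h2 : ((q' (Nseq (ix h)) * Y (Nseq (ix h)) i 0 - p' (Nseq (ix h)) * Y (Nseq (ix h)) i 2 - q (Nseq (ix h)) * Y (Nseq (ix h)) i 1 + p (Nseq (ix h)) * Y (Nseq (ix h)) i 3 : ℤ) : ℝ) = 0 := by
            rw [this]; simp
          push_cast at h2
          linarith
        · simp only [Fin.sum_univ_four]
          have h1 := ht h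
          have h2 := hqr (Nseq (ix h))
          simp at h1 ⊢
          rw [h1]
          field_simp
          ring
      choose a ha using hspan
      have := hvan a i hi
      rw [← this]
      congr 2
      congr 1
      funext k
      rw [ha])
  have hlog : Real.log (ln1 F) + ∑ h, (r h : ℝ) ≤ (∑ h, r h : ℕ) * c2 := by
    have h1 : Real.log (ln1 F) ≤ (∑ h, r h : ℕ) * Real.log (16 * A) := by
      rw [← Real.log_pow]
      exact Real.log_le_log (by linarith [one_le_ln1 hFi hF0]) hFl
    rw [hc2, mul_add, mul_one]
    push_cast at h1 ⊢
    linarith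
  obtain ⟨i, hi1, hi2⟩ := hroth r (fun h => q' (Nseq (ix h))) (fun h => q (Nseq (ix h))) F ((∑ h, r h : ℕ) * c2) hr
    (fun h => hq2 _) (fun h => hcop _) hF0 hFi hFd
    (by
      intro h h' hh
      have h1 := hQlac h h' hh
      have h2 : 2 / om * Q h' ≤ Q h := (mul_le_mul_of_nonneg_right (le_max_right _ _) (hQ0 h').le).trans h1
      have h3 : 2 * Q h' ≤ om * Q h := by
        rw [div_mul_eq_mul_div, div_le_iff₀ hom] at h2; linarith
      have h4 := hr3 h
      have h5 := hr1 h'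
      have h6 : (r h : ℝ) * Q h * Q h' ≤ (om * r h') * (Q h * Q h') := by
        calc (r h : ℝ) * Q h * Q h' ≤ 2 * RR * Q h' := mul_le_mul_of_nonneg_right h4 (hQ0 h').le
          _ = RR * (2 * Q h') := by ring
          _ ≤ RR * (om * Q h) := mul_le_mul_of_nonneg_left h3 hRR0.le
          _ ≤ (r h' * Q h') * (om * Q h) := mul_le_mul_of_nonneg_right h5 (mul_pos hom (hQ0 h)).le
          _ = _ := by ring
      rw [mul_assoc] at h6
      exact le_of_mul_le_mul_right h6 (mul_pos (hQ0 h) (hQ0 h')))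
    hlog
    (by
      intro h
      refine le_trans ?_ (hr1 h)
      have h1 : 2 * m * Λ * c2 ≤ Ns := by
        have : 0 ≤ 16 * c1 / θ := by positivity
        linarith
      have h2 := mul_le_mul_of_nonneg_left h1 hRnn
      have h3 : 2 * m * (Λ * ((∑ h, r h : ℕ) * c2)) ≤ 2 * m * RR := by
        calc 2 * m * (Λ * ((∑ h, r h : ℕ) * c2)) = (∑ h, r h : ℕ) * (2 * m * Λ * c2) := by ring
          _ ≤ _ := h2.trans hR
      exact le_of_mul_le_mul_left h3 (by positivity))
  exact hi1 (hFv i hi2)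

end

section

/-- cross product of triples -/
def cr {R : Type*} [Ring R] (a b : Fin 3 → R) : Fin 3 → R :=
  ![a 1 * b 2 - a 2 * b 1, a 2 * b 0 - a 0 * b 2, a 0 * b 1 - a 1 * b 0]

def ev3 (y : ℝ) (c : Fin 3 → ℤ) : ℝ := c 0 + c 1 * y + c 2 * y ^ 2

/-- primitive triples -/
def Prim (c : Fin 3 → ℤ) : Prop := ∃ u : Fin 3 → ℤ, u 0 * c 0 + u 1 * c 1 + u 2 * c 2 = 1

lemma exists_prim (c : Fin 3 → ℤ) (hc : c ≠ 0) : ∃ (g : ℤ) (c' : Fin 3 → ℤ), g ≠ 0 ∧ Prim c' ∧ ∀ i, c i = g * c' i := by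
  set g1 : ℤ := ((Int.gcd (c 0) (c 1) : ℕ) : ℤ) with hg1
  set g : ℤ := ((Int.gcd g1 (c 2) : ℕ) : ℤ) with hg
  have e1 := Int.gcd_eq_gcd_ab (c 0) (c 1)
  have e2 := Int.gcd_eq_gcd_ab g1 (c 2)
  rw [← hg1] at e1
  rw [← hg] at e2
  have d2 : g ∣ c 2 := Int.gcd_dvd_right ..
  have d1 : g ∣ g1 := Int.gcd_dvd_left ..
  have d0 : g1 ∣ c 0 := Int.gcd_dvd_left ..
  have d0' : g1 ∣ c 1 := Int.gcd_dvd_right ..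
  obtain ⟨x2, h2⟩ := d2
  obtain ⟨x0, h0⟩ := d1.trans d0
  obtain ⟨x1, h1⟩ := d1.trans d0'
  have hg0 : g ≠ 0 := by
    intro h
    apply hc
    funext i
    fin_cases i
    · simp [h0, h]
    · simp [h1, h]
    · simp [h2, h]
  refine ⟨g, ![x0, x1, x2], hg0, ?_, ?_⟩
  · refine ⟨![Int.gcdA g1 (c 2) * Int.gcdA (c 0) (c 1), Int.gcdA g1 (c 2) * Int.gcdB (c 0) (c 1), Int.gcdB g1 (c 2)], ?_⟩
    simp
    apply mul_left_cancel₀ hg0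
    generalize Int.gcdA g1 (c 2) = A at *
    generalize Int.gcdB g1 (c 2) = B at *
    generalize Int.gcdA (c 0) (c 1) = A' at *
    generalize Int.gcdB (c 0) (c 1) = B' at *
    calc g * (A * A' * x0 + A * B' * x1 + B * x2) = A * ((g * x0) * A' + (g * x1) * B') + B * (g * x2) := by ring
      _ = A * (c 0 * A' + c 1 * B') + B * c 2 := by rw [← h0, ← h1, ← h2]
      _ = A * g1 + B * c 2 := by rw [← e1]
      _ = g * 1 := by rw [mul_one]; linear_combination -e2
  · intro i
    fin_cases i
    · simpa using h0
    · simpa using h1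
    · simpa using h2

lemma prim_parallel {c d : Fin 3 → ℤ} (hc : Prim c) (h : cr c d = 0) : ∃ k : ℤ, ∀ i, d i = k * c i := by
  obtain ⟨u, hu⟩ := hc
  have h0 := congrFun h 0
  have h1 := congrFun h 1
  have h2 := congrFun h 2
  simp [cr] at h0 h1 h2
  refine ⟨u 0 * d 0 + u 1 * d 1 + u 2 * d 2, fun i => ?_⟩
  fin_cases i
  · simp; linear_combination (-d 0) * hu - u 1 * h2 + u 2 * h1
  · simp; linear_combination (-d 1) * hu + u 0 * h2 - u 2 * h0
  · simp; linear_combination (-d 2) * hu - u 0 * h1 + u 1 * h0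

lemma no_square {y c : ℝ} (hc : ∀ a b : ℤ, a ≠ 0 → c ≤ |(a:ℝ)| * |a * y - b|) (n : Fin 3 → ℤ) (hn : n ≠ 0) (ε : ℝ)
    (hε1 : ε < 1) (hεc : ε < c) (h1 : |(n 0 : ℝ) * y - n 1| ≤ ε) (h2 : |(n 2 : ℝ) - n 0 * y ^ 2| ≤ ε) :
    n 1 ^ 2 - n 0 * n 2 ≠ 0 := by
  intro h
  by_cases h0 : n 0 = 0
  · rw [h0] at h h1 h2
    have e1 : n 1 = 0 := by simpa using h
    simp at h2
    have e2 : n 2 = 0 := by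
      have : |n 2| < 1 := by exact_mod_cast h2.trans_lt hε1
      exact Int.abs_lt_one_iff.1 this
    apply hn; funext i; fin_cases i <;> simpa
  · obtain ⟨g, a, b, hg, hab, ha, hb⟩ : ∃ g a b : ℤ, 0 < g ∧ IsCoprime a b ∧ n 0 = a * g ∧ n 1 = b * g := by
      have hpos : 0 < Int.gcd (n 0) (n 1) := Int.gcd_pos_of_ne_zero_left _ h0
      obtain ⟨a, b, hcop, ha, hb⟩ := Int.exists_gcd_one hpos
      exact ⟨_, a, b, by exact_mod_cast hpos, Int.isCoprime_iff_gcd_eq_one.2 hcop, ha, hb⟩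
    have ha0 : a ≠ 0 := by rintro rfl; simp at ha; exact h0 ha
    have e1 : g * b ^ 2 = a * n 2 := by
      rw [ha, hb] at h
      have : g * (g * b ^ 2) = g * (a * n 2) := by linear_combination h
      exact mul_left_cancel₀ hg.ne' this
    have hdvd : a ∣ g := by
      have : a ∣ g * b ^ 2 := ⟨_, e1⟩
      exact (hab.pow_right).dvd_of_dvd_mul_right this
    have hle : |a| ≤ g := by
      have := Int.le_of_dvd hg ((abs_dvd a g).2 hdvd)
      exact this
    have h3 := hc a b ha0
    have e2 : (n 0 : ℝ) * y - n 1 = g * (a * y - b) := by rw [ha, hb]; push_cast; ring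
    rw [e2, abs_mul, abs_of_pos (by exact_mod_cast hg : (0:ℝ) < g)] at h1
    have h4 : |(a:ℝ)| ≤ g := by exact_mod_cast hle
    have := mul_le_mul_of_nonneg_right h4 (abs_nonneg (a * y - b))
    linarith

lemma cr_trans {a b c : Fin 3 → ℤ} (hb : b ≠ 0) (h1 : cr a b = 0) (h2 : cr b c = 0) : cr a c = 0 := by
  obtain ⟨g, b', hg, hb', hbb⟩ := exists_prim b hb
  have k1 : cr b' c = 0 := by
    have x0 := congrFun h2 0
    have x1 := congrFun h2 1
    have x2 := congrFun h2 2
    simp [cr, hbb] at x0 x1 x2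
    funext i
    fin_cases i
    · apply mul_left_cancel₀ hg; simp only [cr]; show g * (b' 1 * c 2 - b' 2 * c 1) = g * 0; linear_combination x0
    · apply mul_left_cancel₀ hg; simp only [cr]; show g * (b' 2 * c 0 - b' 0 * c 2) = g * 0; linear_combination x1
    · apply mul_left_cancel₀ hg; simp only [cr]; show g * (b' 0 * c 1 - b' 1 * c 0) = g * 0; linear_combination x2
  have k2 : cr b' a = 0 := by
    have x0 := congrFun h1 0
    have x1 := congrFun h1 1
    have x2 := congrFun h1 2
    simp [cr, hbb] at x0 x1 x2
    funext i
    fin_cases i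
    · apply mul_left_cancel₀ hg; simp only [cr]; show g * (b' 1 * a 2 - b' 2 * a 1) = g * 0; linear_combination -x0
    · apply mul_left_cancel₀ hg; simp only [cr]; show g * (b' 2 * a 0 - b' 0 * a 2) = g * 0; linear_combination -x1
    · apply mul_left_cancel₀ hg; simp only [cr]; show g * (b' 0 * a 1 - b' 1 * a 0) = g * 0; linear_combination -x2
  obtain ⟨k, hk⟩ := prim_parallel hb' k1
  obtain ⟨l, hl⟩ := prim_parallel hb' k2
  funext i
  fin_cases i <;> simp [cr, hk, hl] <;> ring

lemma exists_root11 (δ : ℝ) (hδ : 0 < δ) : ∃ T : ℝ, 0 < T ∧ δ * T ^ 11 = 1 := by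
  refine ⟨(δ⁻¹) ^ ((1:ℝ) / 11), by positivity, ?_⟩
  rw [← Real.rpow_natCast, ← Real.rpow_mul (by positivity)]
  norm_num
  field_simp

end

section

/-- One step: consequences for consecutive polynomials -/
lemma ds_comp (y : ℝ) (P P' : Fin 3 → ℤ) (a b H : ℝ) (ha : 0 < a) (hab : a ≤ b)
    (hP : ∀ k, |(P k : ℝ)| ≤ H) (hHa : H ≤ a ^ 4) (hP' : ∀ k, |(P' k : ℝ)| ≤ 16 * a ^ 4)
    (h1 : |ev3 y P| * a ^ 11 = 1) (h2 : |ev3 y P'| * b ^ 11 = 1) :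
    |((cr P P') 0 : ℝ) * y - (cr P P') 1| ≤ 17 / a ^ 7 ∧ |((cr P P') 2 : ℝ) - (cr P P') 0 * y ^ 2| ≤ 17 / a ^ 7 ∧
    |((cr P P') 0 : ℝ)| ≤ 32 * H * a ^ 4 := by
  have hb : 0 < b := ha.trans_le hab
  have e1 : |ev3 y P| = 1 / a ^ 11 := by field_simp; linarith
  have e2 : |ev3 y P'| ≤ 1 / a ^ 11 := by
    have : |ev3 y P'| = 1 / b ^ 11 := by field_simp; linarith
    rw [this]; gcongr
  have key : ∀ k, |(P' k : ℝ) * ev3 y P - P k * ev3 y P'| ≤ 17 / a ^ 7 := by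
    intro k
    refine (abs_sub _ _).trans ?_
    rw [abs_mul, abs_mul, e1]
    have := hP k
    have := hP' k
    calc _ ≤ (16 * a ^ 4) * (1 / a ^ 11) + a ^ 4 * (1 / a ^ 11) := by
          gcongr
          exact (hP k).trans hHa
      _ = 17 / a ^ 7 := by field_simp; norm_num
  refine ⟨?_, ?_, ?_⟩
  · have := key 2
    convert this using 2
    simp [cr, ev3]; ring
  · have := key 1
    convert this using 2
    simp [cr, ev3]; ring
  · have hH : 0 ≤ H := (abs_nonneg _).trans (hP 0)
    simp only [cr]
    simp
    refine (abs_sub _ _).trans ?_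
    rw [abs_mul, abs_mul]
    calc _ ≤ H * (16 * a ^ 4) + H * (16 * a ^ 4) := by
          gcongr
          · exact hP 1
          · exact hP' 2
          · exact hP 2
          · exact hP' 1
      _ = _ := by ring

lemma ds_growth {y c : ℝ} (hc : ∀ a b : ℤ, a ≠ 0 → c ≤ |(a:ℝ)| * |a * y - b|) (n : Fin 3 → ℤ) (hn : n ≠ 0) (a H : ℝ)
    (ha : 34 ≤ a) (hac : 17 < c * a) (hH : 0 ≤ H)
    (h1 : |(n 0 : ℝ) * y - n 1| ≤ 17 / a ^ 7) (h2 : |(n 2 : ℝ) - n 0 * y ^ 2| ≤ 17 / a ^ 7) (h0 : |(n 0 : ℝ)| ≤ 32 * H * a ^ 4) :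
    a ^ 3 ≤ 1088 * (2 * |y| + 1) * H := by
  have ha0 : 0 < a := by linarith
  have hε : 17 / a ^ 7 ≤ 17 / a := by
    gcongr
    exact le_self_pow₀ (by linarith) (by norm_num)
  have hε1 : 17 / a ≤ 1 / 2 := by rw [div_le_iff₀ ha0]; linarith
  have hεc : 17 / a < c := by rw [div_lt_iff₀ ha0]; exact hac
  have hne := no_square hc n hn (17 / a ^ 7) (by linarith) (by linarith) h1 h2
  have hge : (1:ℝ) ≤ |(n 1 : ℝ) ^ 2 - n 0 * n 2| := by
    have := Int.one_le_abs hne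
    exact_mod_cast this
  set ε := 17 / a ^ 7 with hεd
  have hεpos : 0 < ε := by positivity
  set u := (n 0 : ℝ) * y - n 1
  set v := (n 2 : ℝ) - n 0 * y ^ 2
  have hid : (n 1 : ℝ) ^ 2 - n 0 * n 2 = u ^ 2 - (n 0 * (2 * y) * u + n 0 * v) := by simp only [u, v]; ring
  have hup : |(n 1 : ℝ) ^ 2 - n 0 * n 2| ≤ ε ^ 2 + (32 * H * a ^ 4 * (2 * |y|) * ε + 32 * H * a ^ 4 * ε) := by
    rw [hid]
    refine (abs_sub _ _).trans ?_
    refine add_le_add ?_ ((abs_add_le _ _).trans (add_le_add ?_ ?_))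
    · rw [abs_pow]; gcongr
    · rw [abs_mul, abs_mul, abs_mul, abs_two]; gcongr
    · rw [abs_mul]; gcongr
  have h5 : ε ^ 2 ≤ 1 / 2 := by nlinarith
  have h6 : 1 / 2 ≤ 32 * H * a ^ 4 * (2 * |y| + 1) * ε := by nlinarith
  have h7 : ε * a ^ 4 * a ^ 3 = 17 := by rw [hεd]; field_simp
  have h8 := mul_le_mul_of_nonneg_right h6 (by positivity : 0 ≤ a ^ 3)
  have h9 : 32 * H * a ^ 4 * (2 * |y| + 1) * ε * a ^ 3 = 32 * H * (2 * |y| + 1) * (ε * a ^ 4 * a ^ 3) := by ring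
  rw [h9, h7] at h8
  linarith

lemma ds_det (y : ℝ) (P P' P'' : Fin 3 → ℤ) (a b d K : ℝ) (ha : 0 < a) (hab : a ≤ b) (hbd : b ≤ d)
    (hP : ∀ k, |(P k : ℝ)| ≤ a ^ 4) (hP' : ∀ k, |(P' k : ℝ)| ≤ 16 * a ^ 4) (hP'' : ∀ k, |(P'' k : ℝ)| ≤ 16 * b ^ 4)
    (h1 : |ev3 y P| * a ^ 11 = 1) (h2 : |ev3 y P'| * b ^ 11 = 1) (h3 : |ev3 y P''| * d ^ 11 = 1)
    (hK : 1 ≤ K) (hg : b ^ 3 ≤ K * a ^ 4) (hbig : 2 ^ 33 * K ^ 4 ≤ a) :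
    P 0 * (cr P' P'') 0 + P 1 * (cr P' P'') 1 + P 2 * (cr P' P'') 2 = 0 := by
  have hb : 0 < b := ha.trans_le hab
  have hd : 0 < d := hb.trans_le hbd
  have e1 : |ev3 y P| = 1 / a ^ 11 := by field_simp; linarith
  have e2 : |ev3 y P'| = 1 / b ^ 11 := by field_simp; linarith
  have e3 : |ev3 y P''| = 1 / d ^ 11 := by field_simp; linarith
  have hK4 : 1 ≤ K ^ 4 := one_le_pow₀ hK
  have ha1 : 2 ^ 33 ≤ a := by nlinarith
  -- determinant bound
  have hid : ((P 0 * (cr P' P'') 0 + P 1 * (cr P' P'') 1 + P 2 * (cr P' P'') 2 : ℤ) : ℝ)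
      = ev3 y P * (P' 1 * P'' 2 - P' 2 * P'' 1) - ev3 y P' * (P 1 * P'' 2 - P 2 * P'' 1) + ev3 y P'' * (P 1 * P' 2 - P 2 * P' 1) := by
    simp [cr, ev3]; ring
  have m2 : ∀ (R S : Fin 3 → ℤ) (A B : ℝ), 0 ≤ A → (∀ k, |(R k : ℝ)| ≤ A) → (∀ k, |(S k : ℝ)| ≤ B) →
      |(R 1 : ℝ) * S 2 - R 2 * S 1| ≤ 2 * A * B := by
    intro R S A B hA hR hS
    refine (abs_sub _ _).trans ?_
    rw [abs_mul, abs_mul]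
    calc _ ≤ A * B + A * B := by
          gcongr
          · exact hR 1
          · exact hS 2
          · exact hR 2
          · exact hS 1
      _ = _ := by ring
  have m3 : |((P 0 * (cr P' P'') 0 + P 1 * (cr P' P'') 1 + P 2 * (cr P' P'') 2 : ℤ) : ℝ)| ≤
      1 / a ^ 11 * (2 * (16 * a ^ 4) * (16 * b ^ 4)) + 1 / b ^ 11 * (2 * a ^ 4 * (16 * b ^ 4)) + 1 / d ^ 11 * (2 * a ^ 4 * (16 * a ^ 4)) := by
    rw [hid]
    refine (abs_add_le _ _).trans (add_le_add ((abs_sub _ _).trans (add_le_add ?_ ?_)) ?_)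
    · rw [abs_mul, e1]; gcongr; exact m2 _ _ _ _ (by positivity) hP' hP''
    · rw [abs_mul, e2]; gcongr; exact m2 _ _ _ _ (by positivity) hP hP''
    · rw [abs_mul, e3]; gcongr; exact m2 _ _ _ _ (by positivity) hP hP'
  have hb12 : b ^ 4 ≤ a ^ 7 / 2 ^ 11 := by
    have : (b ^ 4) ^ 3 ≤ (a ^ 7 / 2 ^ 11) ^ 3 := by
      calc (b ^ 4) ^ 3 = (b ^ 3) ^ 4 := by ring
        _ ≤ (K * a ^ 4) ^ 4 := by gcongr
        _ = K ^ 4 * a ^ 16 := by ring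
        _ ≤ a / 2 ^ 33 * a ^ 16 := by gcongr; rw [le_div_iff₀ (by positivity)]; linarith
        _ = a ^ 17 / 2 ^ 33 := by ring
        _ ≤ a ^ 21 / 2 ^ 33 := by gcongr <;> linarith
        _ = _ := by ring
    exact le_of_pow_le_pow_left₀ (by norm_num) (by positivity) this
  have t1 : 1 / a ^ 11 * (2 * (16 * a ^ 4) * (16 * b ^ 4)) ≤ 1 / 4 := by
    calc _ ≤ 1 / a ^ 11 * (2 * (16 * a ^ 4) * (16 * (a ^ 7 / 2 ^ 11))) := by gcongr
      _ = 1 / 4 := by field_simp; norm_num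
  have t2 : 1 / b ^ 11 * (2 * a ^ 4 * (16 * b ^ 4)) ≤ 1 / 4 := by
    calc _ ≤ 1 / b ^ 11 * (2 * b ^ 4 * (16 * b ^ 4)) := by gcongr
      _ = 32 / b ^ 3 := by field_simp; norm_num
      _ ≤ 32 / b := by gcongr; exact le_self_pow₀ (by linarith) (by norm_num)
      _ ≤ 1 / 4 := by rw [div_le_iff₀ hb]; linarith
  have t3 : 1 / d ^ 11 * (2 * a ^ 4 * (16 * a ^ 4)) ≤ 1 / 4 := by
    have had := hab.trans hbd
    calc _ ≤ 1 / d ^ 11 * (2 * d ^ 4 * (16 * d ^ 4)) := by gcongr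
      _ = 32 / d ^ 3 := by field_simp; norm_num
      _ ≤ 32 / d := by gcongr; exact le_self_pow₀ (by linarith) (by norm_num)
      _ ≤ 1 / 4 := by rw [div_le_iff₀ hd]; linarith
  have : |((P 0 * (cr P' P'') 0 + P 1 * (cr P' P'') 1 + P 2 * (cr P' P'') 2 : ℤ) : ℝ)| < 1 := by linarith
  apply Int.abs_lt_one_iff.1
  exact_mod_cast this

lemma ds_chain (y : ℝ) (hquad : ∀ c : Fin 3 → ℤ, ev3 y c = 0 → c = 0) (T0 : ℝ) 
    (hneg : ∀ T, T0 ≤ T → ∃ c : Fin 3 → ℤ, c ≠ 0 ∧ (∀ i, |(c i : ℝ)| ≤ T ^ 4) ∧ |ev3 y c| * T ^ 11 ≤ 1) (B : ℝ) :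
    ∃ (P : ℕ → Fin 3 → ℤ) (T : ℕ → ℝ), B ≤ T 0 ∧ 0 < T 0 ∧ (∀ i, Prim (P i)) ∧ (∀ i k, |(P i k : ℝ)| ≤ T i ^ 4) ∧
      (∀ i k, |(P (i+1) k : ℝ)| ≤ 16 * T i ^ 4) ∧ (∀ i, |ev3 y (P i)| * T i ^ 11 = 1) ∧ (∀ i, 2 * T i ≤ T (i+1)) := by
  have h1 : ∀ S : ℝ, ∃ (c : Fin 3 → ℤ) (T : ℝ), T0 ≤ S → 0 < S → Prim c ∧ (∀ i, |(c i : ℝ)| ≤ S ^ 4) ∧ |ev3 y c| * T ^ 11 = 1 ∧ S ≤ T := by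
    intro S
    by_cases hS : T0 ≤ S
    swap
    · exact ⟨0, 0, fun h => absurd h hS⟩
    obtain ⟨d, hd, hd1, hd2⟩ := hneg S hS
    obtain ⟨g, c, hg, hc, hgc⟩ := exists_prim d hd
    have hg1 : (1:ℝ) ≤ |(g:ℝ)| := by exact_mod_cast Int.one_le_abs hg
    have hc0 : c ≠ 0 := by
      rintro rfl
      obtain ⟨u, hu⟩ := hc
      simp at hu
    have hδ : 0 < |ev3 y c| := abs_pos.2 fun h => hc0 (hquad c h)
    obtain ⟨T, hT, hT1⟩ := exists_root11 _ hδ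
    refine ⟨c, T, fun _ hS0 => ⟨hc, fun i => ?_, hT1, ?_⟩⟩
    · have := hd1 i
      rw [hgc, Int.cast_mul, abs_mul] at this
      nlinarith [abs_nonneg (c i : ℝ)]
    · have e : |ev3 y d| = |(g:ℝ)| * |ev3 y c| := by
        rw [← abs_mul]; congr 1; simp only [ev3, hgc]; push_cast; ring
      rw [e] at hd2
      have : |ev3 y c| * S ^ 11 ≤ |ev3 y c| * T ^ 11 := by
        rw [hT1]
        have : 0 ≤ |ev3 y c| * S ^ 11 := by positivity
        nlinarith
      exact le_of_pow_le_pow_left₀ (by norm_num) hT.le (le_of_mul_le_mul_left this hδ)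
  choose c Tf h using h1
  let S : ℕ → ℝ := fun i => Nat.rec (max (max B T0) 1) (fun _ s => 2 * Tf s) i
  have hS0 : S 0 = max (max B T0) 1 := rfl
  have hS1 : ∀ i, S (i+1) = 2 * Tf (S i) := fun i => rfl
  have hS : ∀ i, T0 ≤ S i ∧ 1 ≤ S i := by
    intro i
    induction i with
    | zero => rw [hS0]; exact ⟨(le_max_right _ _).trans (le_max_left _ _), le_max_right _ _⟩
    | succ i ih =>
      have := (h (S i) ih.1 (by linarith)).2.2.2
      rw [hS1]
      constructor <;> linarith
  have hh := fun i => h (S i) (hS i).1 (by linarith [(hS i).2])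
  refine ⟨fun i => c (S i), fun i => Tf (S i), ?_, ?_, fun i => (hh i).1, fun i k => ?_, fun i k => ?_, fun i => (hh i).2.2.1, fun i => ?_⟩
  · refine le_trans ?_ (hh 0).2.2.2
    rw [hS0]; exact (le_max_left _ _).trans (le_max_left _ _)
  · have := (hh 0).2.2.2
    linarith [(hS 0).2]
  · refine ((hh i).2.1 k).trans ?_
    have := (hh i).2.2.2
    have := (hS i).2
    gcongr
  · refine ((hh (i+1)).2.1 k).trans ?_
    rw [hS1]
    apply le_of_eq; ring
  · have := (hh (i+1)).2.2.2
    rwa [hS1] at this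

theorem ds_dual (y : ℝ) (hquad : ∀ c : Fin 3 → ℤ, ev3 y c = 0 → c = 0) (c : ℝ) (hc0 : 0 < c)
    (hc : ∀ a b : ℤ, a ≠ 0 → c ≤ |(a:ℝ)| * |a * y - b|) (T0 : ℝ) :
    ∃ T, T0 ≤ T ∧ ∀ c : Fin 3 → ℤ, c ≠ 0 → (∀ i, |(c i : ℝ)| ≤ T ^ 4) → 1 < |ev3 y c| * T ^ 11 := by
  by_contra! hneg
  set K : ℝ := 1088 * (2 * |y| + 1) * 16 with hK
  have hK1 : 1 ≤ K := by rw [hK]; nlinarith [abs_nonneg y]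
  obtain ⟨P, T, hB, hT0, hprim, hPT, hPT', hev, hT2⟩ := ds_chain y hquad T0 hneg (max (34 + 18 / c) (2 ^ 33 * K ^ 4))
  have hTpos : ∀ i, T 0 + i ≤ T i := by
    have hT01 : 34 + 18 / c ≤ T 0 := (le_max_left _ _).trans hB
    have : 0 < 18 / c := by positivity
    intro i
    induction i with
    | zero => simp
    | succ i ih => have := hT2 i; push_cast; have : (0:ℝ) ≤ i := by positivity
                   linarith
  have hT0i : ∀ i, T 0 ≤ T i := fun i => by have := hTpos i; have : (0:ℝ) ≤ i := by positivity
                                            linarith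
  have hpos : ∀ i, 0 < T i := fun i => hT0.trans_le (hT0i i)
  have hmono : ∀ i, T i ≤ T (i+1) := fun i => by linarith [hT2 i, hpos i]
  set n : ℕ → Fin 3 → ℤ := fun i => cr (P i) (P (i+1)) with hn
  have hn0 : ∀ i, n i ≠ 0 := by
    intro i h
    obtain ⟨k, hk⟩ := prim_parallel (hprim i) h
    have e : ev3 y (P (i+1)) = k * ev3 y (P i) := by simp only [ev3, hk]; push_cast; ring
    have h1 := hev i
    have h2 := hev (i+1)
    rw [e, abs_mul] at h2
    have hk0 : k ≠ 0 := by rintro rfl; simp at h2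
    have hk1 : (1:ℝ) ≤ |(k:ℝ)| := by exact_mod_cast Int.one_le_abs hk0
    have h3 : T i ^ 11 < T (i+1) ^ 11 := by
      have := hT2 i; have := hpos i
      gcongr; linarith
    have h4 : 0 < |ev3 y (P i)| := by
      by_contra! h; have : |ev3 y (P i)| = 0 := le_antisymm h (abs_nonneg _)
      rw [this] at h1; simp at h1
    have h5 : |ev3 y (P i)| * T i ^ 11 < |ev3 y (P i)| * T (i+1) ^ 11 := by gcongr
    have h6 : 0 ≤ |ev3 y (P i)| * T (i+1) ^ 11 := by have := hpos (i+1); positivity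
    nlinarith
  have hcomp := fun i => ds_comp y (P i) (P (i+1)) (T i) (T (i+1)) (T i ^ 4) (hpos i) (hmono i) (hPT i) le_rfl (hPT' i) (hev i) (hev (i+1))
  have hgrow : ∀ i, T (i+1) ^ 3 ≤ K * T i ^ 4 := by
    intro i
    have hT01 : 34 + 18 / c ≤ T 0 := (le_max_left _ _).trans hB
    have hq : 0 < 18 / c := by positivity
    have hge := hT0i (i+1)
    have hca : 17 < c * T (i+1) := by
      have : c * (18 / c) = 18 := by field_simp
      nlinarith
    have hge' : 34 ≤ T (i+1) := by linarith
    have hp := hpos i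
    by_cases hle : 16 * T i ^ 4 ≤ T (i+1) ^ 4
    · have hcc := ds_comp y (P (i+1)) (P (i+2)) (T (i+1)) (T (i+2)) (16 * T i ^ 4) (hpos _) (hmono _) (hPT' i) hle (hPT' (i+1)) (hev (i+1)) (hev (i+2))
      have := ds_growth hc (n (i+1)) (hn0 (i+1)) (T (i+1)) (16 * T i ^ 4) hge' hca (by positivity) hcc.1 hcc.2.1 hcc.2.2
      rw [hK]; linarith
    · exfalso
      apply hle
      calc 16 * T i ^ 4 = (2 * T i) ^ 4 := by ring
        _ ≤ T (i+1) ^ 4 := by have := hT2 i; gcongr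
  have hpar : ∀ i, cr (n i) (n (i+1)) = 0 := by
    intro i
    have hd := ds_det y (P i) (P (i+1)) (P (i+2)) (T i) (T (i+1)) (T (i+2)) K (hpos i) (hmono i) (hmono (i+1)) (hPT i) (hPT' i) (hPT' (i+1)) (hev i) (hev (i+1)) (hev (i+2)) hK1 (hgrow i) (((le_max_right _ _).trans hB).trans (hT0i i))
    simp [cr] at hd
    funext j
    fin_cases j
    · simp [hn, cr]; linear_combination (P (i+1) 0) * hd
    · simp [hn, cr]; linear_combination (P (i+1) 1) * hd
    · simp [hn, cr]; linear_combination (P (i+1) 2) * hd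
  have hpar0 : ∀ i, cr (n 0) (n i) = 0 := by
    intro i
    induction i with
    | zero => funext j; fin_cases j <;> simp [cr] <;> ring
    | succ i ih => exact cr_trans (hn0 i) ih (hpar i)
  obtain ⟨g, m, hg, hm, hgm⟩ := exists_prim (n 0) (hn0 0)
  have hmi : ∀ i, ∃ k : ℤ, ∀ j, n i j = k * m j := by
    intro i
    apply prim_parallel hm
    refine cr_trans (hn0 0) ?_ (hpar0 i)
    funext j
    fin_cases j <;> simp [cr, hgm] <;> ring
  have hsmall : ∀ i : ℕ, |(m 0 : ℝ) * y - m 1| ≤ 17 / (1 + i) ∧ |(m 2 : ℝ) - m 0 * y ^ 2| ≤ 17 / (1 + i) := by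
    intro i
    obtain ⟨k, hk⟩ := hmi i
    have hk0 : k ≠ 0 := by
      rintro rfl
      apply hn0 i
      funext j; simp [hk]
    have hk1 : (1:ℝ) ≤ |(k:ℝ)| := by exact_mod_cast Int.one_le_abs hk0
    have hb : 17 / T i ^ 7 ≤ 17 / (1 + i) := by
      have h1 := hTpos i
      have hT01 : 34 + 18 / c ≤ T 0 := (le_max_left _ _).trans hB
      have hq : 0 < 18 / c := by positivity
      have hi : (0:ℝ) ≤ i := by positivity
      gcongr
      calc (1:ℝ) + i ≤ T i := by linarith
        _ ≤ T i ^ 7 := le_self_pow₀ (by linarith) (by norm_num)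
    obtain ⟨c1, c2, -⟩ := hcomp i
    have f1 : ((n i 0 : ℤ) : ℝ) * y - (n i 1 : ℤ) = k * (m 0 * y - m 1) := by rw [hk, hk]; push_cast; ring
    have f2 : ((n i 2 : ℤ) : ℝ) - (n i 0 : ℤ) * y ^ 2 = k * (m 2 - m 0 * y ^ 2) := by rw [hk, hk]; push_cast; ring
    simp only [hn] at f1 f2
    rw [f1, abs_mul] at c1
    rw [f2, abs_mul] at c2
    constructor
    · nlinarith [abs_nonneg ((m 0 : ℝ) * y - m 1)]
    · nlinarith [abs_nonneg ((m 2 : ℝ) - m 0 * y ^ 2)]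
  have hzero : ∀ z : ℝ, (∀ i : ℕ, |z| ≤ 17 / (1 + i)) → z = 0 := by
    intro z hz
    by_contra hne
    have hp : 0 < |z| := abs_pos.2 hne
    obtain ⟨i, hi⟩ := exists_nat_gt (17 / |z|)
    have := hz i
    rw [le_div_iff₀ (by positivity)] at this
    rw [div_lt_iff₀ hp] at hi
    nlinarith
  have z1 := hzero _ fun i => (hsmall i).1
  have z2 := hzero _ fun i => (hsmall i).2
  have hm0 : m 0 = 0 := by
    by_contra h
    have := hc (m 0) (m 1) h
    rw [z1] at this
    simp at this; linarith
  rw [hm0] at z1 z2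
  simp at z1 z2
  obtain ⟨u, hu⟩ := hm
  rw [hm0, z1, z2] at hu
  simp at hu

end

section

def dt {R : Type*} [Ring R] (a b : Fin 3 → R) : R := a 0 * b 0 + a 1 * b 1 + a 2 * b 2

lemma red_step (u1 u2 u3 z : Fin 3 → ℝ) (hz1 : dt z u1 = 0) (hz2 : dt z u2 = 0) (hz3 : dt z u3 = 1)
    (hD : dt z (cr u1 u2) ≠ 0) (hNz : 1 / 16 ≤ dt z z) (h12 : dt u1 u1 ≤ dt u2 u2) (hB : |dt u1 u2| ≤ dt u1 u1 / 2) :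
    ∃ k1 k2 : ℤ, dt (fun i => u3 i - k1 * u1 i - k2 * u2 i) (fun i => u3 i - k1 * u1 i - k2 * u2 i) ≤ 16 + 3 / 4 * dt u2 u2 := by
  set D := dt z (cr u1 u2) with hDd
  set t1 := dt (cr u2 z) u3 / D with ht1
  set t2 := dt (cr z u1) u3 / D with ht2
  set s := dt (cr u1 u2) u3 / D with hs
  have hid : ∀ i, u3 i = t1 * u1 i + t2 * u2 i + s * z i := by
    intro i
    have : D * u3 i = dt (cr u2 z) u3 * u1 i + dt (cr z u1) u3 * u2 i + dt (cr u1 u2) u3 * z i := by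
      rw [hDd]
      fin_cases i <;> simp [dt, cr] <;> ring
    rw [ht1, ht2, hs]
    field_simp
    linarith
  have hsz : s * dt z z = 1 := by
    have h0 := hid 0
    have h1 := hid 1
    have h2 := hid 2
    simp only [dt] at hz1 hz2 hz3 ⊢
    linear_combination hz3 - t1 * hz1 - t2 * hz2 - z 0 * h0 - z 1 * h1 - z 2 * h2
  refine ⟨round t1, round t2, ?_⟩
  have hx1 := abs_sub_round t1
  have hx2 := abs_sub_round t2
  set x1 := t1 - round t1
  set x2 := t2 - round t2
  have hu : (fun i => u3 i - round t1 * u1 i - round t2 * u2 i) = fun i => x1 * u1 i + x2 * u2 i + s * z i := by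
    funext i
    rw [hid i]; simp only [x1, x2]; ring
  rw [hu]
  have hexp : dt (fun i => x1 * u1 i + x2 * u2 i + s * z i) (fun i => x1 * u1 i + x2 * u2 i + s * z i)
      = x1 ^ 2 * dt u1 u1 + x2 ^ 2 * dt u2 u2 + 2 * (x1 * x2 * dt u1 u2) + s * (s * dt z z) := by
    simp only [dt] at hz1 hz2 ⊢
    linear_combination (2 * s * x1) * hz1 + (2 * s * x2) * hz2
  rw [hexp, hsz]
  have hN1 : 0 ≤ dt u1 u1 := by simp only [dt]; nlinarith [sq_nonneg (u1 0), sq_nonneg (u1 1), sq_nonneg (u1 2)]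
  have hs16 : s ≤ 16 := by
    have : 0 < s := by
      by_contra! h
      nlinarith
    nlinarith
  have q1 : x1 ^ 2 ≤ 1 / 4 := by rw [← sq_abs]; nlinarith [abs_nonneg x1]
  have q2 : x2 ^ 2 ≤ 1 / 4 := by rw [← sq_abs]; nlinarith [abs_nonneg x2]
  have q3 : x1 * x2 * dt u1 u2 ≤ 1 / 4 * (dt u1 u1 / 2) := by
    refine (le_abs_self _).trans ?_
    rw [abs_mul, abs_mul]
    calc _ ≤ (1 / 2) * (1 / 2) * (dt u1 u1 / 2) := by gcongr
      _ = _ := by ring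
  nlinarith

/-- scaled embedding -/
noncomputable def Em (y T : ℝ) (n : Fin 3 → ℤ) : Fin 3 → ℝ := ![n 0 / T ^ 11, (n 0 * y - n 1) * T ^ 4, (n 0 * y ^ 2 - n 2) * T ^ 4]

lemma Em_bound (y T B : ℝ) (hT : 0 < T) (n : Fin 3 → ℤ) (hB : 0 ≤ B) (h : dt (Em y T n) (Em y T n) ≤ B ^ 2) :
    |(n 0 : ℝ)| ≤ B * T ^ 11 ∧ |(n 0 : ℝ) * y - n 1| ≤ B / T ^ 4 ∧ |(n 0 : ℝ) * y ^ 2 - n 2| ≤ B / T ^ 4 := by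
  simp only [dt] at h
  have hk : ∀ k, |Em y T n k| ≤ B := by
    intro k
    refine abs_le_of_sq_le_sq ?_ hB
    fin_cases k <;> simp <;> nlinarith [sq_nonneg (Em y T n 0), sq_nonneg (Em y T n 1), sq_nonneg (Em y T n 2)]
  refine ⟨?_, ?_, ?_⟩
  · have := hk 0
    simp [Em] at this
    rw [abs_div, abs_of_pos (show 0 < T ^ 11 by positivity), div_le_iff₀ (by positivity)] at this
    exact this
  · have := hk 1
    simp [Em] at this
    rw [abs_of_pos hT] at this
    rw [le_div_iff₀ (by positivity)]
    exact this
  · have := hk 2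
    simp [Em] at this
    rw [abs_of_pos hT] at this
    rw [le_div_iff₀ (by positivity)]
    exact this

lemma Em_min (y T : ℝ) (hT : 0 < T) (S : Set (Fin 3 → ℤ)) (hS : S.Nonempty) :
    ∃ n ∈ S, ∀ m ∈ S, dt (Em y T n) (Em y T n) ≤ dt (Em y T m) (Em y T m) := by
  obtain ⟨n, hn⟩ := hS
  set B := 1 + dt (Em y T n) (Em y T n) with hB
  have hBn : 0 ≤ dt (Em y T n) (Em y T n) := by
    simp only [dt]; nlinarith [sq_nonneg (Em y T n 0), sq_nonneg (Em y T n 1), sq_nonneg (Em y T n 2)]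
  set S' := {m ∈ S | dt (Em y T m) (Em y T m) ≤ dt (Em y T n) (Em y T n)} with hS'
  have hfin : S'.Finite := by
    obtain ⟨M, hM⟩ := exists_nat_gt (B * T ^ 11 + B * T ^ 11 * |y| + B * T ^ 11 * y ^ 2 + B / T ^ 4)
    apply (Set.finite_Icc (fun _ : Fin 3 => -(M:ℤ)) (fun _ => (M:ℤ))).subset
    rintro m ⟨-, hm⟩
    obtain ⟨h0, h1, h2⟩ := Em_bound y T B hT m (by linarith) (by nlinarith)
    have p1 : 0 ≤ B * T ^ 11 := by have : 0 ≤ B := by linarith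
                                   positivity
    have p2 : 0 ≤ B / T ^ 4 := by have : 0 ≤ B := by linarith
                                  positivity
    have hk : ∀ k, |(m k : ℝ)| ≤ M := by
      have e1 : |(m 0 : ℝ) * y| ≤ B * T ^ 11 * |y| := by rw [abs_mul]; gcongr
      have e2 : |(m 0 : ℝ) * y ^ 2| ≤ B * T ^ 11 * y ^ 2 := by rw [abs_mul, abs_of_nonneg (sq_nonneg y)]; gcongr
      have := abs_nonneg y
      have p3 : 0 ≤ B * T ^ 11 * |y| := by positivity
      have p4 : 0 ≤ B * T ^ 11 * y ^ 2 := by positivity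
      rw [abs_le] at e1 e2 h1 h2
      intro k
      fin_cases k
      · simp; linarith
      · simp; rw [abs_le]; constructor <;> linarith
      · simp; rw [abs_le]; constructor <;> linarith
    rw [Set.mem_Icc, Pi.le_def, Pi.le_def]
    have hk' : ∀ k, |m k| ≤ M := fun k => by exact_mod_cast hk k
    exact ⟨fun k => (abs_le.1 (hk' k)).1, fun k => (abs_le.1 (hk' k)).2⟩
  obtain ⟨m, hm, hmin⟩ := Set.exists_min_image S' (fun m => dt (Em y T m) (Em y T m)) hfin ⟨n, hn, le_rfl⟩
  refine ⟨m, hm.1, fun k hk => ?_⟩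
  by_cases h : dt (Em y T k) (Em y T k) ≤ dt (Em y T n) (Em y T n)
  · exact hmin k ⟨hk, h⟩
  · exact hm.2.trans (not_le.1 h).le

theorem three_points (y T : ℝ) (hT : 2 ≤ T) (hy : |y| ≤ 1)
    (hgood : ∀ c : Fin 3 → ℤ, c ≠ 0 → (∀ i, |(c i : ℝ)| ≤ T ^ 4) → 1 < |ev3 y c| * T ^ 11) :
    ∃ n : Fin 3 → Fin 3 → ℤ, dt (cr (n 0) (n 1)) (n 2) ≠ 0 ∧ 
      ∀ i, |(n i 0 : ℝ)| ≤ 8 * T ^ 11 ∧ |(n i 0 : ℝ) * y - n i 1| ≤ 8 / T ^ 4 ∧ |(n i 0 : ℝ) * y ^ 2 - n i 2| ≤ 8 / T ^ 4 := by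
  have hT0 : 0 < T := by linarith
  obtain ⟨n1, h1, hmin1⟩ := Em_min y T hT0 {n | n ≠ 0} ⟨![1, 0, 0], by intro h; simpa using congrFun h 0⟩
  obtain ⟨n2, h2, hmin2⟩ := Em_min y T hT0 {n | cr n1 n ≠ 0} (by
    by_contra h
    rw [Set.not_nonempty_iff_eq_empty] at h
    have hh : ∀ n, cr n1 n = 0 := by
      intro n
      by_contra hn
      have : n ∈ {n | cr n1 n ≠ 0} := hn
      rw [h] at this
      exact this
    apply h1
    have a1 := congrFun (hh ![1, 0, 0]) 1
    have a2 := congrFun (hh ![1, 0, 0]) 2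
    have a3 := congrFun (hh ![0, 1, 0]) 2
    simp [cr] at a1 a2 a3
    funext i; fin_cases i <;> simpa)
  simp only [Set.mem_ofPred_eq] at h1 hmin1 h2 hmin2
  obtain ⟨g, c, hg, hc, hgc⟩ := exists_prim _ h2
  have hc0 : c ≠ 0 := by
    rintro rfl
    obtain ⟨u, hu⟩ := hc
    simp at hu
  obtain ⟨m, hm⟩ := hc
  have hN12 : dt (Em y T n1) (Em y T n1) ≤ dt (Em y T n2) (Em y T n2) := by
    apply hmin1
    rintro rfl
    apply h2
    funext i; fin_cases i <;> simp [cr]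
  have hc1 : dt c n1 = 0 := by
    apply mul_left_cancel₀ hg
    have e0 := hgc 0
    have e1 := hgc 1
    have e2 := hgc 2
    simp [cr] at e0 e1 e2
    simp only [dt]
    linear_combination -n1 0 * e0 - n1 1 * e1 - n1 2 * e2
  have hc2 : dt c n2 = 0 := by
    apply mul_left_cancel₀ hg
    have e0 := hgc 0
    have e1 := hgc 1
    have e2 := hgc 2
    simp [cr] at e0 e1 e2
    simp only [dt]
    linear_combination -n2 0 * e0 - n2 1 * e1 - n2 2 * e2
  set z : Fin 3 → ℝ := ![T ^ 11 * ev3 y c, - c 1 / T ^ 4, - c 2 / T ^ 4] with hz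
  have hzE : ∀ n : Fin 3 → ℤ, dt z (Em y T n) = (dt c n : ℤ) := by
    intro n
    simp [dt, hz, Em, ev3]
    field_simp
    ring
  have hzz : 1 / 16 ≤ dt z z := by
    by_contra! hlt
    have hk : ∀ k, |z k| ≤ 1 / 4 := by
      intro k
      refine abs_le_of_sq_le_sq ?_ (by norm_num)
      simp only [dt] at hlt
      fin_cases k <;> simp <;> nlinarith [sq_nonneg (z 0), sq_nonneg (z 1), sq_nonneg (z 2)]
    have k0 := hk 0
    have k1 := hk 1
    have k2 := hk 2
    simp [hz] at k0 k1 k2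
    have hT4 : 0 < T ^ 4 := by positivity
    have hT11 : 0 < T ^ 11 := by positivity
    rw [abs_div, abs_neg, abs_of_pos hT4, div_le_iff₀ hT4] at k1 k2
    rw [abs_of_pos hT0] at k0
    have hT16 : 16 ≤ T ^ 4 := by
      calc (16:ℝ) = 2 ^ 4 := by norm_num
        _ ≤ T ^ 4 := by gcongr
    have hT1 : 1 ≤ T ^ 11 := one_le_pow₀ (by linarith)
    have hc00 : |(c 0 : ℝ)| ≤ T ^ 4 := by
      have e : (c 0 : ℝ) = ev3 y c - (c 1 * y + c 2 * y ^ 2) := by simp only [ev3]; ring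
      have l1 : |(c 1 : ℝ) * y| ≤ T ^ 4 / 4 := by
        rw [abs_mul]; nlinarith [abs_nonneg (c 1 : ℝ), abs_nonneg y]
      have l2 : |(c 2 : ℝ) * y ^ 2| ≤ T ^ 4 / 4 := by
        rw [abs_mul, abs_pow]
        have : |y| ^ 2 ≤ 1 := by nlinarith [abs_nonneg y]
        nlinarith [abs_nonneg (c 2 : ℝ)]
      have l3 : |ev3 y c| ≤ 1 / 4 := by nlinarith [abs_nonneg (ev3 y c)]
      rw [e]
      refine (abs_sub _ _).trans ?_
      have := abs_add_le ((c 1 : ℝ) * y) (c 2 * y ^ 2)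
      linarith
    have := hgood c hc0 (by
      intro i; fin_cases i
      · simpa using hc00
      · simp; linarith
      · simp; linarith)
    linarith
  have hcrE : ∀ i, cr (Em y T n1) (Em y T n2) i = (g / T ^ 3) * z i := by
    have e0 : ((cr n1 n2 0 : ℤ) : ℝ) = (g * c 0 : ℤ) := by rw [hgc 0]
    have e1 : ((cr n1 n2 1 : ℤ) : ℝ) = (g * c 1 : ℤ) := by rw [hgc 1]
    have e2 : ((cr n1 n2 2 : ℤ) : ℝ) = (g * c 2 : ℤ) := by rw [hgc 2]
    simp [cr] at e0 e1 e2
    intro i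
    fin_cases i
    · simp [cr, Em, hz, ev3]
      field_simp
      linear_combination  e0 + y * e1 + y ^ 2 * e2
    · simp [cr, Em, hz, ev3]
      field_simp
      linear_combination -e1
    · simp [cr, Em, hz, ev3]
      field_simp
      linear_combination -e2
  have hgR : (g:ℝ) ≠ 0 := by exact_mod_cast hg
  have hD : dt z (cr (Em y T n1) (Em y T n2)) ≠ 0 := by
    have : dt z (cr (Em y T n1) (Em y T n2)) = (g / T ^ 3) * dt z z := by
      simp only [dt, hcrE]; ring
    rw [this]
    have : 0 < dt z z := by linarith
    positivity
  have hadd : ∀ (k : ℤ), dt (Em y T (fun i => n2 i + k * n1 i)) (Em y T (fun i => n2 i + k * n1 i))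
      = dt (Em y T n2) (Em y T n2) + 2 * k * dt (Em y T n1) (Em y T n2) + k ^ 2 * dt (Em y T n1) (Em y T n1) := by
    intro k
    simp [dt, Em]; ring
  have hge : ∀ k : ℤ, dt (Em y T n2) (Em y T n2) ≤ dt (Em y T (fun i => n2 i + k * n1 i)) (Em y T (fun i => n2 i + k * n1 i)) := by
    intro k
    apply hmin2
    intro h
    apply h2
    rw [← h]
    funext i; fin_cases i <;> simp [cr] <;> ring
  have hB : |dt (Em y T n1) (Em y T n2)| ≤ dt (Em y T n1) (Em y T n1) / 2 := by
    have p := hge 1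
    have q := hge (-1)
    rw [hadd] at p q
    push_cast at p q
    rw [abs_le]
    constructor <;> linarith
  obtain ⟨k1, k2, hk⟩ := red_step (Em y T n1) (Em y T n2) (Em y T m) z (by rw [hzE, hc1]; simp) (by rw [hzE, hc2]; simp)
    (by rw [hzE]; norm_cast; simp only [dt]; linarith) hD hzz hN12 hB
  set n3 : Fin 3 → ℤ := fun i => m i - k1 * n1 i - k2 * n2 i with hn3
  have e3 : Em y T n3 = (fun i => Em y T m i - k1 * Em y T n1 i - k2 * Em y T n2 i) := by
    funext i
    fin_cases i <;> simp [Em, hn3] <;> ring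
  rw [← e3] at hk
  have hc3 : dt c n3 = 1 := by
    simp only [dt, hn3] at hc1 hc2 ⊢
    linear_combination hm - k1 * hc1 - k2 * hc2
  have hN23 : dt (Em y T n2) (Em y T n2) ≤ dt (Em y T n3) (Em y T n3) := by
    apply hmin2
    intro h
    apply h1
    have x0 := congrFun h 0
    have x1 := congrFun h 1
    have x2 := congrFun h 2
    simp [cr] at x0 x1 x2
    simp only [dt] at hc1 hc3
    funext i
    fin_cases i
    · simp; linear_combination (-n1 0) * hc3 + n3 0 * hc1 + c 1 * x2 - c 2 * x1
    · simp; linear_combination (-n1 1) * hc3 + n3 1 * hc1 - c 0 * x2 + c 2 * x0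
    · simp; linear_combination (-n1 2) * hc3 + n3 2 * hc1 + c 0 * x1 - c 1 * x0
  refine ⟨![n1, n2, n3], ?_, ?_⟩
  · have : dt (cr n1 n2) n3 = g * dt c n3 := by
      simp only [dt, hgc]; ring
    simp
    rw [this, hc3]; simpa using hg
  · have hb : ∀ n, dt (Em y T n) (Em y T n) ≤ dt (Em y T n3) (Em y T n3) → 
      |(n 0 : ℝ)| ≤ 8 * T ^ 11 ∧ |(n 0 : ℝ) * y - n 1| ≤ 8 / T ^ 4 ∧ |(n 0 : ℝ) * y ^ 2 - n 2| ≤ 8 / T ^ 4 := by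
      intro n hn
      apply Em_bound y T 8 hT0 n (by norm_num)
      linarith
    intro i
    fin_cases i
    · exact hb n1 (hN12.trans hN23)
    · exact hb n2 hN23
    · exact hb n3 le_rfl

end

section

lemma indep_of_det (n : Fin 3 → Fin 3 → ℤ) (p p' q q' : ℤ) (hV : p * q' - p' * q ≠ 0)
    (hn : dt (cr (n 0) (n 1)) (n 2) ≠ 0) (Y : Fin 3 → Fin 4 → ℤ)
    (h0 : ∀ i, Y i 0 = p * n i 1 + p' * n i 0) (h1 : ∀ i, Y i 1 = - p * n i 2 - p' * n i 1)
    (h2 : ∀ i, Y i 2 = q * n i 1 + q' * n i 0) (h3 : ∀ i, Y i 3 = - q * n i 2 - q' * n i 1) :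
    LinearIndependent ℝ (fun i k => (Y i k : ℝ)) := by
  rw [Fintype.linearIndependent_iff]
  intro g hg
  have hk : ∀ k, g 0 * (Y 0 k : ℝ) + g 1 * Y 1 k + g 2 * Y 2 k = 0 := by
    intro k
    have := congrFun hg k
    simpa [Fin.sum_univ_three] using this
  have k0 := hk 0
  have k1 := hk 1
  have k2 := hk 2
  have k3 := hk 3
  simp only [h0, h1, h2, h3] at k0 k1 k2 k3
  push_cast at k0 k1 k2 k3
  have hVR : (p * q' - p' * q : ℝ) ≠ 0 := by exact_mod_cast hV
  have hnR : ((dt (cr (n 0) (n 1)) (n 2) : ℤ) : ℝ) ≠ 0 := by exact_mod_cast hn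
  simp [dt, cr] at hnR
  have m1 : g 0 * (n 0 1 : ℝ) + g 1 * n 1 1 + g 2 * n 2 1 = 0 := by
    apply mul_left_cancel₀ hVR; linear_combination q' * k0 - p' * k2
  have m0 : g 0 * (n 0 0 : ℝ) + g 1 * n 1 0 + g 2 * n 2 0 = 0 := by
    apply mul_left_cancel₀ hVR; linear_combination p * k2 - q * k0
  have m2 : g 0 * (n 0 2 : ℝ) + g 1 * n 1 2 + g 2 * n 2 2 = 0 := by
    apply mul_left_cancel₀ hVR; linear_combination p' * k3 - q' * k1
  intro i
  fin_cases i
  · simp only [Fin.zero_eta]; apply mul_left_cancel₀ hnR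
    linear_combination (m0 * (n 1 1 * n 2 2 - n 1 2 * n 2 1) + m1 * (n 1 2 * n 2 0 - n 1 0 * n 2 2) + m2 * (n 1 0 * n 2 1 - n 1 1 * n 2 0))
  · simp only [Fin.mk_one]; apply mul_left_cancel₀ hnR
    linear_combination -(m0 * (n 0 1 * n 2 2 - n 0 2 * n 2 1) + m1 * (n 0 2 * n 2 0 - n 0 0 * n 2 2) + m2 * (n 0 0 * n 2 1 - n 0 1 * n 2 0))
  · simp only [Fin.reduceFinMk]; apply mul_left_cancel₀ hnR
    linear_combination (m0 * (n 0 1 * n 1 2 - n 0 2 * n 1 1) + m1 * (n 0 2 * n 1 0 - n 0 0 * n 1 2) + m2 * (n 0 0 * n 1 1 - n 0 1 * n 1 0))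

lemma form_bounds (y T C τ' q q' p p' x0 x1 x2 : ℝ) (hy : |y| ≤ 1) (hT : 2 ≤ T) (hC : 1 ≤ C) (hq : 0 < q)
    (hq' : |q'| ≤ C * q) (he : |p - y * q| ≤ C / q) (he' : |p' - y * q'| ≤ C / q)
    (hs : |(p' - y * q') + y * (p - y * q)| ≤ C / (q * τ')) (hτ : T ^ 15 ≤ τ')
    (b0 : |x0| ≤ 8 * T ^ 11) (b1 : |x0 * y - x1| ≤ 8 / T ^ 4) (b2 : |x0 * y ^ 2 - x2| ≤ 8 / T ^ 4) (v : Fin 4 → ℝ)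
    (h0 : v 0 = p * x1 + p' * x0) (h1 : v 1 = - p * x2 - p' * x1)
    (h2 : v 2 = q * x1 + q' * x0) (h3 : v 3 = - q * x2 - q' * x1) :
    |Lf y v 0| ≤ (24 * C) * (1 / (q * T ^ 4)) ∧ |Lf y v 1| ≤ (24 * C) * (1 / (q * T ^ 4)) ∧
    |Lf y v 2| ≤ (24 * C) * (q / T ^ 4) ∧ |Lf y v 3| ≤ (24 * C) * (q * T ^ 11) := by
  have hT0 : 0 < T := by linarith
  have hC0 : 0 < C := by linarith
  have hτ0 : 0 < τ' := lt_of_lt_of_le (by positivity) hτ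
  set ε := p - y * q with hε
  set ε' := p' - y * q' with hε'
  set P := x0 * y - x1 with hP
  set F := x0 * y ^ 2 - x2 with hF
  have e0 : Lf y v 0 = ε * F + P * (ε' - y * ε) := by
    simp [Lf, h0, h1, h2, h3, hε, hε', hP, hF]; ring
  have e1 : Lf y v 1 = x0 * (ε' + y * ε) - ε * P := by
    simp [Lf, h0, h1, h2, h3, hε, hε', hP]; ring
  have e2 : Lf y v 2 = q * (F - y * P) + q' * P := by
    simp [Lf, h0, h1, h2, h3, hP, hF]; ring
  have e3 : Lf y v 3 = q * (x0 * y - P) + q' * x0 := by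
    simp [Lf, h2, hP]
  have hyε : |y * ε| ≤ C / q := by
    rw [abs_mul]
    calc |y| * |ε| ≤ 1 * |ε| := by gcongr
      _ ≤ _ := by rw [one_mul]; exact he
  have hyP : |y * P| ≤ 8 / T ^ 4 := by
    rw [abs_mul]
    calc |y| * |P| ≤ 1 * |P| := by gcongr
      _ ≤ _ := by rw [one_mul]; exact b1
  have hT4 : 0 < T ^ 4 := by positivity
  have hTq : C / q * (8 / T ^ 4) = (8 * C) * (1 / (q * T ^ 4)) := by field_simp
  refine ⟨?_, ?_, ?_, ?_⟩
  · rw [e0]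
    refine (abs_add_le _ _).trans ?_
    rw [abs_mul, abs_mul]
    calc _ ≤ C / q * (8 / T ^ 4) + (8 / T ^ 4) * (C / q + C / q) := by
          gcongr
          exact (abs_sub _ _).trans (add_le_add he' hyε)
      _ = _ := by field_simp; norm_num
  · rw [e1]
    refine (abs_sub _ _).trans ?_
    rw [abs_mul, abs_mul]
    calc _ ≤ 8 * T ^ 11 * (C / (q * τ')) + C / q * (8 / T ^ 4) := by gcongr
      _ ≤ 8 * T ^ 11 * (C / (q * T ^ 15)) + C / q * (8 / T ^ 4) := by gcongr
      _ = (16 * C) * (1 / (q * T ^ 4)) := by field_simp; norm_num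
      _ ≤ _ := by gcongr; norm_num
  · rw [e2]
    refine (abs_add_le _ _).trans ?_
    rw [abs_mul, abs_mul, abs_of_pos hq]
    calc _ ≤ q * (8 / T ^ 4 + 8 / T ^ 4) + C * q * (8 / T ^ 4) := by
          gcongr
          exact (abs_sub _ _).trans (add_le_add b2 hyP)
      _ = (16 + 8 * C) * (q / T ^ 4) := by ring
      _ ≤ _ := by gcongr; linarith
  · rw [e3]
    refine (abs_add_le _ _).trans ?_
    rw [abs_mul, abs_mul, abs_of_pos hq]
    have l1 : |x0 * y| ≤ 8 * T ^ 11 := by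
      rw [abs_mul]; nlinarith [abs_nonneg y, abs_nonneg x0]
    have l2 : 8 / T ^ 4 ≤ 8 * T ^ 11 := by
      rw [div_le_iff₀ hT4]
      have : 1 ≤ T ^ 11 * T ^ 4 := by rw [← pow_add]; exact one_le_pow₀ (by linarith)
      nlinarith
    calc _ ≤ q * (8 * T ^ 11 + 8 * T ^ 11) + C * q * (8 * T ^ 11) := by
          gcongr
          exact (abs_sub _ _).trans (add_le_add l1 (b1.trans l2))
      _ = (16 + 8 * C) * (q * T ^ 11) := by ring
      _ ≤ _ := by gcongr; linarith

theorem final_approx (y : ℝ) (halg : IsAlgebraic ℚ y) (hy : |y| ≤ 1) (hquad : ∀ c : Fin 3 → ℤ, ev3 y c = 0 → c = 0) (c : ℝ) (hc0 : 0 < c)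
    (hc : ∀ a b : ℤ, a ≠ 0 → c ≤ |(a:ℝ)| * |a * y - b|) (C τ Λ R0 : ℝ) (hC : 1 ≤ C) (hτ : 0 < τ) (hΛ : 0 < Λ)
    (hdata : ∀ R : ℝ, R0 ≤ R → ∃ p' p q' q : ℤ, 2 ≤ q ∧ R ≤ Real.log q ∧ Real.log q ≤ Λ * R ∧ IsCoprime q' q ∧ p * q' - p' * q ≠ 0 ∧
      |(q':ℝ)| ≤ C * q ∧ |(p:ℝ) - y * q| ≤ C / q ∧ |(p':ℝ) - y * q'| ≤ C / q ∧ 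
      |((p':ℝ) - y * q') + y * (p - y * q)| ≤ C / (q * Real.exp (τ * Real.log q))) : False := by
  set κ := Real.log (24 * C) with hκ
  have hκ0 : 0 ≤ κ := Real.log_nonneg (by linarith)
  set ρ := 12 + 15 / τ with hρ
  have hρ0 : 12 ≤ ρ := by have : 0 < 15 / τ := by positivity
                          linarith
  have hΛρ : 0 < Λ * ρ := by positivity
  refine pt4 y halg 13 (1 / (8 * (Λ * ρ))) (by positivity) ?_
  intro N
  obtain ⟨T, hT, hgood⟩ := ds_dual y hquad c hc0 hc (Real.exp (1 + 8 * κ + |N| + |R0|))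
  set t := Real.log T with ht
  have hTpos : 0 < T := (Real.exp_pos _).trans_le hT
  have hlt : 1 + 8 * κ + |N| + |R0| ≤ t := by
    rw [ht, Real.le_log_iff_exp_le hTpos]; exact hT
  have hN1 := abs_nonneg N
  have hN2 := le_abs_self N
  have hR1 := abs_nonneg R0
  have hR2 := le_abs_self R0
  have hT2 : 2 ≤ T := by
    have h1 : Real.exp 1 ≤ T := (Real.exp_le_exp.2 (by linarith)).trans hT
    have := Real.add_one_le_exp (1:ℝ)
    linarith
  have hTt : T = Real.exp t := (Real.exp_log hTpos).symm
  obtain ⟨n, hn, hb⟩ := three_points y T hT2 hy hgood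
  obtain ⟨p', p, q', q, hq2, hR, hRΛ, hcop, hdet, hq', he, he', hs⟩ := hdata (t * ρ) (by nlinarith)
  set l := Real.log q with hl
  have hqR : (2:ℝ) ≤ q := by exact_mod_cast hq2
  have hql : (q:ℝ) = Real.exp l := (Real.exp_log (by linarith)).symm
  have hlt12 : 12 * t ≤ l := by nlinarith
  have hl0 : 0 < l := by linarith
  have hτl : 15 * t ≤ τ * l := by
    have : 15 / τ * t ≤ l := by nlinarith
    rw [div_mul_eq_mul_div, div_le_iff₀ hτ] at this
    linarith
  set Y : Fin 3 → Fin 4 → ℤ := fun i => ![p * n i 1 + p' * n i 0, - p * n i 2 - p' * n i 1, q * n i 1 + q' * n i 0, - q * n i 2 - q' * n i 1] with hY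
  refine ⟨p', p, q', q, Y, ![-1 - 4 * t / l + κ / l, -1 - 4 * t / l + κ / l, 1 - 4 * t / l + κ / l, 1 + 11 * t / l + κ / l], hq2, ?_, hcop, ?_, ?_, ?_, ?_, ?_⟩
  · nlinarith
  · have g1 : 0 ≤ t / l := div_nonneg (by linarith) hl0.le
    have g2 : t / l ≤ 1 / 12 := by rw [div_le_iff₀ hl0]; linarith
    have g3 : 0 ≤ κ / l := by positivity
    have g4 : κ / l ≤ 1 := by rw [div_le_iff₀ hl0]; linarith
    intro k
    fin_cases k
    all_goals simp only [mul_div_assoc]; simp; rw [abs_le]; constructor <;> linarith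
  · rw [Fin.sum_univ_four]
    simp
    have : -1 - 4 * t / l + κ / l + (-1 - 4 * t / l + κ / l) + (1 - 4 * t / l + κ / l) + (1 + 11 * t / l + κ / l) = (4 * κ - t) / l := by
      field_simp; ring
    rw [this]
    have h1 : (4 * κ - t) / l ≤ (- t / 2) / l := by gcongr; linarith
    refine h1.trans ?_
    rw [div_le_iff₀ hl0]
    have : l / (Λ * ρ) ≤ t := by rw [div_le_iff₀ hΛρ]; linarith
    have e : -(4 * (ρ⁻¹ * Λ⁻¹ * 8⁻¹)) * l = - (1 / 2) * (l / (Λ * ρ)) := by field_simp; norm_num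
    rw [e]; linarith
  · intro i
    obtain ⟨b0, b1, b2⟩ := hb i
    have hexp : T ^ 15 ≤ Real.exp (τ * l) := by
      rw [hTt, ← Real.exp_nat_mul]; apply Real.exp_le_exp.2; push_cast; linarith
    have hfb := form_bounds y T C (Real.exp (τ * l)) q q' p p' (n i 0) (n i 1) (n i 2) hy hT2 hC (by linarith) hq' he he' hs hexp b0 b1 b2
      (fun k => (Y i k : ℝ)) (by simp [hY]) (by simp [hY]) (by simp [hY]) (by simp [hY])
    have hK : 24 * C = Real.exp κ := (Real.exp_log (by linarith)).symm
    have hT4 : T ^ 4 = Real.exp (4 * t) := by rw [hTt, ← Real.exp_nat_mul]; norm_num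
    have hT11 : T ^ 11 = Real.exp (11 * t) := by rw [hTt, ← Real.exp_nat_mul]; norm_num
    rw [hK, hT4, hT11, hql] at hfb
    obtain ⟨f0, f1, f2, f3⟩ := hfb
    rw [one_div, ← Real.exp_add, ← Real.exp_neg, ← Real.exp_add] at f0 f1
    rw [← Real.exp_sub, ← Real.exp_add] at f2
    rw [← Real.exp_add, ← Real.exp_add] at f3
    intro k
    fin_cases k
    · refine f0.trans (Real.exp_le_exp.2 (le_of_eq ?_)); simp; field_simp; ring
    · refine f1.trans (Real.exp_le_exp.2 (le_of_eq ?_)); simp; field_simp; ring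
    · refine f2.trans (Real.exp_le_exp.2 (le_of_eq ?_)); simp; field_simp; ring
    · refine f3.trans (Real.exp_le_exp.2 (le_of_eq ?_)); simp; field_simp; ring
  · intro i
    simp [hY]; ring
  · exact indep_of_det n p p' q q' hdet hn Y (fun i => by simp [hY]) (fun i => by simp [hY]) (fun i => by simp [hY]) (fun i => by simp [hY])

end

section

lemma cvQ_succ2 (a : ℕ → ℕ) (n : ℕ) : cvQ a (n + 2) = (a (n + 1) : ℤ) * cvQ a (n + 1) + cvQ a n := rfl
lemma cvP_succ2 (b : ℤ) (a : ℕ → ℕ) (n : ℕ) : cvP b a (n + 2) = (a (n + 1) : ℤ) * cvP b a (n + 1) + cvP b a n := rfl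

lemma cvP_shift (b : ℤ) (a : ℕ → ℕ) (n : ℕ) : cvP b a n = b * cvQ a n + cvP 0 a n ∧
    cvP b a (n+1) = b * cvQ a (n+1) + cvP 0 a (n+1) := by
  induction n with
  | zero => simp [cvP, cvQ]; ring
  | succ n ih =>
    refine ⟨ih.2, ?_⟩
    rw [cvP_succ2, cvP_succ2, cvQ_succ2, ih.1, ih.2]; ring

lemma cvQ_pos (a : ℕ → ℕ) (hpos : ∀ i, 0 < a i) (n : ℕ) : 1 ≤ cvQ a n ∧ cvQ a n ≤ cvQ a (n + 1) := by
  induction n with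
  | zero => simp [cvQ]; have := hpos 0; omega
  | succ n ih =>
    have h1 : 1 ≤ cvQ a (n+1) := ih.1.trans ih.2
    refine ⟨h1, ?_⟩
    rw [cvQ_succ2]
    have : (1:ℤ) ≤ a (n+1) := by exact_mod_cast hpos (n+1)
    nlinarith [ih.1]

lemma cvQ_mono (a : ℕ → ℕ) (hpos : ∀ i, 0 < a i) : Monotone (cvQ a) :=
  monotone_nat_of_le_succ fun n => (cvQ_pos a hpos n).2

lemma cvQ_ge (a : ℕ → ℕ) (hpos : ∀ i, 0 < a i) (n : ℕ) : (n : ℤ) ≤ cvQ a n ∧ (n : ℤ) + 1 ≤ cvQ a (n+1) := by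
  induction n with
  | zero => simp [cvQ]; have := hpos 0; omega
  | succ n ih =>
    refine ⟨by push_cast; exact ih.2, ?_⟩
    rw [cvQ_succ2]
    have : (1:ℤ) ≤ a (n+1) := by exact_mod_cast hpos (n+1)
    have := (cvQ_pos a hpos n).1
    push_cast
    nlinarith [ih.2]

lemma cvQ_two (a : ℕ → ℕ) (hpos : ∀ i, 0 < a i) (n : ℕ) : 2 * cvQ a n ≤ cvQ a (n + 2) := by
  rw [cvQ_succ2]
  have h0 : (1:ℤ) ≤ a (n+1) := by exact_mod_cast hpos (n+1)
  have := cvQ_pos a hpos n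
  nlinarith

lemma cvQ_ge_pow (a : ℕ → ℕ) (hpos : ∀ i, 0 < a i) (n : ℕ) : 2 ^ (n / 2) ≤ cvQ a n := by
  have h : ∀ k, 2 ^ k ≤ cvQ a (2 * k) := by
    intro k
    induction k with
    | zero => simp [cvQ]
    | succ k ih =>
      have := cvQ_two a hpos (2 * k)
      rw [show 2 * (k+1) = 2 * k + 2 by ring, pow_succ]; linarith
  exact (h (n / 2)).trans (cvQ_mono a hpos (Nat.mul_div_le n 2))

lemma cvQ_le_succ (a : ℕ → ℕ) (hpos : ∀ i, 0 < a i) (M : ℕ) (hM : ∀ i, a i ≤ M) (n : ℕ) : cvQ a (n+1) ≤ (M + 1) * cvQ a n := by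
  cases n with
  | zero => simp [cvQ]; have := hM 0; omega
  | succ n =>
    rw [cvQ_succ2]
    have : (a (n+1) : ℤ) ≤ M := by exact_mod_cast hM (n+1)
    have := cvQ_pos a hpos n
    nlinarith

lemma cvQ_le_pow (a : ℕ → ℕ) (hpos : ∀ i, 0 < a i) (M : ℕ) (hM : ∀ i, a i ≤ M) (n : ℕ) : cvQ a n ≤ (M + 1) ^ n := by
  induction n with
  | zero => simp [cvQ]
  | succ n ih =>
    refine (cvQ_le_succ a hpos M hM n).trans ?_
    rw [pow_succ]; nlinarith

lemma cv_det (a : ℕ → ℕ) (n : ℕ) : cvP 0 a n * cvQ a (n+1) - cvP 0 a (n+1) * cvQ a n = (-1) ^ (n+1) := by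
  induction n with
  | zero => simp [cvP, cvQ]
  | succ n ih =>
    rw [cvP_succ2, cvQ_succ2, pow_succ, ← ih]; ring

lemma cv_D (a : ℕ → ℕ) (hpos : ∀ i, 0 < a i) (r k : ℕ) :
    |cvP 0 a r * cvQ a (r+k) - cvP 0 a (r+k) * cvQ a r| * cvQ a (r+1) ≤ cvQ a (r+k) ∧
    |cvP 0 a r * cvQ a (r+k+1) - cvP 0 a (r+k+1) * cvQ a r| * cvQ a (r+1) ≤ cvQ a (r+k+1) := by
  induction k with
  | zero =>
    constructor
    · simp; linarith [(cvQ_pos a hpos r).1]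
    · simp [cv_det]
  | succ k ih =>
    refine ⟨ih.2, ?_⟩
    rw [show r + (k+1) + 1 = r + k + 2 by ring, cvQ_succ2, cvP_succ2]
    have e : cvP 0 a r * ((a (r+k+1) : ℤ) * cvQ a (r+k+1) + cvQ a (r+k)) - ((a (r+k+1) : ℤ) * cvP 0 a (r+k+1) + cvP 0 a (r+k)) * cvQ a r
      = a (r+k+1) * (cvP 0 a r * cvQ a (r+k+1) - cvP 0 a (r+k+1) * cvQ a r) + (cvP 0 a r * cvQ a (r+k) - cvP 0 a (r+k) * cvQ a r) := by ring
    rw [e]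
    have ha : (0:ℤ) ≤ a (r+k+1) := by positivity
    have hq := (cvQ_pos a hpos (r+1)).1
    calc _ ≤ ((a (r+k+1):ℤ) * |cvP 0 a r * cvQ a (r+k+1) - cvP 0 a (r+k+1) * cvQ a r| + |cvP 0 a r * cvQ a (r+k) - cvP 0 a (r+k) * cvQ a r|) * cvQ a (r+1) := by
          gcongr
          refine (abs_add_le _ _).trans ?_
          rw [abs_mul, abs_of_nonneg ha]
      _ ≤ _ := by nlinarith [ih.1, ih.2]

lemma cv_err (a : ℕ → ℕ) (hpos : ∀ i, 0 < a i) (y : ℝ)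
    (hy : Filter.Tendsto (fun n => (cvP 0 a n : ℝ) / (cvQ a n : ℝ)) Filter.atTop (nhds y)) (r : ℕ) :
    |(cvP 0 a r : ℝ) - y * cvQ a r| ≤ 1 / cvQ a (r+1) := by
  have h1 : Filter.Tendsto (fun k => |(cvP 0 a r : ℝ) - (cvP 0 a (k + r) : ℝ) / (cvQ a (k + r) : ℝ) * cvQ a r|) Filter.atTop
      (nhds |(cvP 0 a r : ℝ) - y * cvQ a r|) := by
    have := (Filter.tendsto_add_atTop_iff_nat r).2 hy
    exact ((this.mul_const _).const_sub _).abs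
  refine le_of_tendsto h1 (Filter.Eventually.of_forall fun k => ?_)
  have h2 := (cv_D a hpos r k).1
  have q1 : (0:ℝ) < cvQ a (r+1) := by exact_mod_cast (cvQ_pos a hpos (r+1)).1
  have q2 : (0:ℝ) < cvQ a (k+r) := by exact_mod_cast (cvQ_pos a hpos (k+r)).1
  have h3 : |(cvP 0 a r : ℝ) * cvQ a (k+r) - cvP 0 a (k+r) * cvQ a r| * cvQ a (r+1) ≤ cvQ a (k+r) := by
    rw [add_comm k r]; exact_mod_cast h2
  have e : (cvP 0 a r : ℝ) - (cvP 0 a (k + r) : ℝ) / (cvQ a (k + r) : ℝ) * cvQ a r = 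
      ((cvP 0 a r : ℝ) * cvQ a (k+r) - cvP 0 a (k+r) * cvQ a r) / cvQ a (k+r) := by field_simp
  rw [e, abs_div, abs_of_pos q2, div_le_div_iff₀ q2 q1]
  linarith

lemma cv_bad (a : ℕ → ℕ) (hpos : ∀ i, 0 < a i) (M : ℕ) (hM : ∀ i, a i ≤ M) (y : ℝ)
    (hy : Filter.Tendsto (fun n => (cvP 0 a n : ℝ) / (cvQ a n : ℝ)) Filter.atTop (nhds y)) (u v : ℤ) (hu : u ≠ 0) :
    1 / (4 * (M + 1)) ≤ |(u:ℝ)| * |u * y - v| := by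
  have hu1 : (1:ℤ) ≤ |u| := Int.one_le_abs hu
  have hex : ∃ n : ℕ, 2 * |u| ≤ cvQ a (n+1) := ⟨(2 * |u|).toNat, by
    have := (cvQ_ge a hpos (2 * |u|).toNat).2
    have := Int.self_le_toNat (2 * |u|)
    omega⟩
  classical
  set n := Nat.find hex with hn
  have hn1 : 2 * |u| ≤ cvQ a (n+1) := Nat.find_spec hex
  have hn2 : cvQ a (n+1) ≤ (M+1) * (2 * |u|) := by
    rcases Nat.eq_zero_or_pos n with h0 | h0
    · rw [h0]
      have := cvQ_le_succ a hpos M hM 0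
      simp [cvQ] at this ⊢
      nlinarith
    · have h := Nat.find_min hex (m := n - 1) (by omega)
      rw [show n - 1 + 1 = n by omega] at h
      have := cvQ_le_succ a hpos M hM n
      push Not at h
      refine this.trans ?_
      gcongr
  have hne : ∃ k, (k = n ∨ k = n + 1) ∧ u * cvP 0 a k - v * cvQ a k ≠ 0 := by
    by_contra! h
    have h1 := h n (Or.inl rfl)
    have h2 := h (n+1) (Or.inr rfl)
    have h3 := cv_det a n
    have : u * (-1) ^ (n+1) = 0 := by
      rw [← h3]; linear_combination cvQ a (n+1) * h1 - cvQ a n * h2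
    rcases mul_eq_zero.1 this with h | h
    · exact hu h
    · exact absurd h (pow_ne_zero _ (by norm_num))
  obtain ⟨k, hk, hne⟩ := hne
  have hge : (1:ℝ) ≤ |(u:ℝ) * cvP 0 a k - v * cvQ a k| := by exact_mod_cast Int.one_le_abs hne
  set Q : ℝ := ((cvQ a (n+1) : ℤ) : ℝ) with hQ
  have hQ1 : (1:ℝ) ≤ Q := by rw [hQ]; exact_mod_cast (cvQ_pos a hpos (n+1)).1
  have hkQ : (cvQ a k : ℝ) ≤ Q := by
    rw [hQ]; exact_mod_cast cvQ_mono a hpos (by omega)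
  have hk1Q : Q ≤ (cvQ a (k+1) : ℝ) := by
    rw [hQ]; exact_mod_cast cvQ_mono a hpos (by omega)
  have hk0 : (0:ℝ) < cvQ a k := by exact_mod_cast (cvQ_pos a hpos k).1
  have herr : |(cvP 0 a k : ℝ) - y * cvQ a k| ≤ 1 / Q := (cv_err a hpos y hy k).trans (by gcongr)
  have e : (u:ℝ) * cvP 0 a k - v * cvQ a k = u * (cvP 0 a k - y * cvQ a k) + cvQ a k * (u * y - v) := by ring
  rw [e] at hge
  have h1 : (1:ℝ) ≤ |(u:ℝ)| * (1 / Q) + Q * |u * y - v| := by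
    refine hge.trans ((abs_add_le _ _).trans ?_)
    rw [abs_mul, abs_mul, abs_of_pos hk0]
    gcongr
  have hn1R : 2 * |(u:ℝ)| ≤ Q := by rw [hQ]; exact_mod_cast hn1
  have hn2R : Q ≤ (M+1) * (2 * |(u:ℝ)|) := by rw [hQ]; exact_mod_cast hn2
  have h2 : |(u:ℝ)| * (1 / Q) ≤ 1 / 2 := by
    rw [mul_one_div, div_le_iff₀ (by linarith)]; linarith
  have h3 : 1 / 2 ≤ (M+1) * (2 * |(u:ℝ)|) * |u * y - v| := by
    have := mul_le_mul_of_nonneg_right hn2R (abs_nonneg (u * y - v))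
    linarith
  rw [div_le_iff₀ (by positivity)]
  linarith

lemma cvQ_congr (a b : ℕ → ℕ) (s : ℕ) (h : ∀ i < s, b i = a i) : ∀ j, (j ≤ s → cvQ b j = cvQ a j ∧ cvP 0 b j = cvP 0 a j) ∧
    (j + 1 ≤ s → cvQ b (j+1) = cvQ a (j+1) ∧ cvP 0 b (j+1) = cvP 0 a (j+1)) := by
  intro j
  induction j with
  | zero =>
    refine ⟨fun _ => ⟨rfl, rfl⟩, fun h1 => ?_⟩
    have := h 0 (by omega)
    simp [cvQ, cvP, this]
  | succ j ih =>
    refine ⟨ih.2, fun h1 => ?_⟩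
    rw [cvQ_succ2, cvQ_succ2, cvP_succ2, cvP_succ2, h (j+1) (by omega), (ih.1 (by omega)).1, (ih.1 (by omega)).2, (ih.2 (by omega)).1, (ih.2 (by omega)).2]
    exact ⟨rfl, rfl⟩

lemma cv_concat (a : ℕ → ℕ) (m s : ℕ) : 
   (cvQ a (m+1+s) = cvQ a (m+1) * cvQ (fun i => a (i+(m+1))) s + cvQ a m * cvP 0 (fun i => a (i+(m+1))) s ∧
    cvP 0 a (m+1+s) = cvP 0 a (m+1) * cvQ (fun i => a (i+(m+1))) s + cvP 0 a m * cvP 0 (fun i => a (i+(m+1))) s) ∧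
   (cvQ a (m+1+s+1) = cvQ a (m+1) * cvQ (fun i => a (i+(m+1))) (s+1) + cvQ a m * cvP 0 (fun i => a (i+(m+1))) (s+1) ∧
    cvP 0 a (m+1+s+1) = cvP 0 a (m+1) * cvQ (fun i => a (i+(m+1))) (s+1) + cvP 0 a m * cvP 0 (fun i => a (i+(m+1))) (s+1)) := by
  induction s with
  | zero =>
    refine ⟨by simp [cvQ, cvP], ?_⟩
    rw [show m + 1 + 0 + 1 = m + 2 by ring, cvQ_succ2, cvP_succ2]
    simp [cvQ, cvP, mul_comm]
  | succ s ih =>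
    refine ⟨ih.2, ?_⟩
    rw [show m + 1 + (s+1) + 1 = m + 1 + s + 2 by ring, cvQ_succ2, cvP_succ2, cvQ_succ2, cvP_succ2, ih.1.1, ih.1.2, ih.2.1, ih.2.2]
    rw [show (s + 1 + (m+1)) = m + 1 + s + 1 by ring]
    constructor <;> ring

lemma cvP_nonneg (a : ℕ → ℕ) (n : ℕ) : 0 ≤ cvP 0 a n ∧ 0 ≤ cvP 0 a (n+1) := by
  induction n with
  | zero => simp [cvP]
  | succ n ih => refine ⟨ih.2, ?_⟩; rw [cvP_succ2]; have := ih.1; have := ih.2; positivity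

lemma cv_periodic (a : ℕ → ℕ) (hpos : ∀ i, 0 < a i) (y : ℝ)
    (hy : Filter.Tendsto (fun n => (cvP 0 a n : ℝ) / (cvQ a n : ℝ)) Filter.atTop (nhds y)) (m s : ℕ)
    (hper : ∀ i < s, a (i + (m+1)) = a i) :
    |((cvP 0 a (m+1) : ℝ) - y * cvQ a (m+1)) + y * (cvP 0 a m - y * cvQ a m)| ≤ 2 / (cvQ a (m+1) * (cvQ a s : ℝ) ^ 2) := by
  obtain ⟨⟨c1, c2⟩, -⟩ := cv_concat a m s
  obtain ⟨d1, d2⟩ := (cvQ_congr a (fun i => a (i + (m+1))) s hper s).1 le_rfl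
  rw [d1, d2] at c1 c2
  have hr := cv_err a hpos y hy (m+1+s)
  have hm := cv_err a hpos y hy m
  have hs := cv_err a hpos y hy s
  have q1 : (1:ℝ) ≤ cvQ a (m+1) := by exact_mod_cast (cvQ_pos a hpos (m+1)).1
  have q2 : (1:ℝ) ≤ cvQ a s := by exact_mod_cast (cvQ_pos a hpos s).1
  have q3 : (cvQ a s : ℝ) ≤ cvQ a (s+1) := by exact_mod_cast (cvQ_pos a hpos s).2
  have q4 : (cvQ a (m+1) : ℝ) * cvQ a s ≤ cvQ a (m+1+s+1) := by
    have : cvQ a (m+1) * cvQ a s ≤ cvQ a (m+1+s+1) := by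
      refine le_trans ?_ (cvQ_pos a hpos (m+1+s)).2
      rw [c1]
      have := (cvQ_pos a hpos m).1
      have := (cvP_nonneg a s).1
      nlinarith
    exact_mod_cast this
  have c1R : (cvQ a (m+1+s) : ℝ) = cvQ a (m+1) * cvQ a s + cvQ a m * cvP 0 a s := by exact_mod_cast c1
  have c2R : (cvP 0 a (m+1+s) : ℝ) = cvP 0 a (m+1) * cvQ a s + cvP 0 a m * cvP 0 a s := by exact_mod_cast c2
  have key : (cvQ a s : ℝ) * (((cvP 0 a (m+1) : ℝ) - y * cvQ a (m+1)) + y * (cvP 0 a m - y * cvQ a m)) 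
     = (cvP 0 a (m+1+s) - y * cvQ a (m+1+s)) - (cvP 0 a m - y * cvQ a m) * (cvP 0 a s - y * cvQ a s) := by
    rw [c1R, c2R]; ring
  have h1 : |(cvQ a s : ℝ) * (((cvP 0 a (m+1) : ℝ) - y * cvQ a (m+1)) + y * (cvP 0 a m - y * cvQ a m))| ≤ 2 / (cvQ a (m+1) * cvQ a s) := by
    rw [key]
    refine (abs_sub _ _).trans ?_
    rw [abs_mul]
    calc _ ≤ 1 / ((cvQ a (m+1) : ℝ) * cvQ a s) + (1 / cvQ a (m+1)) * (1 / cvQ a s) := by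
          gcongr
          · exact hr.trans (by gcongr)
          · exact hs.trans (by gcongr)
      _ = _ := by field_simp; norm_num
  rw [abs_mul, abs_of_pos (by linarith), ← le_div_iff₀' (by linarith)] at h1
  refine h1.trans (le_of_eq ?_)
  field_simp

end

section

open Filter Topology

theorem cf_contra (α : ℝ) (halg : IsAlgebraic ℚ α) (hdeg : 3 ≤ (minpoly ℚ α).natDegree)
    (a0 : ℤ) (a : ℕ → ℕ) (hpos : ∀ i, 0 < a i)
    (hα : Tendsto (fun l => (cvP a0 a l : ℝ) / (cvQ a l : ℝ)) atTop (𝓝 α)) (M : ℕ) (hM : ∀ i, a i ≤ M) :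
    ∃ y : ℝ, IsAlgebraic ℚ y ∧ |y| ≤ 1 ∧ (∀ c : Fin 3 → ℤ, ev3 y c = 0 → c = 0) ∧
      Tendsto (fun l => (cvP 0 a l : ℝ) / (cvQ a l : ℝ)) atTop (𝓝 y) := by
  have hlim : Tendsto (fun l => (cvP 0 a l : ℝ) / (cvQ a l : ℝ)) atTop (𝓝 (α - a0)) := by
    refine (hα.sub_const (a0:ℝ)).congr fun l => ?_
    have q : (cvQ a l : ℝ) ≠ 0 := by have := (cvQ_pos a hpos l).1; exact_mod_cast (by omega : cvQ a l ≠ 0)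
    rw [(cvP_shift a0 a l).1]; push_cast; field_simp; ring
  refine ⟨α - a0, halg.sub (isAlgebraic_intCast _), ?_, ?_, hlim⟩
  · have := cv_err a hpos _ hlim 0
    simp only [cvP, cvQ] at this
    have h1 : (1:ℝ) ≤ a 0 := by exact_mod_cast hpos 0
    simp at this
    rw [abs_sub_comm] at this
    exact this.trans (inv_le_one_of_one_le₀ h1)
  · intro c hc
    set P : Polynomial ℚ := Polynomial.C (c 0 : ℚ) + Polynomial.C (c 1 : ℚ) * (Polynomial.X - Polynomial.C (a0:ℚ)) + Polynomial.C (c 2 : ℚ) * (Polynomial.X - Polynomial.C (a0:ℚ)) ^ 2 with hP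
    have hev : Polynomial.aeval α P = 0 := by
      rw [hP, ← hc]; simp [ev3]
    have hP0 : P = 0 := by
      by_contra hne
      have h1 := Polynomial.natDegree_le_natDegree (minpoly.degree_le_of_ne_zero ℚ α hne hev)
      have h2 : P.natDegree ≤ 2 := by rw [hP]; compute_degree
      omega
    have e0 := congrArg (Polynomial.eval (a0:ℚ)) hP0
    have e1 := congrArg (Polynomial.eval (a0+1:ℚ)) hP0
    have e2 := congrArg (Polynomial.eval (a0-1:ℚ)) hP0
    simp [hP] at e0 e1 e2
    have f0 : (c 0 : ℚ) = 0 := by exact_mod_cast e0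
    have f1 : (c 1 : ℚ) = 0 := by rw [e0] at e1 e2; push_cast at e1 e2; linarith
    have f2 : (c 2 : ℚ) = 0 := by rw [e0] at e1 e2; push_cast at e1 e2; linarith
    funext i
    fin_cases i
    · exact_mod_cast f0
    · exact_mod_cast f1
    · exact_mod_cast f2

theorem cf_recur (y : ℝ) (halg : IsAlgebraic ℚ y) (hy1 : |y| ≤ 1) (hquad : ∀ c : Fin 3 → ℤ, ev3 y c = 0 → c = 0) 
    (a : ℕ → ℕ) (hpos : ∀ i, 0 < a i)
    (hy : Tendsto (fun l => (cvP 0 a l : ℝ) / (cvQ a l : ℝ)) atTop (𝓝 y)) (M : ℕ) (hM : ∀ i, a i ≤ M)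
    (L n0 : ℕ) (η : ℝ) (hη : 0 < η)
    (hrec : ∀ n, n0 ≤ n → ∃ r s : ℕ, n ≤ r ∧ r ≤ L * n ∧ 2 ≤ s ∧ η * r ≤ s ∧ ∀ i < s, a (i + r) = a i) : False := by
  have hM1 : 1 ≤ M := (hpos 0).trans_le (hM 0)
  have hM1R : (1:ℝ) ≤ M := by exact_mod_cast hM1
  set lM := Real.log (M + 1) with hlM
  have hlM0 : 0 < lM := Real.log_pos (by linarith)
  have hl2 : 1 / 2 < Real.log 2 := by have := Real.log_two_gt_d9; linarith
  have hlogge : ∀ n : ℕ, ((n:ℝ) - 1) / 2 * Real.log 2 ≤ Real.log (cvQ a n) := by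
    intro n
    have h1 : ((2:ℝ) ^ (n / 2)) ≤ cvQ a n := by exact_mod_cast cvQ_ge_pow a hpos n
    have h2 := Real.log_le_log (by positivity) h1
    rw [Real.log_pow] at h2
    refine le_trans ?_ h2
    gcongr
    have : n ≤ 2 * (n / 2) + 1 := by omega
    have : (n:ℝ) ≤ 2 * ((n / 2 : ℕ) : ℝ) + 1 := by exact_mod_cast this
    linarith
  have hlogle : ∀ n : ℕ, Real.log (cvQ a n) ≤ n * lM := by
    intro n
    have q1 : (1:ℝ) ≤ cvQ a n := by exact_mod_cast (cvQ_pos a hpos n).1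
    have h1 : (cvQ a n : ℝ) ≤ ((M:ℝ) + 1) ^ n := by exact_mod_cast cvQ_le_pow a hpos M hM n
    have h2 := Real.log_le_log (by linarith) h1
    rwa [Real.log_pow] at h2
  set τ := η / (4 * lM) with hτ
  have hτ0 : 0 < τ := by positivity
  have hL : (0:ℝ) ≤ L := by positivity
  refine final_approx y halg hy1 hquad (1 / (4 * (M + 1))) (by positivity) (cv_bad a hpos M hM y hy) (M + 1) τ (9 * L * lM + 1) (n0 + 4)
    (by linarith) hτ0 (by positivity) ?_
  intro R hR
  have hn0 : (0:ℝ) ≤ n0 := by positivity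
  obtain ⟨r, s, hr1, hr2, hs, hηs, hper⟩ := hrec ⌈8 * R⌉₊ (by
    have : (n0:ℝ) ≤ ⌈8 * R⌉₊ := le_trans (by linarith) (Nat.le_ceil _)
    exact_mod_cast this)
  have hr1R : 8 * R ≤ r := (Nat.le_ceil _).trans (by exact_mod_cast hr1)
  have hr2R : (r:ℝ) ≤ L * (8 * R + 1) := by
    calc (r:ℝ) ≤ L * (⌈8 * R⌉₊ : ℝ) := by exact_mod_cast hr2
      _ ≤ _ := by gcongr; exact (Nat.ceil_lt_add_one (by linarith)).le
  have hr4 : 32 ≤ r := by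
    have : (32:ℝ) ≤ r := by linarith
    exact_mod_cast this
  obtain ⟨m, rfl⟩ : ∃ m, r = m + 1 := ⟨r - 1, by omega⟩
  push_cast at hr1R hr2R hηs
  have q1 : (1:ℝ) ≤ cvQ a m := by exact_mod_cast (cvQ_pos a hpos m).1
  have q12 : (cvQ a m : ℝ) ≤ cvQ a (m+1) := by exact_mod_cast (cvQ_pos a hpos m).2
  have q13 : (cvQ a (m+1) : ℝ) ≤ (M + 1) * cvQ a m := by exact_mod_cast cvQ_le_succ a hpos M hM m
  have q14 : (cvQ a (m+1) : ℝ) ≤ cvQ a (m+2) := by exact_mod_cast (cvQ_pos a hpos (m+1)).2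
  have hdet := cv_det a m
  have hdet2 : ((-1:ℤ)) ^ (m+1) * (-1) ^ (m+1) = 1 := by rw [← mul_pow]; simp
  have hm31 : 31 ≤ m := by omega
  have hmR : (31:ℝ) ≤ m := by exact_mod_cast hm31
  refine ⟨cvP 0 a (m+1), cvP 0 a m, cvQ a (m+1), cvQ a m, ?_, ?_, ?_, ?_, ?_, ?_, ?_, ?_, ?_⟩
  · have := (cvQ_ge a hpos m).1
    omega
  · refine le_trans ?_ (hlogge m)
    nlinarith
  · refine (hlogle m).trans ?_
    have h1 : (m:ℝ) ≤ 9 * L * R := by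
      have : (L:ℝ) * (8 * R + 1) ≤ L * (9 * R) := by gcongr; linarith
      linarith
    nlinarith
  · refine ⟨(-1) ^ (m+1) * cvP 0 a m, -((-1) ^ (m+1) * cvP 0 a (m+1)), ?_⟩
    calc _ = (-1:ℤ) ^ (m+1) * (cvP 0 a m * cvQ a (m+1) - cvP 0 a (m+1) * cvQ a m) := by ring
      _ = 1 := by rw [hdet, hdet2]
  · rw [hdet]; exact pow_ne_zero _ (by norm_num)
  · rw [abs_of_pos (by linarith)]; exact q13
  · refine (cv_err a hpos y hy m).trans ?_
    have hh : (1:ℝ) ≤ M + 1 := by linarith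
    gcongr
  · refine (cv_err a hpos y hy (m+1)).trans ?_
    have hh : (1:ℝ) ≤ M + 1 := by linarith
    gcongr
    exact cvQ_mono a hpos (by omega)
  · refine (cv_periodic a hpos y hy m s hper).trans ?_
    have hh : (2:ℝ) ≤ M + 1 := by linarith
    have hq2 : Real.exp (τ * Real.log (cvQ a m)) ≤ (cvQ a s : ℝ) ^ 2 := by
      have qs : (1:ℝ) ≤ cvQ a s := by exact_mod_cast (cvQ_pos a hpos s).1
      rw [← Real.exp_log (show (0:ℝ) < (cvQ a s : ℝ) ^ 2 by positivity)]
      apply Real.exp_le_exp.2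
      rw [Real.log_pow]
      have h1 := hlogge s
      have h2 := hlogle m
      have hsR : (2:ℝ) ≤ s := by exact_mod_cast hs
      have h3 : τ * Real.log (cvQ a m) ≤ τ * (m * lM) := by gcongr
      have h4 : τ * (m * lM) = η * m / 4 := by rw [hτ]; field_simp
      push_cast
      nlinarith
    have hq0 : (0:ℝ) < cvQ a (m+1) := by linarith
    have hq00 : (0:ℝ) < cvQ a m := by linarith
    gcongr

theorem cf_const (y : ℝ) (hquad : ∀ c : Fin 3 → ℤ, ev3 y c = 0 → c = 0) 
    (a : ℕ → ℕ) (hpos : ∀ i, 0 < a i)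
    (hy : Tendsto (fun l => (cvP 0 a l : ℝ) / (cvQ a l : ℝ)) atTop (𝓝 y)) (b : ℕ) (hb : ∀ i, a (i+1) = b) : False := by
  set ε : ℕ → ℝ := fun n => (cvP 0 a n : ℝ) - y * cvQ a n with hε
  have hrec : ∀ n, ε (n+2) = b * ε (n+1) + ε n := by
    intro n
    simp only [hε]
    rw [cvP_succ2, cvQ_succ2, hb]; push_cast; ring
  have hI : ∀ n, |ε (n+1) ^ 2 - b * ε (n+1) * ε n - ε n ^ 2| = |ε 1 ^ 2 - b * ε 1 * ε 0 - ε 0 ^ 2| := by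
    intro n
    induction n with
    | zero => rfl
    | succ n ih =>
      rw [← ih, hrec n, ← abs_neg]; congr 1; ring
  have hbd : ∀ n : ℕ, |ε n| ≤ 1 / (n + 1) := by
    intro n
    refine (cv_err a hpos y hy n).trans ?_
    have : (n + 1 : ℝ) ≤ cvQ a (n+1) := by exact_mod_cast (cvQ_ge a hpos n).2
    gcongr
  have h0 : Tendsto ε atTop (𝓝 0) := squeeze_zero_norm hbd tendsto_one_div_add_atTop_nhds_zero_nat
  have h1 : Tendsto (fun n => ε (n+1)) atTop (𝓝 0) := (tendsto_add_atTop_iff_nat 1).2 h0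
  have h2 : Tendsto (fun n => |ε (n+1) ^ 2 - b * ε (n+1) * ε n - ε n ^ 2|) atTop (𝓝 |0 ^ 2 - b * 0 * 0 - 0 ^ 2|) :=
    (((h1.pow 2).sub ((h1.const_mul _).mul h0)).sub (h0.pow 2)).abs
  have h3 := tendsto_nhds_unique (tendsto_const_nhds.congr fun n => (hI n).symm) h2
  simp at h3
  have h4 : ε 1 ^ 2 - b * ε 1 * ε 0 - ε 0 ^ 2 = 0 := h3
  simp [hε, cvP, cvQ] at h4
  have := congrFun (hquad ![1, -2 * a 0 + b, a 0 ^ 2 - a 0 * b - 1] (by simp [ev3]; linear_combination h4)) 0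
  simp at this

end

section

lemma iterM_append {A : Type*} (σ : A → List A) (n : ℕ) (U V : List A) : iterM σ n (U ++ V) = iterM σ n U ++ iterM σ n V := by
  induction n generalizing U V with
  | zero => rfl
  | succ n ih =>
    simp only [iterM, Function.iterate_succ_apply, List.flatMap_append] at ih ⊢
    exact ih _ _

lemma iterM_add {A : Type*} (σ : A → List A) (m n : ℕ) (U : List A) : iterM σ (m + n) U = iterM σ m (iterM σ n U) := by
  simp only [iterM, Function.iterate_add_apply]

lemma iterM_one {A : Type*} (σ : A → List A) (U : List A) : iterM σ 1 U = U.flatMap σ := rfl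

lemma flatMap_len {A : Type*} (σ : A → List A) (L : ℕ) (hL : ∀ b, (σ b).length ≤ L) (U : List A) :
    (U.flatMap σ).length ≤ L * U.length := by
  induction U with
  | nil => simp
  | cons b U ih =>
    simp only [List.flatMap_cons, List.length_append, List.length_cons]
    have := hL b
    nlinarith

lemma iterM_len {A : Type*} (σ : A → List A) (L : ℕ) (hL : ∀ b, (σ b).length ≤ L) (n : ℕ) (U : List A) :
    (iterM σ n U).length ≤ L ^ n * U.length := by
  induction n with
  | zero => simp [iterM]
  | succ n ih =>
    rw [add_comm, iterM_add, iterM_one]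
    refine (flatMap_len σ L hL _).trans ?_
    rw [pow_add, pow_one, mul_assoc]
    gcongr

lemma fixed_len {A : Type*} (σ : A → List A) (l : A) (h : Prolongable σ l) (n : ℕ) : n + 1 ≤ (iterM σ n [l]).length := by
  obtain ⟨W, hW, hne⟩ := h
  induction n with
  | zero => simp [iterM]
  | succ n ih =>
    have e : iterM σ (n+1) [l] = iterM σ n [l] ++ iterM σ n W := by
      rw [iterM_add, iterM_one, ← iterM_append]; simp [hW]
    rw [e, List.length_append]
    have := List.length_pos_iff.2 (hne n)
    omega

theorem word_recur {A : Type*} (σ : A → List A) (l : A) (x : ℕ → A) (hp : Prolongable σ l) (hx : IsFixedPointSeq σ l x)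
    (L : ℕ) (hL : ∀ b, (σ b).length ≤ L) (hL1 : 1 ≤ L) (j : ℕ) (hj : x (j+1) = l) :
    ∃ (n0 : ℕ) (η : ℝ), 0 < η ∧ ∀ n, n0 ≤ n → ∃ r s : ℕ, n ≤ r ∧ r ≤ L * n ∧ 2 ≤ s ∧ η * r ≤ s ∧ ∀ i < s, x (i + r) = x i := by
  set N := j + 1 with hN
  have hlen := fixed_len σ l hp N
  have hjlt : N < (iterM σ N [l]).length := by omega
  have hget : (iterM σ N [l])[N] = l := by
    have := hx N N hjlt
    rw [List.getElem?_eq_getElem hjlt] at this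
    exact (Option.some.inj this).trans hj
  set U := (iterM σ N [l]).take N with hU
  set V := (iterM σ N [l]).drop (N+1) with hV
  have hdec : iterM σ N [l] = U ++ ([l] ++ V) := by
    rw [hU, hV]
    conv_lhs => rw [← List.take_append_drop N (iterM σ N [l]), List.drop_eq_getElem_cons hjlt, hget]
    rfl
  have hx0 : x 0 = l := by
    have := hx 0 0 (by simp [iterM])
    simpa [iterM] using this.symm
  have hUlen : U.length = N := by rw [hU, List.length_take]; omega
  obtain ⟨U', hU'⟩ : ∃ U', U = l :: U' := by
    have h0 : (0:ℕ) < U.length := by omega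
    have e : U[0] = l := by
      have := hx N 0 (by omega)
      rw [List.getElem?_eq_getElem (by omega), hx0] at this
      have := Option.some.inj this
      rw [← this]; simp [hU]
    cases hUU : U with
    | nil => rw [hUU] at h0; simp at h0
    | cons u U' => refine ⟨U', ?_⟩; simp only [hUU] at e; simpa using e
  set s : ℕ → ℕ := fun k => (iterM σ k [l]).length with hs
  set r : ℕ → ℕ := fun k => (iterM σ k U).length with hr
  have hdk : ∀ k, iterM σ (k + N) [l] = iterM σ k U ++ (iterM σ k [l] ++ iterM σ k V) := by
    intro k
    rw [iterM_add, hdec, iterM_append, iterM_append]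
  have hper : ∀ k, ∀ i < s k, x (i + r k) = x i := by
    intro k i hi
    have h1 := hx k i hi
    have h2 := hx (k + N) (i + r k) (by rw [hdk]; simp only [List.length_append]; simp only [hs, hr] at hi ⊢; omega)
    rw [hdk, List.getElem?_append_right (by simp only [hr]; omega), List.getElem?_append_left (by simp only [hs, hr] at hi ⊢; omega)] at h2
    simp only [hr, Nat.add_sub_cancel] at h2
    rw [h1] at h2
    simp only [hr]
    exact (Option.some.inj h2).symm
  have hrs : ∀ k, r k ≤ L ^ N * s k := by
    intro k
    have h1 : r k ≤ (iterM σ (k + N) [l]).length := by rw [hdk, List.length_append]; simp only [hr]; omega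
    refine h1.trans ?_
    rw [add_comm, iterM_add]
    exact iterM_len σ L hL N _
  have hrk : ∀ k, k + 1 ≤ r k := by
    intro k
    refine (fixed_len σ l hp k).trans ?_
    simp only [hr]
    rw [hU', show l :: U' = [l] ++ U' from rfl, iterM_append, List.length_append]; omega
  have hrL : ∀ k, r (k+1) ≤ L * r k := by
    intro k
    simp only [hr]
    rw [add_comm, iterM_add, iterM_one]
    exact flatMap_len σ L hL _
  have hLN : 1 ≤ L ^ N := Nat.one_le_pow _ _ hL1
  refine ⟨r 0 + 2 * L ^ N, 1 / (L ^ N : ℕ), by positivity, fun n hn => ?_⟩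
  have hex : ∃ k, n ≤ r k := ⟨n, by have := hrk n; omega⟩
  classical
  set k := Nat.find hex with hk
  have hk1 : n ≤ r k := Nat.find_spec hex
  have hk2 : r k ≤ L * n := by
    rcases Nat.eq_zero_or_pos k with h0 | h0
    · rw [h0]; nlinarith
    · have h := Nat.find_min hex (m := k - 1) (by omega)
      have h2 := hrL (k-1)
      rw [show k - 1 + 1 = k by omega] at h2
      push Not at h
      refine h2.trans ?_
      gcongr
  refine ⟨r k, s k, hk1, hk2, ?_, ?_, hper k⟩
  · have h1 := hrs k
    by_contra! h
    have : L ^ N * s k ≤ L ^ N * 1 := by gcongr; omega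
    omega
  · rw [one_div, inv_mul_le_iff₀ (by positivity)]
    exact_mod_cast hrs k

end

/-- Corollary of Theorem 3: the continued fraction expansion of an algebraic
number of degree at least three cannot be generated by a binary morphism, i.e.
a morphism on a two-letter alphabet.  Here `a0` and `(a i)` are the partial
quotients of `α`, i.e. `α = [a_0; a_1, a_2, …]`. -/
theorem statement5 (α : ℝ) (halg : IsAlgebraic ℚ α) (hdeg : 3 ≤ (minpoly ℚ α).natDegree)
    (a0 : ℤ) (a : ℕ → ℕ) (hpos : ∀ i, 0 < a i)
    (hα : Tendsto (fun ℓ => (cvP a0 a ℓ : ℝ) / (cvQ a ℓ : ℝ)) atTop (𝓝 α)) :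
    ¬ ∃ (A : Type) (_ : Nat.card A = 2) (σ : A → List A) (l : A) (x : ℕ → A) (φ : A → ℕ),
        Prolongable σ l ∧ IsFixedPointSeq σ l x ∧
        (∀ i, a i = φ (x i)) := by
  rintro ⟨A, hA, σ, l, x, φ, hp, hx, ha⟩
  have hfin : Finite A := Nat.finite_of_card_ne_zero (by omega)
  obtain ⟨M, hM⟩ : ∃ M, ∀ b, φ b ≤ M := by
    obtain ⟨M, hM⟩ := (Set.finite_range φ).bddAbove
    exact ⟨M, fun b => hM ⟨b, rfl⟩⟩
  obtain ⟨L, hL⟩ : ∃ L, ∀ b, (σ b).length ≤ L := by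
    obtain ⟨L, hL⟩ := (Set.finite_range fun b => (σ b).length).bddAbove
    exact ⟨L, fun b => hL ⟨b, rfl⟩⟩
  have haM : ∀ i, a i ≤ M := fun i => by rw [ha]; exact hM _
  obtain ⟨y, hyalg, hy1, hquad, hy⟩ := cf_contra α halg hdeg a0 a hpos hα M haM
  by_cases hrec : ∃ j, x (j+1) = l
  · obtain ⟨j, hj⟩ := hrec
    obtain ⟨n0, η, hη, h⟩ := word_recur σ l x hp hx (L+1) (fun b => (hL b).trans (by omega)) (by omega) j hj
    refine cf_recur y hyalg hy1 hquad a hpos hy M haM (L+1) n0 η hη fun n hn => ?_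
    obtain ⟨r, s, h1, h2, h3, h4, h5⟩ := h n hn
    exact ⟨r, s, h1, h2, h3, h4, fun i hi => by rw [ha, ha, h5 i hi]⟩
  · push Not at hrec
    obtain ⟨u, v, huv, hun⟩ := Nat.card_eq_two_iff.1 hA
    have hconst : ∀ i, x (i+1) = x (0+1) := by
      intro i
      have hc : ∀ b : A, b = u ∨ b = v := fun b => by
        have : b ∈ ({u, v} : Set A) := by rw [hun]; trivial
        simpa using this
      have h1 := hrec i
      have h2 := hrec 0
      rcases hc l with e | e <;> rcases hc (x (i+1)) with e1 | e1 <;> rcases hc (x (0+1)) with e2 | e2 <;> simp_all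
    exact cf_const y hquad a hpos hy (φ (x (0+1))) fun i => by rw [ha, hconst]
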